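/- arXiv:1306.1775 — 2 statements merged into one kernel-verified Lean document; each statement's English description precedes it below -/
import Mathlib

section
/- For the boundary driven Kawasaki process on 𝒢_N with N ≥ 5 and parameters satisfying μ_L > κ > 0 > μ_R and |μ_R| > κ: the function Ψ = Γ − Θ is constant on 𝒟 = {η_{p,q} : p ≥ 3, q ≥ 2, p+q=N}, and Ψ(x) > Ψ(y) for every x ∈ 𝒟 and every y ∈ 𝒢_N \ 𝒟; i.e. the maximizers of Ψ are exactly the configurations η_{p,q} with p ≥ 3, q ≥ 2. -/
open scoped Classical

namespace Kawasaki

/-- Configurations of the lattice gas on `{1,…,N}`: each site is occupied (`true`) or empty. -/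
abbrev Config (N : ℕ) := Fin N → Bool

/-- Occupation number of site `i` as a real number. -/
noncomputable def occ {N : ℕ} (x : Config N) (i : Fin N) : ℝ := if x i then 1 else 0

/-- The nearest-neighbour interaction energy `E(x) = -κ ∑ x(i) x(i+1)`. -/
noncomputable def energy {N : ℕ} (κ : ℝ) (x : Config N) : ℝ :=
  -κ * ∑ i : Fin N, ∑ j : Fin N, if (j : ℕ) = (i : ℕ) + 1 then occ x i * occ x j else 0

/-- `x^{i,j}`: the configuration with the occupations of `i` and `j` interchanged. -/
def swapConf {N : ℕ} (x : Config N) (i j : Fin N) : Config N :=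
  Function.update (Function.update x i (x j)) j (x i)

/-- `x^i`: the configuration with the occupation at `i` flipped. -/
def flipConf {N : ℕ} (x : Config N) (i : Fin N) : Config N :=
  Function.update x i (!x i)

/-- The last site. -/
def lastIdx (N : ℕ) [NeZero N] : Fin N :=
  ⟨N - 1, Nat.sub_lt (Nat.pos_of_ne_zero (NeZero.ne N)) Nat.one_pos⟩

/-- `y` is obtained from `x` by exchanging the occupations of two nearest neighbours. -/
def IsSwap {N : ℕ} (x y : Config N) : Prop :=
  ∃ i j : Fin N, (j : ℕ) = (i : ℕ) + 1 ∧ y = swapConf x i j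

/-- The allowed transitions: nearest-neighbour exchanges in the bulk,
birth/death at the two boundary sites. -/
def Allowed {N : ℕ} [NeZero N] (x y : Config N) : Prop :=
  y ≠ x ∧ (IsSwap x y ∨ y = flipConf x 0 ∨ y = flipConf x (lastIdx N))

/-- The transition rates of the boundary driven Kawasaki process at inverse temperature `β`. -/
noncomputable def rate {N : ℕ} [NeZero N] (κ μL μR β : ℝ) (x y : Config N) : ℝ :=
  if y = x then 0
  else if IsSwap x y then Real.exp (-(β / 2) * (energy κ y - energy κ x))
  else if y = flipConf x 0 then
    Real.exp (β * μL / 2 * (1 - 2 * occ x 0)) *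
      Real.exp (-(β / 2) * (energy κ y - energy κ x))
  else if y = flipConf x (lastIdx N) then
    Real.exp (β * μR / 2 * (1 - 2 * occ x (lastIdx N))) *
      Real.exp (-(β / 2) * (energy κ y - energy κ x))
  else 0

/-- `ρ` is a stationary probability distribution for the rates at inverse temperature `β`. -/
noncomputable def IsStationary {N : ℕ} [NeZero N] (κ μL μR β : ℝ) (ρ : Config N → ℝ) : Prop :=
  (∀ x, 0 ≤ ρ x) ∧ (∑ x, ρ x = 1) ∧
  ∀ x, ∑ y, ρ y * rate κ μL μR β y x = ρ x * ∑ y, rate κ μL μR β x y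

/-- `φ(x,y) = lim_{β→∞} (1/β) log k(x→y;β)` (computed explicitly, the rates being
pure exponentials in `β`). -/
noncomputable def phi {N : ℕ} [NeZero N] (κ μL μR : ℝ) (x y : Config N) : ℝ :=
  if IsSwap x y then -(energy κ y - energy κ x) / 2
  else if y = flipConf x 0 then
    μL * (1 - 2 * occ x 0) / 2 - (energy κ y - energy κ x) / 2
  else if y = flipConf x (lastIdx N) then
    μR * (1 - 2 * occ x (lastIdx N)) / 2 - (energy κ y - energy κ x) / 2
  else 0

/-- `Γ(x) = -max_y φ(x,y)` (maximum over the allowed transitions from `x`). -/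
noncomputable def Gam {N : ℕ} [NeZero N] (κ μL μR : ℝ) (x : Config N) : ℝ :=
  - sSup (phi κ μL μR x '' {y | Allowed x y})

/-- `U(x,y) = -φ(x,y) - Γ(x)` (meaningful on allowed transitions). -/
noncomputable def Ucost {N : ℕ} [NeZero N] (κ μL μR : ℝ) (x y : Config N) : ℝ :=
  - phi κ μL μR x y - Gam κ μL μR x

/-- The cost `U(D)` of a path: sum of `U` over consecutive steps. -/
noncomputable def pathCost {N : ℕ} [NeZero N] (κ μL μR : ℝ) : List (Config N) → ℝ
  | [] => 0
  | [_] => 0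
  | a :: b :: l => Ucost κ μL μR a b + pathCost κ μL μR (b :: l)

/-- `𝒰(x,y)`: the minimal cost over all paths of allowed transitions from `x` to `y`. -/
noncomputable def Ucal {N : ℕ} [NeZero N] (κ μL μR : ℝ) (x y : Config N) : ℝ :=
  sInf { c | ∃ L : List (Config N), L.Chain' Allowed ∧ L.head? = some x ∧
    L.getLast? = some y ∧ c = pathCost κ μL μR L }

/-- `t` encodes a spanning tree of the transition graph with all edges oriented toward `x`:
`t y` is the successor of `y` on the unique path from `y` to the root `x`. -/
def IsInTree {N : ℕ} [NeZero N] (t : Config N → Config N) (x : Config N) : Prop :=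
  t x = x ∧ (∀ y, y ≠ x → Allowed y (t y)) ∧ ∀ y, ∃ n : ℕ, t^[n] y = x

/-- `U(𝒯_x)`: the sum of `U` over all (oriented) edges of the in-tree. -/
noncomputable def treeCost {N : ℕ} [NeZero N] (κ μL μR : ℝ) (t : Config N → Config N)
    (x : Config N) : ℝ :=
  ∑ y : Config N, if y = x then 0 else Ucost κ μL μR y (t y)

/-- `Θ(x) = min_𝒯 U(𝒯_x)`. -/
noncomputable def Theta {N : ℕ} [NeZero N] (κ μL μR : ℝ) (x : Config N) : ℝ :=
  sInf { c | ∃ t, IsInTree t x ∧ c = treeCost κ μL μR t x }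

/-- `Ψ = Γ - Θ`. -/
noncomputable def Psi {N : ℕ} [NeZero N] (κ μL μR : ℝ) (x : Config N) : ℝ :=
  Gam κ μL μR x - Theta κ μL μR x

/-- `η_{p,q}`: `p` occupied sites followed by `q = N - p` empty sites. -/
def eta (N p : ℕ) : Config N := fun i => decide ((i : ℕ) < p)

/-- `x ∈ 𝒟` iff `x = η_{p,q}` with `p ≥ 3`, `q ≥ 2`, `p + q = N`. -/
def memD {N : ℕ} (x : Config N) : Prop :=
  ∃ p q : ℕ, 3 ≤ p ∧ 2 ≤ q ∧ p + q = N ∧ x = eta N p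

/-- The configuration written in block form `(p_0,q_0,…,p_n,q_n)`:
`p_0` occupied sites, then `q_0` empty sites, and so on. -/
def blockConfig (ps qs : List ℕ) : List Bool :=
  (ps.zip qs).flatMap fun pq => List.replicate pq.1 true ++ List.replicate pq.2 false

/-- `x ∈ 𝒫`: block form `(p_0,q_0,…,p_n,q_n)` with all `p_i ≥ 3`,
`q_i ≥ 3` for `i < n` and `q_n ≥ 2`. -/
def memP {N : ℕ} (x : Config N) : Prop :=
  ∃ ps qs : List ℕ, ps.length = qs.length ∧ 0 < ps.length ∧
    (∀ p ∈ ps, 3 ≤ p) ∧ (∀ q ∈ qs.dropLast, 3 ≤ q) ∧ (∀ q ∈ qs.getLast?, 2 ≤ q) ∧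
    List.ofFn x = blockConfig ps qs

/-- `y` is obtained from `x` by one occupation switch of the form
`…11100… → …11010…` or `…00111… → …01011…`. -/
def isSwitchE {N : ℕ} (x y : Config N) : Prop :=
  (∃ a : ℕ, ∃ h : a + 4 < N,
    x ⟨a, by omega⟩ = true ∧ x ⟨a + 1, by omega⟩ = true ∧ x ⟨a + 2, by omega⟩ = true ∧
    x ⟨a + 3, by omega⟩ = false ∧ x ⟨a + 4, by omega⟩ = false ∧
    y = swapConf x ⟨a + 2, by omega⟩ ⟨a + 3, by omega⟩) ∨
  (∃ a : ℕ, ∃ h : a + 4 < N,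
    x ⟨a, by omega⟩ = false ∧ x ⟨a + 1, by omega⟩ = false ∧ x ⟨a + 2, by omega⟩ = true ∧
    x ⟨a + 3, by omega⟩ = true ∧ x ⟨a + 4, by omega⟩ = true ∧
    y = swapConf x ⟨a + 1, by omega⟩ ⟨a + 2, by omega⟩)

/-- `y ∈ ℰ`: obtained from some `x ∈ 𝒫` by one such switch. -/
def memE {N : ℕ} (y : Config N) : Prop := ∃ x : Config N, memP x ∧ isSwitchE x y

/-- `y` is a preferred successor of `x`: an allowed transition with `U(x,y) = 0`. -/
def PreferredStep {N : ℕ} [NeZero N] (κ μL μR : ℝ) (x y : Config N) : Prop :=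
  Allowed x y ∧ Ucost κ μL μR x y = 0

/-- `𝒜_x`: the set consisting of `x` together with all its preferred successors. -/
def Attr {N : ℕ} [NeZero N] (κ μL μR : ℝ) (x : Config N) : Set (Config N) :=
  insert x {y | PreferredStep κ μL μR x y}

/-- A nonempty set `A` is an attractor when `𝒰 = 0` inside `A` and `𝒰 > 0` from `A`
to its complement. -/
def IsAttractor {N : ℕ} [NeZero N] (κ μL μR : ℝ) (A : Set (Config N)) : Prop :=
  A.Nonempty ∧ (∀ x ∈ A, ∀ y ∈ A, x ≠ y → Ucal κ μL μR x y = 0) ∧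
  ∀ x ∈ A, ∀ y, y ∉ A → 0 < Ucal κ μL μR x y

end Kawasaki

namespace Kawasaki

section Trees

variable {V : Type*}

/-- `t` is a spanning tree of the graph `A`, oriented toward the root `x`. -/
def InTree (A : V → V → Prop) (t : V → V) (x : V) : Prop :=
  t x = x ∧ (∀ y, y ≠ x → A y (t y)) ∧ ∀ y, ∃ n : ℕ, t^[n] y = x

/-- The total weight of the edges of an in-tree. -/
noncomputable def weight [Fintype V] (φ : V → V → ℝ) (t : V → V) (x : V) : ℝ :=
  ∑ y : V, if y = x then 0 else φ y (t y)

/-- Following `a → b` out of the root `a` and cutting at `b'` gives a tree rooted at `b'`. -/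
lemma InTree.reroot {A : V → V → Prop} {t : V → V} {a b b' : V} (ht : InTree A t a)
    (hab : A a b) (hb' : b' ≠ a)
    (hk : ∃ k, t^[k] b = b' ∧ ∀ j < k, t^[j] b ≠ a) :
    InTree A (Function.update (Function.update t a b) b' b') b' := by
  obtain ⟨k, hkb, hka⟩ := hk
  set t' := Function.update (Function.update t a b) b' b' with ht'
  have hother : ∀ y, y ≠ b' → y ≠ a → t' y = t y := by
    intro y h1 h2
    simp [ht', Function.update_of_ne h1, Function.update_of_ne h2]
  have hta : t' a = b := by simp [ht', Function.update_of_ne hb'.symm]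
  have hchain : ∀ j ≤ k, ∃ n, t'^[n] (t^[k - j] b) = b' := by
    intro j
    induction j with
    | zero => intro _; exact ⟨0, by simpa using hkb⟩
    | succ j ih =>
      intro hj
      obtain ⟨n, hn⟩ := ih (by omega)
      by_cases hu : t^[k - (j + 1)] b = b'
      · exact ⟨0, by simpa using hu⟩
      · refine ⟨n + 1, ?_⟩
        rw [Function.iterate_succ_apply, hother _ hu (hka _ (by omega)),
          ← Function.iterate_succ_apply' t]
        rw [show (k - (j + 1)).succ = k - j by omega]
        exact hn
  refine ⟨by simp [ht'], ?_, ?_⟩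
  · intro y hy
    by_cases hya : y = a
    · subst hya; rw [hta]; exact hab
    · rw [hother y hy hya]; exact ht.2.1 y hya
  · have key : ∀ n y, t^[n] y = a → ∃ m, t'^[m] y = b' := by
      intro n
      induction n with
      | zero =>
        intro y hy
        have hy : y = a := by simpa using hy
        obtain ⟨m, hm⟩ := hchain k le_rfl
        refine ⟨m + 1, ?_⟩
        rw [Function.iterate_succ_apply, hy, hta]
        simpa using hm
      | succ n ih =>
        intro y hy
        by_cases h1 : y = b'
        · exact ⟨0, by simpa using h1⟩
        by_cases h2 : y = a
        · obtain ⟨m, hm⟩ := hchain k le_rfl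
          refine ⟨m + 1, ?_⟩
          rw [Function.iterate_succ_apply, h2, hta]
          simpa using hm
        · rw [Function.iterate_succ_apply] at hy
          obtain ⟨m, hm⟩ := ih _ hy
          exact ⟨m + 1, by rw [Function.iterate_succ_apply, hother y h1 h2]; exact hm⟩
    intro y
    obtain ⟨n, hn⟩ := ht.2.2 y
    exact key n y hn

lemma weight_reroot [Fintype V] (φ : V → V → ℝ) {t : V → V} {a b b' : V} (hb' : b' ≠ a) :
    weight φ (Function.update (Function.update t a b) b' b') b' + φ b' (t b') =
      weight φ t a + φ a b := by
  have h1 : weight φ t a + φ a b = ∑ y, φ y (Function.update t a b y) := by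
    unfold weight
    rw [← Finset.sum_erase_add _ _ (Finset.mem_univ a),
      ← Finset.sum_erase_add (Finset.univ) (fun y => φ y (Function.update t a b y))
        (Finset.mem_univ a)]
    simp only [if_true, Function.update_self, add_zero]
    congr 1
    refine Finset.sum_congr rfl fun y hy => ?_
    have := Finset.ne_of_mem_erase hy
    simp [this]
  rw [h1]
  unfold weight
  rw [← Finset.sum_erase_add _ _ (Finset.mem_univ b'),
    ← Finset.sum_erase_add (Finset.univ) (fun y => φ y (Function.update t a b y))
        (Finset.mem_univ b')]
  simp only [if_true, add_zero, Function.update_of_ne hb']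
  congr 1
  refine Finset.sum_congr rfl fun y hy => ?_
  have := Finset.ne_of_mem_erase hy
  simp [this]

/-- If `F` is the maximal tree weight (up to a constant), then for every cut and every edge
leaving it some edge entering it carries at least the same flux. -/
lemma cut_of_isGreatest [Fintype V] {A : V → V → Prop} {φ : V → V → ℝ} {F : V → ℝ} {C : ℝ}
    (hF : ∀ x, IsGreatest {c | ∃ t, InTree A t x ∧ c = weight φ t x + C} (F x))
    (S : Set V) {a b : V} (ha : a ∈ S) (hb : b ∉ S) (hab : A a b) :
    ∃ b' a', b' ∉ S ∧ a' ∈ S ∧ A b' a' ∧ F a + φ a b ≤ F b' + φ b' a' := by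
  obtain ⟨t, ht, hFa⟩ := (hF a).1
  have hex : ∃ n, t^[n] b ∈ S := by
    obtain ⟨n, hn⟩ := ht.2.2 b
    exact ⟨n, hn ▸ ha⟩
  have hpos : Nat.find hex ≠ 0 := by
    intro h0
    have := Nat.find_spec hex
    rw [h0] at this
    exact hb this
  obtain ⟨k, hk⟩ := Nat.exists_eq_succ_of_ne_zero hpos
  have hS : t^[k + 1] b ∈ S := by have := Nat.find_spec hex; rwa [hk] at this
  have hnS : ∀ j < k + 1, t^[j] b ∉ S := fun j hj => Nat.find_min hex (by omega)
  have hb' : t^[k] b ∉ S := hnS k (by omega)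
  have hne : t^[k] b ≠ a := fun h => hb' (h ▸ ha)
  rw [Function.iterate_succ_apply'] at hS
  refine ⟨t^[k] b, t (t^[k] b), hb', hS, ht.2.1 _ hne, ?_⟩
  have htree := ht.reroot hab hne ⟨k, rfl, fun j hj h => hnS j (by omega) (h ▸ ha)⟩
  have := (hF (t^[k] b)).2 ⟨_, htree, rfl⟩
  have hw := weight_reroot φ (t := t) (b := b) hne
  linarith

/-- Roots can be moved along edges. -/
lemma exists_inTree_of_reflTransGen {A : V → V → Prop} {r x : V} {t : V → V}
    (hA : ∀ y z, A y z → z ≠ y) (ht : InTree A t r) (h : Relation.ReflTransGen A r x) :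
    ∃ t, InTree A t x := by
  induction h with
  | refl => exact ⟨t, ht⟩
  | tail _ hbc ih =>
    obtain ⟨s, hs⟩ := ih
    exact ⟨_, hs.reroot hbc (hA _ _ hbc) ⟨0, rfl, by simp⟩⟩

/-- A strictly decreasing height function gives an in-tree to its only minimum. -/
lemma exists_inTree_of_height {A : V → V → Prop} (r : V) (h : V → ℕ)
    (hd : ∀ y, y ≠ r → ∃ z, A y z ∧ h z < h y) : ∃ t, InTree A t r := by
  choose! f hf using hd
  refine ⟨Function.update f r r, by simp, fun y hy => by simpa [hy] using (hf y hy).1, ?_⟩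
  intro y
  induction hy : h y using Nat.strong_induction_on generalizing y with
  | _ n ih =>
    by_cases hyr : y = r
    · exact ⟨0, hyr⟩
    · obtain ⟨n, hn⟩ := ih _ (hy ▸ (hf y hyr).2) (f y) rfl
      exact ⟨n + 1, by rw [Function.iterate_succ_apply, Function.update_of_ne hyr]; exact hn⟩

end Trees

/-- Up to an additive constant, `Psi` is the maximal weight of an in-tree. -/
lemma isGreatest_Psi {N : ℕ} [NeZero N] (κ μL μR : ℝ) {x : Config N}
    (hx : ∃ t, InTree (Allowed (N := N)) t x) :
    IsGreatest {c | ∃ t, InTree (Allowed (N := N)) t x ∧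
      c = weight (phi κ μL μR) t x + ∑ y : Config N, Gam κ μL μR y} (Psi κ μL μR x) := by
  set P : Set ℝ := {c | ∃ t, InTree (Allowed (N := N)) t x ∧
      c = weight (phi κ μL μR) t x + ∑ y : Config N, Gam κ μL μR y} with hP
  have hcost : ∀ t, treeCost κ μL μR t x =
      Gam κ μL μR x - (weight (phi κ μL μR) t x + ∑ y : Config N, Gam κ μL μR y) := by
    intro t
    unfold treeCost weight Ucost
    have : ∑ y : Config N, Gam κ μL μR y = ∑ y, (if y = x then 0 else Gam κ μL μR y) + Gam κ μL μR x := by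
      rw [← Finset.sum_erase_add _ _ (Finset.mem_univ x),
        ← Finset.sum_erase_add Finset.univ (fun y => if y = x then 0 else Gam κ μL μR y)
          (Finset.mem_univ x)]
      simp only [if_true, add_zero]
      congr 1
      refine Finset.sum_congr rfl fun y hy => ?_
      simp [Finset.ne_of_mem_erase hy]
    rw [this, ← add_assoc, ← Finset.sum_add_distrib]
    rw [show ∀ a b : ℝ, a - (b + a) = -b by intros; ring, ← Finset.sum_neg_distrib]
    refine Finset.sum_congr rfl fun y _ => ?_
    split_ifs <;> ring
  have hfin : P.Finite := by
    refine (Set.finite_range fun t : Config N → Config N =>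
      weight (phi κ μL μR) t x + ∑ y : Config N, Gam κ μL μR y).subset ?_
    rintro c ⟨t, _, rfl⟩
    exact ⟨t, rfl⟩
  have hne : P.Nonempty := by
    obtain ⟨t, ht⟩ := hx
    exact ⟨_, t, ht, rfl⟩
  have hmax : IsGreatest P (sSup P) := ⟨hne.csSup_mem hfin, fun c hc => le_csSup hfin.bddAbove hc⟩
  have hT : Theta κ μL μR x = Gam κ μL μR x - sSup P := by
    refine IsLeast.csInf_eq ⟨?_, ?_⟩
    · obtain ⟨t, ht, h⟩ := hmax.1
      exact ⟨t, ht, by rw [hcost, h]⟩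
    · rintro c ⟨t, ht, rfl⟩
      rw [hcost]
      have := hmax.2 ⟨t, ht, rfl⟩
      linarith
  have : Psi κ μL μR x = sSup P := by unfold Psi; rw [hT]; ring
  rwa [this]

end Kawasaki

namespace Kawasaki

section Sites

variable {N : ℕ}

/-- Occupation of site `j ∈ {1,…,N}`; all other sites are empty. -/
def st (x : Config N) (j : ℕ) : Bool :=
  if h : 1 ≤ j ∧ j ≤ N then x ⟨j - 1, by omega⟩ else false

/-- The configuration with prescribed occupations. -/
def mk (N : ℕ) (f : ℕ → Bool) : Config N := fun k => f (k + 1)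

/-- Exchange of the occupations of the sites `i` and `i + 1`. -/
def sw (x : Config N) (i : ℕ) : Config N :=
  mk N fun j => if j = i then st x (i + 1) else if j = i + 1 then st x i else st x j

/-- Flip at the left boundary. -/
def fl (x : Config N) : Config N := mk N fun j => if j = 1 then !st x 1 else st x j

/-- Flip at the right boundary. -/
def fr (x : Config N) : Config N := mk N fun j => if j = N then !st x N else st x j

lemma st_mk (f : ℕ → Bool) {j : ℕ} (h : 1 ≤ j ∧ j ≤ N) : st (mk N f) j = f j := by
  simp only [st, mk, h, and_self, dite_true]
  congr 1
  omega

lemma st_zero (x : Config N) : st x 0 = false := by simp [st]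

lemma st_gt (x : Config N) {j : ℕ} (h : N < j) : st x j = false := by
  simp only [st]
  rw [dif_neg (by omega)]

lemma le_of_st {x : Config N} {j : ℕ} (h : st x j = true) : 1 ≤ j ∧ j ≤ N := by
  by_contra hc
  simp [st, hc] at h

lemma st_succ (x : Config N) (k : Fin N) : st x (k + 1) = x k := by
  simp [st, k.2]

lemma ext_st {x y : Config N} (h : ∀ j, 1 ≤ j → j ≤ N → st x j = st y j) : x = y := by
  funext k
  rw [← st_succ x, ← st_succ y]
  exact h _ (by omega) (by omega)

lemma st_sw (x : Config N) {i : ℕ} (h1 : 1 ≤ i) (h2 : i < N) (j : ℕ) :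
    st (sw x i) j = if j = i then st x (i + 1) else if j = i + 1 then st x i else st x j := by
  by_cases h : 1 ≤ j ∧ j ≤ N
  · exact st_mk _ h
  · rw [show st (sw x i) j = false by simp [st, h], if_neg (by omega), if_neg (by omega)]
    simp [st, h]

lemma st_fl (x : Config N) (hN : 5 ≤ N) (j : ℕ) :
    st (fl x) j = if j = 1 then !st x 1 else st x j := by
  by_cases h : 1 ≤ j ∧ j ≤ N
  · exact st_mk _ h
  · rw [show st (fl x) j = false by simp [st, h], if_neg (by omega)]
    simp [st, h]

lemma st_fr (x : Config N) (hN : 5 ≤ N) (j : ℕ) :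
    st (fr x) j = if j = N then !st x N else st x j := by
  by_cases h : 1 ≤ j ∧ j ≤ N
  · exact st_mk _ h
  · rw [show st (fr x) j = false by simp [st, h], if_neg (by omega)]
    simp [st, h]

/-- Occupation number of a Boolean. -/
noncomputable def o (b : Bool) : ℝ := if b then 1 else 0

/-- Indicator of a disagreement. -/
noncomputable def d (a b : Bool) : ℝ := if a = b then 0 else 1

@[simp] lemma o_true : o true = 1 := by simp [o]
@[simp] lemma o_false : o false = 0 := by simp [o]
@[simp] lemma d_self (a : Bool) : d a a = 0 := by simp [d]
@[simp] lemma d_true_false : d true false = 1 := by simp [d]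
@[simp] lemma d_false_true : d false true = 1 := by simp [d]

/-- Two sums that differ only on a finite subset. -/
lemma sum_local {M : Type*} [AddCommMonoid M] {s : Finset ℕ} (T : Finset ℕ) (f g : ℕ → M)
    (hT : T ⊆ s) (h : ∀ j ∈ s, j ∉ T → f j = g j) :
    ∑ j ∈ s, f j + ∑ j ∈ T, g j = ∑ j ∈ s, g j + ∑ j ∈ T, f j := by
  rw [← Finset.sum_sdiff hT, ← Finset.sum_sdiff (f := g) hT]
  rw [Finset.sum_congr rfl (g := g) (s₁ := s \ T) fun j hj => by
    simp only [Finset.mem_sdiff] at hj; exact h j hj.1 hj.2]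
  rw [add_assoc, add_assoc, add_comm (∑ j ∈ T, f j)]

lemma energy_eq (κ : ℝ) (x : Config N) :
    energy κ x = -κ * ∑ j ∈ Finset.range (N + 1), o (st x j) * o (st x (j + 1)) := by
  unfold energy
  congr 1
  rw [Finset.sum_range_succ', st_zero, o_false, zero_mul, add_zero,
    ← Fin.sum_univ_eq_sum_range (fun j => o (st x (j + 1)) * o (st x (j + 1 + 1)))]
  refine Finset.sum_congr rfl fun i _ => ?_
  rw [st_succ]
  by_cases h : (i : ℕ) + 1 < N
  · rw [Finset.sum_eq_single ⟨i + 1, h⟩]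
    · have := st_succ x ⟨i + 1, h⟩
      simp only at this
      simp [this, occ, o]
    · intro j _ hj
      rw [if_neg]
      intro h'
      exact hj (Fin.ext h')
    · simp
  · rw [st_gt x (by omega)]
    simp only [o_false, mul_zero]
    refine Finset.sum_eq_zero fun j _ => ?_
    rw [if_neg (by omega)]

lemma energy_sw (κ : ℝ) (x : Config N) {k : ℕ} (hk : k + 1 < N) :
    energy κ (sw x (k + 1)) - energy κ x =
      κ * (o (st x (k + 1)) - o (st x (k + 2))) * (o (st x k) - o (st x (k + 3))) := by
  have hs : ∀ j, st (sw x (k + 1)) j = _ := st_sw x (by omega) hk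
  rw [energy_eq, energy_eq]
  have := sum_local {k, k + 1, k + 2}
    (fun j => o (st (sw x (k + 1)) j) * o (st (sw x (k + 1)) (j + 1)))
    (fun j => o (st x j) * o (st x (j + 1))) (s := Finset.range (N + 1))
    (by intro j; simp; omega)
    (by
      intro j _ hj
      simp only [Finset.mem_insert, Finset.mem_singleton, not_or] at hj
      simp only [hs]
      rw [if_neg (by omega), if_neg (by omega), if_neg (by omega), if_neg (by omega)])
  simp only [hs] at this
  rw [Finset.sum_insert (by simp), Finset.sum_insert (by simp), Finset.sum_singleton,
    Finset.sum_insert (by simp), Finset.sum_insert (by simp), Finset.sum_singleton] at this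
  simp [Nat.add_assoc] at this
  simp only [hs]
  simp [Nat.add_assoc]
  linear_combination (-κ) * this

lemma energy_fl (κ : ℝ) (x : Config N) (hN : 5 ≤ N) :
    energy κ (fl x) - energy κ x = -κ * (1 - 2 * o (st x 1)) * o (st x 2) := by
  have hs := st_fl x hN
  rw [energy_eq, energy_eq]
  have := sum_local {1}
    (fun j => o (st (fl x) j) * o (st (fl x) (j + 1)))
    (fun j => o (st x j) * o (st x (j + 1))) (s := Finset.range (N + 1))
    (by intro j; simp; omega)
    (by
      intro j _ hj
      simp only [Finset.mem_singleton] at hj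
      rcases Nat.eq_zero_or_pos j with rfl | h0
      · simp [st_zero]
      simp only [hs]
      rw [if_neg (by omega), if_neg (by omega)])
  simp only [hs] at this
  simp at this
  simp only [hs]
  simp
  have h2 : o (!st x 1) = 1 - o (st x 1) := by cases st x 1 <;> simp
  rw [h2] at this
  linear_combination (-κ) * this

lemma energy_fr (κ : ℝ) (x : Config N) (hN : 5 ≤ N) :
    energy κ (fr x) - energy κ x = -κ * (1 - 2 * o (st x N)) * o (st x (N - 1)) := by
  have hs := st_fr x hN
  rw [energy_eq, energy_eq]
  have := sum_local {N - 1}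
    (fun j => o (st (fr x) j) * o (st (fr x) (j + 1)))
    (fun j => o (st x j) * o (st x (j + 1))) (s := Finset.range (N + 1))
    (by intro j; simp; omega)
    (by
      intro j hj' hj
      simp only [Finset.mem_singleton] at hj
      simp only [Finset.mem_range] at hj'
      rcases Nat.lt_or_ge j N with h0 | h0
      · simp only [hs]
        rw [if_neg (by omega), if_neg (by omega)]
      · simp [st_gt _ (show N < j + 1 by omega)])
  simp only [hs] at this
  rw [Finset.sum_singleton, Finset.sum_singleton, Nat.sub_add_cancel (by omega), if_pos rfl,
    if_neg (by omega)] at this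
  have h2 : o (!st x N) = 1 - o (st x N) := by cases st x N <;> simp
  rw [h2] at this
  simp only [hs]
  linear_combination (-κ) * this

lemma swapConf_eq (x : Config N) (i j : Fin N) (h : (j : ℕ) = i + 1) :
    swapConf x i j = sw x (i + 1) := by
  funext k
  have h1 := st_succ x i
  have h2 := st_succ x j
  simp only [swapConf, sw, mk, Function.update_apply]
  by_cases hk : k = j
  · subst hk
    rw [if_pos rfl, if_neg (by omega), if_pos (by omega), h1]
  · have : (k : ℕ) ≠ j := fun h' => hk (Fin.ext h')
    rw [if_neg hk]
    by_cases hi : k = i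
    · subst hi
      rw [if_pos rfl, if_pos rfl, ← h2, h]
    · have : (k : ℕ) ≠ i := fun h' => hi (Fin.ext h')
      rw [if_neg hi, if_neg (by omega), if_neg (by omega), st_succ]

lemma isSwap_iff {x y : Config N} : IsSwap x y ↔ ∃ i, 1 ≤ i ∧ i < N ∧ y = sw x i := by
  constructor
  · rintro ⟨i, j, h, rfl⟩
    exact ⟨i + 1, by omega, by omega, swapConf_eq x i j h⟩
  · rintro ⟨i, h1, h2, rfl⟩
    refine ⟨⟨i - 1, by omega⟩, ⟨i, h2⟩, by simp; omega, ?_⟩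
    rw [swapConf_eq _ _ _ (by simp; omega)]
    simp only
    rw [Nat.sub_add_cancel h1]

lemma sw_eq_self {x : Config N} {i : ℕ} (h1 : 1 ≤ i) (h2 : i < N)
    (h : st x i = st x (i + 1)) : sw x i = x := by
  refine ext_st fun j _ _ => ?_
  rw [st_sw x h1 h2]
  split_ifs with h3 h4
  · rw [h3, h]
  · rw [h4, h]
  · rfl

lemma sw_ne_self {x : Config N} {i : ℕ} (h1 : 1 ≤ i) (h2 : i < N)
    (h : st x i ≠ st x (i + 1)) : sw x i ≠ x := by
  intro h'
  have := st_sw x h1 h2 i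
  rw [h', if_pos rfl] at this
  exact h this

lemma fl_ne_self (hN : 5 ≤ N) (x : Config N) : fl x ≠ x := by
  intro h
  have := st_fl x hN 1
  rw [h] at this
  simp at this

lemma fr_ne_self (hN : 5 ≤ N) (x : Config N) : fr x ≠ x := by
  intro h
  have := st_fr x hN N
  rw [h] at this
  simp at this

lemma not_isSwap_fl (hN : 5 ≤ N) (x : Config N) : ¬ IsSwap x (fl x) := by
  rw [isSwap_iff]
  rintro ⟨i, h1, h2, h⟩
  have ha := st_fl x hN i
  have hb := st_fl x hN (i + 1)
  have hc := st_fl x hN 1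
  rw [h, st_sw x h1 h2, if_pos rfl] at ha
  rw [h, st_sw x h1 h2, if_neg (by omega), if_pos rfl, if_neg (by omega)] at hb
  rw [h, st_sw x h1 h2] at hc
  by_cases hi : i = 1
  · subst hi; simp_all
  · rw [if_neg (by omega), if_neg (by omega), if_pos rfl] at hc
    simp at hc

lemma not_isSwap_fr (hN : 5 ≤ N) (x : Config N) : ¬ IsSwap x (fr x) := by
  rw [isSwap_iff]
  rintro ⟨i, h1, h2, h⟩
  have ha := st_fr x hN i
  have hb := st_fr x hN (i + 1)
  have hc := st_fr x hN N
  rw [h, st_sw x h1 h2, if_pos rfl, if_neg (by omega)] at ha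
  rw [h, st_sw x h1 h2, if_neg (by omega), if_pos rfl] at hb
  rw [h, st_sw x h1 h2] at hc
  by_cases hi : i + 1 = N
  · rw [if_pos hi, ← congrArg (st x) hi, ha] at hb
    simp at hb
  · rw [if_neg (by omega), if_neg (by omega), if_pos rfl] at hc
    simp at hc

lemma fr_ne_fl (hN : 5 ≤ N) (x : Config N) : fr x ≠ fl x := by
  intro h
  have h1 := st_fr x hN 1
  rw [h, st_fl x hN, if_pos rfl, if_neg (by omega)] at h1
  simp at h1

lemma sw_sw (x : Config N) {i : ℕ} (h1 : 1 ≤ i) (h2 : i < N) : sw (sw x i) i = x := by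
  refine ext_st fun j _ _ => ?_
  rw [st_sw _ h1 h2, st_sw _ h1 h2, st_sw _ h1 h2, st_sw _ h1 h2]
  rcases eq_or_ne j i with rfl | h
  · simp
  rcases eq_or_ne j (i + 1) with rfl | h'
  · simp
  · simp [h, h']

lemma fl_fl (hN : 5 ≤ N) (x : Config N) : fl (fl x) = x := by
  refine ext_st fun j _ _ => ?_
  rw [st_fl _ hN, st_fl _ hN, st_fl _ hN]
  split_ifs <;> simp_all

lemma fr_fr (hN : 5 ≤ N) (x : Config N) : fr (fr x) = x := by
  refine ext_st fun j _ _ => ?_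
  rw [st_fr _ hN, st_fr _ hN, st_fr _ hN]
  split_ifs <;> simp_all

end Sites

section Rates

variable {N : ℕ} [NeZero N] {κ μL μR : ℝ}

lemma flipConf_zero (x : Config N) : flipConf x 0 = fl x := by
  funext k
  have h0 : ((0 : Fin N) : ℕ) = 0 := by simp
  have h1 := st_succ x 0
  rw [h0] at h1
  simp only [flipConf, fl, mk, Function.update_apply, zero_add] at h1 ⊢
  by_cases hk : k = 0
  · subst hk; simp [h1]
  · rw [if_neg hk, if_neg, st_succ]
    intro h
    exact hk (Fin.ext (by rw [h0]; omega))

lemma flipConf_last (hN : 5 ≤ N) (x : Config N) : flipConf x (lastIdx N) = fr x := by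
  funext k
  have h0 : ((lastIdx N : Fin N) : ℕ) = N - 1 := rfl
  have h1 := st_succ x (lastIdx N)
  rw [h0, Nat.sub_add_cancel (by omega)] at h1
  simp only [flipConf, fr, mk, Function.update_apply]
  by_cases hk : k = lastIdx N
  · subst hk
    rw [if_pos rfl, if_pos (by omega), h1]
  · rw [if_neg hk, if_neg, st_succ]
    intro h
    exact hk (Fin.ext (by rw [h0]; omega))

lemma allowed_iff (hN : 5 ≤ N) {x y : Config N} : Allowed x y ↔
    (∃ i, 1 ≤ i ∧ i < N ∧ st x i ≠ st x (i + 1) ∧ y = sw x i) ∨ y = fl x ∨ y = fr x := by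
  unfold Allowed
  rw [flipConf_zero, flipConf_last hN, isSwap_iff]
  constructor
  · rintro ⟨hne, ⟨i, h1, h2, rfl⟩ | h | h⟩
    · exact Or.inl ⟨i, h1, h2, fun h => hne (sw_eq_self h1 h2 h), rfl⟩
    · exact Or.inr (Or.inl h)
    · exact Or.inr (Or.inr h)
  · rintro (⟨i, h1, h2, h, rfl⟩ | rfl | rfl)
    · exact ⟨sw_ne_self h1 h2 h, Or.inl ⟨i, h1, h2, rfl⟩⟩
    · exact ⟨fl_ne_self hN x, Or.inr (Or.inl rfl)⟩
    · exact ⟨fr_ne_self hN x, Or.inr (Or.inr rfl)⟩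

lemma allowed_sw (hN : 5 ≤ N) {x : Config N} {i : ℕ} (h1 : 1 ≤ i) (h2 : i < N)
    (h : st x i ≠ st x (i + 1)) : Allowed x (sw x i) :=
  (allowed_iff hN).2 (Or.inl ⟨i, h1, h2, h, rfl⟩)

lemma allowed_fl (hN : 5 ≤ N) (x : Config N) : Allowed x (fl x) :=
  (allowed_iff hN).2 (Or.inr (Or.inl rfl))

lemma allowed_fr (hN : 5 ≤ N) (x : Config N) : Allowed x (fr x) :=
  (allowed_iff hN).2 (Or.inr (Or.inr rfl))

lemma phi_sw (x : Config N) {k : ℕ} (hk : k + 1 < N) (h : st x (k + 1) ≠ st x (k + 2)) :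
    phi κ μL μR x (sw x (k + 1)) =
      κ / 2 * (d (st x k) (st x (k + 1)) + d (st x (k + 2)) (st x (k + 3)) - 1) := by
  unfold phi
  rw [if_pos (isSwap_iff.2 ⟨k + 1, by omega, hk, rfl⟩), energy_sw κ x hk]
  revert h
  cases st x k <;> cases st x (k + 1) <;> cases st x (k + 2) <;> cases st x (k + 3) <;>
    simp <;> ring

lemma phi_fl (hN : 5 ≤ N) (x : Config N) :
    phi κ μL μR x (fl x) = (1 - 2 * o (st x 1)) * (μL + κ * o (st x 2)) / 2 := by
  have h0 : occ x 0 = o (st x 1) := by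
    have h1 := st_succ x 0
    have h0 : ((0 : Fin N) : ℕ) = 0 := by simp
    rw [h0] at h1
    simp only [zero_add] at h1
    rw [h1]; rfl
  unfold phi
  rw [if_neg (not_isSwap_fl hN x), if_pos (flipConf_zero x).symm, energy_fl κ x hN, h0]
  ring

lemma phi_fr (hN : 5 ≤ N) (x : Config N) :
    phi κ μL μR x (fr x) = (1 - 2 * o (st x N)) * (μR + κ * o (st x (N - 1))) / 2 := by
  have h0 : occ x (lastIdx N) = o (st x N) := by
    have h1 := st_succ x (lastIdx N)
    rw [show ((lastIdx N : Fin N) : ℕ) = N - 1 from rfl, Nat.sub_add_cancel (by omega)] at h1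
    rw [h1]; rfl
  unfold phi
  rw [if_neg (not_isSwap_fr hN x), flipConf_zero, if_neg (fr_ne_fl hN x),
    if_pos (flipConf_last hN x).symm, energy_fr κ x hN, h0]
  ring

lemma allowed_symm (hN : 5 ≤ N) {x y : Config N} (h : Allowed x y) : Allowed y x := by
  rcases (allowed_iff hN).1 h with ⟨i, h1, h2, h3, rfl⟩ | rfl | rfl
  · have := allowed_sw hN (x := sw x i) h1 h2 (by
      rw [st_sw _ h1 h2, st_sw _ h1 h2, if_pos rfl, if_neg (by omega), if_pos rfl]
      exact h3.symm)
    rwa [sw_sw x h1 h2] at this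
  · have := allowed_fl hN (fl x); rwa [fl_fl hN] at this
  · have := allowed_fr hN (fr x); rwa [fr_fr hN] at this

lemma phi_symm (hN : 5 ≤ N) {x y : Config N} (h : Allowed x y) :
    phi κ μL μR y x = -phi κ μL μR x y := by
  rcases (allowed_iff hN).1 h with ⟨i, h1, h2, h3, rfl⟩ | rfl | rfl
  · obtain ⟨k, rfl⟩ : ∃ k, i = k + 1 := ⟨i - 1, by omega⟩
    have hs : ∀ j, st (sw x (k + 1)) j = _ := st_sw x h1 h2
    have := phi_sw (κ := κ) (μL := μL) (μR := μR) (sw x (k + 1)) h2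
      (by simp [hs]; exact Ne.symm h3)
    rw [sw_sw x h1 h2] at this
    rw [this, phi_sw x h2 h3]
    simp only [hs]
    simp only [Nat.add_assoc, Nat.reduceAdd, Nat.add_left_cancel_iff, left_eq_add]
    simp
    revert h3
    cases st x k <;> cases st x (k + 1) <;> cases st x (k + 2) <;> cases st x (k + 3) <;>
      simp
  · have := phi_fl (κ := κ) (μL := μL) (μR := μR) hN (fl x)
    rw [fl_fl hN, st_fl x hN, st_fl x hN] at this
    rw [this, phi_fl hN]
    cases st x 1 <;> simp <;> ring
  · have := phi_fr (κ := κ) (μL := μL) (μR := μR) hN (fr x)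
    rw [fr_fr hN, st_fr x hN, st_fr x hN, if_pos rfl, if_neg (by omega)] at this
    rw [this, phi_fr hN]
    cases st x N <;> simp <;> ring

end Rates

end Kawasaki

namespace Kawasaki

/-- Parameters of the process together with a function on configurations having the cut property
of maximal tree weights. -/
structure Sys (N : ℕ) [NeZero N] where
  κ : ℝ
  μL : ℝ
  μR : ℝ
  F : Config N → ℝ
  five_le : 5 ≤ N
  kpos : 0 < κ
  left : κ < μL
  right : μR < -κ
  cut : ∀ (S : Set (Config N)) (a b : Config N), a ∈ S → b ∉ S → Allowed a b →
    ∃ b' a', b' ∉ S ∧ a' ∈ S ∧ Allowed b' a' ∧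
      F a + phi κ μL μR a b ≤ F b' + phi κ μL μR b' a'

/-- Exchanging the sites `k + 1` and `k + 2` gains a bond. -/
def Gain {N : ℕ} (x : Config N) (k : ℕ) : Prop :=
  k + 1 < N ∧ st x k ≠ st x (k + 1) ∧ st x (k + 1) ≠ st x (k + 2) ∧ st x (k + 2) ≠ st x (k + 3)

namespace Sys

variable {N : ℕ} [NeZero N] (Y : Sys N)

/-- The exponential rate of a transition. -/
noncomputable def φ (x y : Config N) : ℝ := phi Y.κ Y.μL Y.μR x y

/-- An allowed transition whose flux is at least `l`. -/
def Step (l : ℝ) (x y : Config N) : Prop := Allowed x y ∧ l ≤ Y.F x + Y.φ x y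

/-- Reachability along transitions of flux at least `l`. -/
def Reach (l : ℝ) : Config N → Config N → Prop := Relation.ReflTransGen (Y.Step l)

/-- Some transition out of `x` has flux at least `l`. -/
def Hge (l : ℝ) (x : Config N) : Prop := ∃ y, Y.Step l x y

/-- `x → y` is a fastest transition out of `x`. -/
def IsMax (x y : Config N) : Prop := Allowed x y ∧ ∀ z, Allowed x z → Y.φ x z ≤ Y.φ x y

variable {Y}

lemma exists_exit {l : ℝ} (S : Set (Config N)) {a b : Config N} (ha : a ∉ S) (hb : b ∈ S)
    (h : Y.Step l a b) : ∃ b' a', b' ∈ S ∧ a' ∉ S ∧ Y.Step l b' a' := by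
  obtain ⟨b', a', h1, h2, h3, h4⟩ := Y.cut Sᶜ a b ha (by simpa using hb) h.1
  exact ⟨b', a', by simpa using h1, h2, h3, h.2.trans h4⟩

lemma exists_exit_of_reach {l : ℝ} (S : Set (Config N)) {s z : Config N} (hs : s ∉ S)
    (hz : z ∈ S) (h : Y.Reach l s z) : ∃ b' a', b' ∈ S ∧ a' ∉ S ∧ Y.Step l b' a' := by
  induction h with
  | refl => exact absurd hz hs
  | @tail b c hb hbc ih =>
    by_cases hbS : b ∈ S
    · exact ih hbS
    · exact exists_exit S hbS hz hbc

lemma hge_of_step {l : ℝ} {x y : Config N} (h : Y.Step l x y) : Y.Hge l y := by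
  obtain ⟨b', a', rfl, _, h3⟩ := exists_exit {y} (by
    rw [Set.mem_singleton_iff]; exact h.1.1.symm) rfl h
  exact ⟨a', h3⟩

lemma hge_of_reach {l : ℝ} {x y : Config N} (hx : Y.Hge l x) (h : Y.Reach l x y) :
    Y.Hge l y := by
  cases h with
  | refl => exact hx
  | tail _ h => exact hge_of_step h

lemma Hge.step {l : ℝ} {x y : Config N} (hx : Y.Hge l x) (h : Y.IsMax x y) : Y.Step l x y := by
  obtain ⟨z, hz, hl⟩ := hx
  exact ⟨h.1, by have := h.2 z hz; linarith⟩

lemma Hge.le {l : ℝ} {x y : Config N} (hx : Y.Hge l x) (h : Y.IsMax x y) :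
    l ≤ Y.F x + Y.φ x y := (hx.step h).2

lemma Reach.step {l : ℝ} {s x y : Config N} (h : Y.Reach l s x) (hs : Y.Hge l s)
    (hxy : Y.IsMax x y) : Y.Reach l s y := h.tail ((hge_of_reach hs h).step hxy)

variable (Y)

lemma allowed_cases (Y : Sys N) {x y : Config N} (h : Allowed x y) :
    (∃ k, k + 1 < N ∧ st x (k + 1) ≠ st x (k + 2) ∧ y = sw x (k + 1)) ∨
      y = fl x ∨ y = fr x := by
  rcases (allowed_iff Y.five_le).1 h with ⟨i, h1, h2, h3, rfl⟩ | h | h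
  · obtain ⟨k, rfl⟩ : ∃ k, i = k + 1 := ⟨i - 1, by omega⟩
    exact Or.inl ⟨k, h2, h3, rfl⟩
  · exact Or.inr (Or.inl h)
  · exact Or.inr (Or.inr h)

lemma allowed_sw (Y : Sys N) {x : Config N} {k : ℕ} (hk : k + 1 < N) (h : st x (k + 1) ≠ st x (k + 2)) :
    Allowed x (sw x (k + 1)) := Kawasaki.allowed_sw Y.five_le (by omega) hk h

lemma φ_sw {x : Config N} {k : ℕ} (hk : k + 1 < N) (h : st x (k + 1) ≠ st x (k + 2)) :
    Y.φ x (sw x (k + 1)) =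
      Y.κ / 2 * (d (st x k) (st x (k + 1)) + d (st x (k + 2)) (st x (k + 3)) - 1) :=
  phi_sw x hk h

lemma φ_fl (x : Config N) :
    Y.φ x (fl x) = (1 - 2 * o (st x 1)) * (Y.μL + Y.κ * o (st x 2)) / 2 := phi_fl Y.five_le x

lemma φ_fr (x : Config N) :
    Y.φ x (fr x) = (1 - 2 * o (st x N)) * (Y.μR + Y.κ * o (st x (N - 1))) / 2 :=
  phi_fr Y.five_le x

lemma φ_symm {x y : Config N} (h : Allowed x y) : Y.φ y x = -Y.φ x y := phi_symm Y.five_le h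

lemma d_nonneg (a b : Bool) : 0 ≤ d a b := by cases a <;> cases b <;> simp
lemma d_le_one (a b : Bool) : d a b ≤ 1 := by cases a <;> cases b <;> simp

lemma d_of_ne {a b : Bool} (h : a ≠ b) : d a b = 1 := by
  simp [d, h]

lemma o_nonneg (a : Bool) : 0 ≤ o a := by cases a <;> simp
lemma o_le_one (a : Bool) : o a ≤ 1 := by cases a <;> simp

lemma φ_sw_le {x : Config N} {k : ℕ} (hk : k + 1 < N) (h : st x (k + 1) ≠ st x (k + 2)) :
    Y.φ x (sw x (k + 1)) ≤ Y.κ / 2 := by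
  rw [Y.φ_sw hk h]
  have := Y.kpos
  have h1 := d_le_one (st x k) (st x (k + 1))
  have h2 := d_le_one (st x (k + 2)) (st x (k + 3))
  nlinarith

lemma le_φ_sw {x : Config N} {k : ℕ} (hk : k + 1 < N) (h : st x (k + 1) ≠ st x (k + 2)) :
    -(Y.κ / 2) ≤ Y.φ x (sw x (k + 1)) := by
  rw [Y.φ_sw hk h]
  have := Y.kpos
  have h1 := d_nonneg (st x k) (st x (k + 1))
  have h2 := d_nonneg (st x (k + 2)) (st x (k + 3))
  nlinarith

lemma φ_sw_gain {x : Config N} {k : ℕ} (h : Gain x k) :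
    Y.φ x (sw x (k + 1)) = Y.κ / 2 := by
  rw [Y.φ_sw h.1 h.2.2.1, d_of_ne h.2.1, d_of_ne h.2.2.2]
  ring

lemma φ_sw_nonpos {x : Config N} {k : ℕ} (hk : k + 1 < N) (h : st x (k + 1) ≠ st x (k + 2))
    (hg : ¬ Gain x k) : Y.φ x (sw x (k + 1)) ≤ 0 := by
  rw [Y.φ_sw hk h]
  have := Y.kpos
  have h1 := d_le_one (st x k) (st x (k + 1))
  have h2 := d_le_one (st x (k + 2)) (st x (k + 3))
  have : d (st x k) (st x (k + 1)) = 0 ∨ d (st x (k + 2)) (st x (k + 3)) = 0 := by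
    by_contra hc
    push Not at hc
    refine hg ⟨hk, ?_, h, ?_⟩
    · intro h'; exact hc.1 (by rw [h']; simp)
    · intro h'; exact hc.2 (by rw [h']; simp)
  rcases this with h3 | h3 <;> rw [h3] <;> nlinarith

lemma φ_sw_loss {x : Config N} {k : ℕ} (hk : k + 1 < N) (h : st x (k + 1) ≠ st x (k + 2))
    (h1 : st x k = st x (k + 1)) (h2 : st x (k + 2) = st x (k + 3)) :
    Y.φ x (sw x (k + 1)) = -(Y.κ / 2) := by
  rw [Y.φ_sw hk h, h1, h2]
  simp

lemma φ_fl_true {x : Config N} (h : st x 1 = true) : Y.φ x (fl x) ≤ -(Y.μL / 2) := by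
  rw [Y.φ_fl, h, o_true]
  have := mul_nonneg Y.kpos.le (o_nonneg (st x 2))
  linarith

lemma φ_fl_false {x : Config N} (h : st x 1 = false) : Y.μL / 2 ≤ Y.φ x (fl x) := by
  rw [Y.φ_fl, h, o_false]
  have := mul_nonneg Y.kpos.le (o_nonneg (st x 2))
  linarith

lemma φ_fr_true {x : Config N} (h : st x N = true) : 0 < Y.φ x (fr x) := by
  rw [Y.φ_fr, h, o_true]
  have := mul_le_mul_of_nonneg_left (o_le_one (st x (N - 1))) Y.kpos.le
  have := Y.right
  linarith

lemma φ_fr_false {x : Config N} (h : st x N = false) : Y.φ x (fr x) < 0 := by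
  rw [Y.φ_fr, h, o_false]
  have := mul_le_mul_of_nonneg_left (o_le_one (st x (N - 1))) Y.kpos.le
  have := Y.right
  linarith

lemma φ_fr_false_false {x : Config N} (h : st x N = false) (h' : st x (N - 1) = false) :
    Y.φ x (fr x) = Y.μR / 2 := by
  rw [Y.φ_fr, h, h', o_false]
  ring

lemma φ_fr_true_false {x : Config N} (h : st x N = true) (h' : st x (N - 1) = false) :
    Y.φ x (fr x) = -(Y.μR / 2) := by
  rw [Y.φ_fr, h, h', o_false, o_true]
  ring

lemma isMax_of {x y : Config N} (hA : Allowed x y)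
    (h1 : ∀ k, k + 1 < N → st x (k + 1) ≠ st x (k + 2) → Y.φ x (sw x (k + 1)) ≤ Y.φ x y)
    (h2 : Y.φ x (fl x) ≤ Y.φ x y) (h3 : Y.φ x (fr x) ≤ Y.φ x y) : Y.IsMax x y := by
  refine ⟨hA, fun z hz => ?_⟩
  rcases Y.allowed_cases hz with ⟨k, hk, hw, rfl⟩ | rfl | rfl
  · exact h1 k hk hw
  · exact h2
  · exact h3

lemma isMax_fl {x : Config N} (h1 : st x 1 = false) (h2 : st x N = false) :
    Y.IsMax x (fl x) := by
  have a := Y.φ_fl_false h1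
  have b := Y.φ_fr_false h2
  have c := Y.left
  have e := Y.kpos
  refine Y.isMax_of (allowed_fl Y.five_le x) (fun k hk hw => ?_) le_rfl (by linarith)
  have := Y.φ_sw_le hk hw
  linarith

lemma isMax_fl_or_fr {x : Config N} (h1 : st x 1 = false) :
    Y.IsMax x (fl x) ∨ st x N = true ∧ Y.IsMax x (fr x) := by
  by_cases h2 : st x N = true
  · have a := Y.φ_fl_false h1
    have c := Y.left
    rcases le_total (Y.φ x (fl x)) (Y.φ x (fr x)) with h | h
    · refine Or.inr ⟨h2, Y.isMax_of (allowed_fr Y.five_le x) (fun k hk hw => ?_) h le_rfl⟩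
      have := Y.φ_sw_le hk hw
      linarith
    · refine Or.inl (Y.isMax_of (allowed_fl Y.five_le x) (fun k hk hw => ?_) le_rfl h)
      have := Y.φ_sw_le hk hw
      linarith
  · exact Or.inl (Y.isMax_fl h1 (by simpa using h2))

lemma isMax_fr_or_gain {x : Config N} (h1 : st x 1 = true) (h2 : st x N = true) :
    Y.IsMax x (fr x) ∨ ∃ k, Gain x k ∧ Y.IsMax x (sw x (k + 1)) := by
  have a := Y.φ_fl_true h1
  have b := Y.φ_fr_true h2
  have c := Y.left
  have e := Y.kpos
  by_cases hg : ∃ k, Gain x k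
  · obtain ⟨k, hk⟩ := hg
    have hv := Y.φ_sw_gain hk
    rcases le_total (Y.φ x (fr x)) (Y.κ / 2) with h | h
    · refine Or.inr ⟨k, hk, Y.isMax_of (Y.allowed_sw hk.1 hk.2.2.1) (fun j hj hw => ?_) ?_ ?_⟩
      · rw [hv]; exact Y.φ_sw_le hj hw
      · linarith
      · linarith
    · refine Or.inl (Y.isMax_of (allowed_fr Y.five_le x) (fun j hj hw => ?_) ?_ le_rfl)
      · exact (Y.φ_sw_le hj hw).trans h
      · linarith
  · push Not at hg
    refine Or.inl (Y.isMax_of (allowed_fr Y.five_le x) (fun j hj hw => ?_) ?_ le_rfl)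
    · exact (Y.φ_sw_nonpos hj hw (hg j)).trans b.le
    · linarith

lemma isMax_fr {x : Config N} (h1 : st x 1 = true) (h2 : st x N = true)
    (h3 : st x (N - 1) = false) : Y.IsMax x (fr x) := by
  have a := Y.φ_fl_true h1
  have b := Y.φ_fr_true_false h2 h3
  have c := Y.left
  have e := Y.kpos
  have f := Y.right
  refine Y.isMax_of (allowed_fr Y.five_le x) (fun j hj hw => ?_) ?_ le_rfl
  · have := Y.φ_sw_le hj hw
    linarith
  · linarith

lemma isMax_gain {x : Config N} {k : ℕ} (h1 : st x 1 = true) (h2 : st x N = false)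
    (hk : Gain x k) : Y.IsMax x (sw x (k + 1)) := by
  have a := Y.φ_fl_true h1
  have b := Y.φ_fr_false h2
  have c := Y.left
  have e := Y.kpos
  have hv := Y.φ_sw_gain hk
  refine Y.isMax_of (Y.allowed_sw hk.1 hk.2.2.1) (fun j hj hw => ?_) ?_ ?_
  · rw [hv]; exact Y.φ_sw_le hj hw
  · linarith
  · linarith

lemma isMax_zero {x : Config N} {k : ℕ} (h1 : st x 1 = true) (h2 : st x N = false)
    (hg : ∀ j, ¬ Gain x j) (hk : k + 1 < N) (hw : st x (k + 1) ≠ st x (k + 2))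
    (h0 : 0 ≤ Y.φ x (sw x (k + 1))) : Y.IsMax x (sw x (k + 1)) := by
  have a := Y.φ_fl_true h1
  have b := Y.φ_fr_false h2
  have c := Y.left
  have e := Y.kpos
  refine Y.isMax_of (Y.allowed_sw hk hw) (fun j hj hw => ?_) ?_ ?_
  · exact (Y.φ_sw_nonpos hj hw (hg j)).trans h0
  · linarith
  · linarith

end Sys

/-- Every exchange in the bulk loses a bond, and the first site is occupied, the last one empty. -/
def Compact {N : ℕ} (x : Config N) : Prop :=
  st x 1 = true ∧ st x N = false ∧ ∀ k, k + 1 < N → st x (k + 1) ≠ st x (k + 2) →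
    st x k = st x (k + 1) ∧ st x (k + 2) = st x (k + 3)

namespace Sys

variable {N : ℕ} [NeZero N] (Y : Sys N)

lemma isMax_compact {x : Config N} {k : ℕ} (hx : Compact x) (h3 : st x (N - 1) = false)
    (hk : k + 1 < N) (hw : st x (k + 1) ≠ st x (k + 2)) : Y.IsMax x (sw x (k + 1)) := by
  have hc : ∀ j, j + 1 < N → st x (j + 1) ≠ st x (j + 2) →
      Y.φ x (sw x (j + 1)) = -(Y.κ / 2) := fun j hj hw =>
    Y.φ_sw_loss hj hw (hx.2.2 j hj hw).1 (hx.2.2 j hj hw).2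
  have a := Y.φ_fl_true hx.1
  have b := Y.φ_fr_false_false hx.2.1 h3
  have c := Y.left
  have e := Y.right
  refine Y.isMax_of (Y.allowed_sw hk hw) (fun j hj hw' => ?_) ?_ ?_
  · rw [hc j hj hw', hc k hk hw]
  · rw [hc k hk hw]; linarith
  · rw [hc k hk hw]; linarith

end Sys

end Kawasaki

namespace Kawasaki

section Measure

variable {N : ℕ}

/-- Indicator that a block of particles starts at `j + 1`, for `1 ≤ j`. -/
def wl (x : Config N) (j : ℕ) : ℕ := if 1 ≤ j ∧ st x j = false ∧ st x (j + 1) = true then 1 else 0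

/-- Number of blocks of particles not starting at the first site. -/
def nb (x : Config N) : ℕ := ∑ j ∈ Finset.range (N + 1), wl x j

/-- Total distance of the particles to the right reservoir. -/
def dist (x : Config N) : ℕ := ∑ j ∈ Finset.range (N + 1), if st x j then N + 1 - j else 0

/-- Number of sites not in the leading block of particles. -/
def tl (x : Config N) : ℕ :=
  ((Finset.Icc 1 N).filter fun i => ∃ j ≤ i, 1 ≤ j ∧ st x j = false).card

lemma tl_le {x y : Config N} (h : ∀ i, (∀ j ≤ i, 1 ≤ j → st x j = true) →
    ∀ j ≤ i, 1 ≤ j → st y j = true) : tl y ≤ tl x := by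
  refine Finset.card_le_card fun i hi => ?_
  simp only [Finset.mem_filter] at hi ⊢
  refine ⟨hi.1, ?_⟩
  by_contra hc
  push Not at hc
  obtain ⟨j, h1, h2, h3⟩ := hi.2
  have := h i (fun j hj hj' => by simpa using hc j hj hj') j h1 h2
  rw [h3] at this
  exact absurd this (by simp)

lemma tl_lt {x y : Config N} (h : ∀ i, (∀ j ≤ i, 1 ≤ j → st x j = true) →
    ∀ j ≤ i, 1 ≤ j → st y j = true) (i : ℕ) (hi : i ∈ Finset.Icc 1 N)
    (hx : ∃ j ≤ i, 1 ≤ j ∧ st x j = false) (hy : ∀ j ≤ i, 1 ≤ j → st y j = true) :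
    tl y < tl x := by
  refine Finset.card_lt_card ⟨?_, ?_⟩
  · intro i hi
    simp only [Finset.mem_filter] at hi ⊢
    refine ⟨hi.1, ?_⟩
    by_contra hc
    push Not at hc
    obtain ⟨j, h1, h2, h3⟩ := hi.2
    have := h i (fun j hj hj' => by simpa using hc j hj hj') j h1 h2
    rw [h3] at this
    exact absurd this (by simp)
  · intro hsub
    have := hsub (x := i) (by simp only [Finset.mem_filter]; exact ⟨hi, hx⟩)
    simp only [Finset.mem_filter] at this
    obtain ⟨j, h1, h2, h3⟩ := this.2
    rw [hy j h1 h2] at h3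
    exact absurd h3 (by simp)

/-- The progress order: fewer blocks, then a longer leading block, then particles further right. -/
def Prog (y x : Config N) : Prop :=
  nb y < nb x ∨ nb y ≤ nb x ∧ (tl y < tl x ∨ tl y ≤ tl x ∧ dist y < dist x)

lemma Prog.wf : WellFounded (Prog (N := N)) := by
  refine Subrelation.wf (r := InvImage (· < ·)
    (fun x : Config N => toLex (nb x, toLex (tl x, dist x)))) ?_ (InvImage.wf _ wellFounded_lt)
  intro y x h
  simp only [InvImage, Prod.Lex.toLex_lt_toLex]
  unfold Prog at h
  omega

lemma nb_sw (x : Config N) {k : ℕ} (hk : k + 1 < N) :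
    nb (sw x (k + 1)) + (wl x k + wl x (k + 1) + wl x (k + 2)) =
      nb x + (wl (sw x (k + 1)) k + wl (sw x (k + 1)) (k + 1) + wl (sw x (k + 1)) (k + 2)) := by
  have hs : ∀ j, st (sw x (k + 1)) j = _ := st_sw x (by omega) hk
  have := sum_local {k, k + 1, k + 2} (wl (sw x (k + 1))) (wl x) (s := Finset.range (N + 1))
    (by intro j; simp; omega)
    (by
      intro j _ hj
      simp only [Finset.mem_insert, Finset.mem_singleton, not_or] at hj
      have h1 : st (sw x (k + 1)) j = st x j := by
        rw [hs, if_neg (by omega), if_neg (by omega)]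
      have h2 : st (sw x (k + 1)) (j + 1) = st x (j + 1) := by
        rw [hs, if_neg (by omega), if_neg (by omega)]
      simp only [wl, h1, h2])
  rw [Finset.sum_insert (by simp), Finset.sum_insert (by simp), Finset.sum_singleton,
    Finset.sum_insert (by simp), Finset.sum_insert (by simp), Finset.sum_singleton] at this
  unfold nb
  omega

lemma nb_fl (x : Config N) (hN : 5 ≤ N) : nb (fl x) + wl x 1 = nb x + wl (fl x) 1 := by
  have := sum_local {1} (wl (fl x)) (wl x) (s := Finset.range (N + 1))
    (by intro j; simp; omega)
    (by
      intro j _ hj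
      simp only [Finset.mem_singleton] at hj
      rcases Nat.eq_zero_or_pos j with rfl | h
      · simp [wl]
      have h1 : st (fl x) j = st x j := by rw [st_fl x hN, if_neg (by omega)]
      have h2 : st (fl x) (j + 1) = st x (j + 1) := by rw [st_fl x hN, if_neg (by omega)]
      simp only [wl, h1, h2])
  simpa [nb] using this

lemma nb_fr (x : Config N) (hN : 5 ≤ N) :
    nb (fr x) + wl x (N - 1) = nb x + wl (fr x) (N - 1) := by
  have := sum_local {N - 1} (wl (fr x)) (wl x) (s := Finset.range (N + 1))
    (by intro j; simp; omega)
    (by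
      intro j hj' hj
      simp only [Finset.mem_singleton] at hj
      simp only [Finset.mem_range] at hj'
      rcases Nat.lt_or_ge j N with h0 | h0
      · have h1 : st (fr x) j = st x j := by rw [st_fr x hN, if_neg (by omega)]
        have h2 : st (fr x) (j + 1) = st x (j + 1) := by rw [st_fr x hN, if_neg (by omega)]
        simp only [wl, h1, h2]
      · simp [wl, st_gt _ (show N < j + 1 by omega)])
  simpa [nb] using this

lemma dist_sw (x : Config N) {k : ℕ} (hk : k + 1 < N) :
    dist (sw x (k + 1)) + (if st x (k + 1) then 1 else 0) =
      dist x + (if st x (k + 2) then 1 else 0) := by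
  have hs : ∀ j, st (sw x (k + 1)) j = _ := st_sw x (by omega) hk
  have := sum_local {k + 1, k + 2} (fun j => if st (sw x (k + 1)) j then N + 1 - j else 0)
    (fun j => if st x j then N + 1 - j else 0) (s := Finset.range (N + 1))
    (by intro j; simp; omega)
    (by
      intro j _ hj
      simp only [Finset.mem_insert, Finset.mem_singleton, not_or] at hj
      simp only [hs]
      rw [if_neg (by omega : ¬ j = k + 1), if_neg (by omega : ¬ j = k + 1 + 1)])
  rw [Finset.sum_insert (by simp), Finset.sum_singleton,
    Finset.sum_insert (by simp), Finset.sum_singleton] at this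
  simp only [hs] at this
  simp only [Nat.add_assoc, Nat.reduceAdd, if_true, Nat.add_left_cancel_iff,
    OfNat.ofNat_ne_one, if_false] at this
  unfold dist
  simp only [hs, Nat.add_assoc, Nat.reduceAdd]
  split_ifs at this ⊢ <;> omega

lemma dist_fr (x : Config N) (hN : 5 ≤ N) (h : st x N = true) : dist (fr x) + 1 = dist x := by
  have := sum_local {N} (fun j => if st (fr x) j then N + 1 - j else 0)
    (fun j => if st x j then N + 1 - j else 0) (s := Finset.range (N + 1))
    (by intro j; simp; omega)
    (by
      intro j _ hj
      simp only [Finset.mem_singleton] at hj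
      simp only [st_fr x hN]
      rw [if_neg hj])
  simp only [Finset.sum_singleton, st_fr x hN, h] at this
  simp at this
  simp only [dist, st_fr x hN, h]
  simpa using this

end Measure

end Kawasaki

namespace Kawasaki

section Measure

variable {N : ℕ}

lemma tl_le_of_zero {x y : Config N} {k : ℕ} (hk : 1 ≤ k) (hx : st x k = false)
    (h : ∀ j < k, st y j = st x j) : tl y ≤ tl x := by
  refine tl_le fun i hi j hj hj' => ?_
  have hik : i < k := by
    by_contra hc
    have := hi k (by omega) hk
    rw [hx] at this
    exact absurd this (by simp)
  rw [h j (by omega)]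
  exact hi j hj hj'

lemma tl_lt_of_zero {x y : Config N} {i : ℕ} (h1 : 1 ≤ i) (h2 : i ≤ N) (hx : st x i = false)
    (hy : ∀ j ≤ i, 1 ≤ j → st y j = true) : tl y < tl x := by
  refine tl_lt (fun i' hi j hj hj' => hy j ?_ hj') i (by simp [h1, h2]) ⟨i, le_rfl, h1, hx⟩ hy
  by_contra hc
  have := hi i (by omega) h1
  rw [hx] at this
  exact absurd this (by simp)

end Measure

namespace Sys

variable {N : ℕ} [NeZero N] {Y : Sys N}

lemma compact_φ_lt_zero {v y : Config N} (hv : Compact v) (h : Allowed v y) : Y.φ v y < 0 := by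
  have e := Y.kpos
  rcases Y.allowed_cases h with ⟨k, hk, hw, rfl⟩ | rfl | rfl
  · rw [Y.φ_sw_loss hk hw (hv.2.2 k hk hw).1 (hv.2.2 k hk hw).2]
    linarith
  · have := Y.φ_fl_true hv.1
    have := Y.left
    linarith
  · exact Y.φ_fr_false hv.2.1

/-- Filling the last site of a compact configuration lowers `F`. -/
lemma F_fr_lt {v : Config N} (hv : Compact v) : Y.F (fr v) < Y.F v := by
  have hA := allowed_fr Y.five_le v
  obtain ⟨y, hy⟩ := hge_of_step (Y := Y) (l := Y.F (fr v) + Y.φ (fr v) v)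
    ⟨allowed_symm Y.five_le hA, le_rfl⟩
  have h1 := Y.φ_symm hA
  have h2 := Y.φ_fr_false hv.2.1
  have h3 := compact_φ_lt_zero (Y := Y) hv hy.1
  have h4 := hy.2
  linarith

/-- A compact configuration whose gap at the right boundary has length one is left through
exchanges, since filling the gap does not open any new way out. -/
lemma hop_le {l : ℝ} {s v : Config N} (hv : Compact v) (hl : st v (N - 1) = true)
    (hs : s ≠ v ∧ s ≠ fr v) (hr : Y.Reach l s v ∨ Y.Reach l s (fr v)) :
    l ≤ Y.F v - Y.κ / 2 := by
  have hlt := F_fr_lt (Y := Y) hv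
  have e := Y.kpos
  have eL := Y.left
  have hN := Y.five_le
  have : ∃ b' a', b' ∈ ({v, fr v} : Set (Config N)) ∧ a' ∉ ({v, fr v} : Set (Config N)) ∧
      Y.Step l b' a' := by
    rcases hr with hr | hr
    · exact exists_exit_of_reach {v, fr v} (by simp [hs.1, hs.2]) (by simp) hr
    · exact exists_exit_of_reach {v, fr v} (by simp [hs.1, hs.2]) (by simp) hr
  obtain ⟨b, a, hb, ha, hA, hle⟩ := this
  simp only [Set.mem_insert_iff, Set.mem_singleton_iff, not_or] at hb ha
  rcases hb with rfl | rfl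
  · rcases Y.allowed_cases hA with ⟨k, hk, hw, rfl⟩ | rfl | rfl
    · rw [Y.φ_sw_loss hk hw (hv.2.2 k hk hw).1 (hv.2.2 k hk hw).2] at hle
      linarith
    · have := Y.φ_fl_true hv.1
      linarith
    · exact absurd rfl ha.2
  · have hf := st_fr v hN
    rcases Y.allowed_cases hA with ⟨k, hk, hw, rfl⟩ | rfl | rfl
    · have hk2 : k + 3 < N := by
        rcases Nat.lt_or_ge (k + 3) N with h | h
        · exact h
        exfalso
        have h1 : ∀ j, N - 1 ≤ j → j ≤ N → st (fr v) j = true := by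
          intro j hj hj'
          rw [hf]
          split_ifs with h
          · simp [hv.2.1]
          · rw [show j = N - 1 by omega]; exact hl
        rcases Nat.lt_or_ge (k + 2) N with h2 | h2
        · have h3 : st v (k + 2) = true := by rw [show k + 2 = N - 1 by omega]; exact hl
          have h4 : st v (k + 3) = false := by rw [show k + 3 = N by omega]; exact hv.2.1
          have h5 := (hv.2.2 (k + 1) (by omega) (by rw [h3, h4]; simp)).1
          rw [h1 (k + 2) (by omega) (by omega), hf, if_neg (by omega), h5, h3] at hw
          exact hw rfl
        · rw [h1 (k + 1) (by omega) (by omega), h1 (k + 2) (by omega) (by omega)] at hw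
          exact hw rfl
      have hfn : ∀ j ≤ k + 3, st (fr v) j = st v j := by
        intro j hj
        rw [hf, if_neg (by omega)]
      rw [hfn _ (by omega), hfn _ (by omega)] at hw
      rw [Y.φ_sw_loss hk (by rwa [hfn _ (by omega), hfn _ (by omega)])
        (by rw [hfn _ (by omega), hfn _ (by omega)]; exact (hv.2.2 k hk hw).1)
        (by rw [hfn _ (by omega), hfn _ (by omega)]; exact (hv.2.2 k hk hw).2)] at hle
      linarith
    · have : st (fr v) 1 = true := by rw [hf, if_neg (by omega)]; exact hv.1
      have := Y.φ_fl_true this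
      linarith
    · rw [fr_fr hN] at ha
      exact absurd rfl ha.1

lemma hop_step {l : ℝ} {v : Config N} (hv : Compact v) (h : l ≤ Y.F v - Y.κ / 2) {k : ℕ}
    (hk : k + 1 < N) (hw : st v (k + 1) ≠ st v (k + 2)) : Y.Step l v (sw v (k + 1)) := by
  refine ⟨Y.allowed_sw hk hw, ?_⟩
  rw [Y.φ_sw_loss hk hw (hv.2.2 k hk hw).1 (hv.2.2 k hk hw).2]
  linarith

variable (Y) in
/-- `s` has outgoing flux at least `l` and is not one of the exceptional configurations with
a particle next to the last site. -/
def Start (l : ℝ) (s : Config N) : Prop :=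
  Y.Hge l s ∧ ∀ v, Compact v → st v (N - 1) = true → s ≠ v ∧ s ≠ fr v

variable (Y) in
/-- From `s` one reaches a configuration that is better than `x`. -/
def Better (l : ℝ) (s x : Config N) : Prop := ∃ y, Y.Reach l s y ∧ Prog y x

variable {l : ℝ} {s x : Config N}

lemma better_of_left_empty (hs : Y.Start l s) (hx : Y.Reach l s x) (h1 : st x 1 = false) :
    Y.Better l s x := by
  have hN := Y.five_le
  rcases Y.isMax_fl_or_fr h1 with h | ⟨h2, h⟩
  · refine ⟨_, hx.step hs.1 h, Or.inr ⟨?_, Or.inl ?_⟩⟩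
    · have := nb_fl x hN
      simp [wl, st_fl x hN, h1] at this
      omega
    · refine tl_lt_of_zero (i := 1) le_rfl (by omega) h1 fun j hj hj' => ?_
      rw [st_fl x hN, if_pos (by omega), h1]; rfl
  · refine ⟨_, hx.step hs.1 h, Or.inr ⟨?_, Or.inr ⟨?_, ?_⟩⟩⟩
    · have := nb_fr x hN
      have h3 : wl (fr x) (N - 1) = 0 := by
        simp [wl, st_fr x hN, h2, Nat.sub_add_cancel (show 1 ≤ N by omega)]
      omega
    · refine tl_le_of_zero (k := 1) le_rfl h1 fun j hj => ?_
      rw [st_fr x hN, if_neg (by omega)]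
    · have := dist_fr x hN h2
      omega

lemma exists_nb_lt_of_left (hs : Y.Start l s) (hx : Y.Reach l s x) (h1 : st x 1 = false)
    (h2 : st x 2 = true) : ∃ y, Y.Reach l s y ∧ nb y < nb x := by
  have hN := Y.five_le
  have key : ∀ x : Config N, st x 1 = false → st x 2 = true → nb (fl x) < nb x := by
    intro x h1 h2
    have := nb_fl x hN
    simp [wl, st_fl x hN, h1, h2] at this
    omega
  rcases Y.isMax_fl_or_fr h1 with h | ⟨h3, h⟩
  · exact ⟨_, hx.step hs.1 h, key x h1 h2⟩
  · have hf := st_fr x hN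
    have h1' : st (fr x) 1 = false := by rw [hf, if_neg (by omega), h1]
    have h2' : st (fr x) 2 = true := by rw [hf, if_neg (by omega), h2]
    have h3' : st (fr x) N = false := by rw [hf, if_pos rfl, h3]; rfl
    refine ⟨_, (hx.step hs.1 h).step hs.1 (Y.isMax_fl h1' h3'), (key _ h1' h2').trans_le ?_⟩
    have := nb_fr x hN
    have h4 : wl (fr x) (N - 1) = 0 := by
      simp [wl, h3', Nat.sub_add_cancel (show 1 ≤ N by omega)]
    omega

lemma better_of_gain (hs : Y.Start l s) (hx : Y.Reach l s x) {k : ℕ}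
    (hk : Gain x k) (hm : Y.IsMax x (sw x (k + 1))) : Y.Better l s x := by
  have hN := Y.five_le
  obtain ⟨h1, h2, h3, h4⟩ := hk
  have hf : ∀ j, st (sw x (k + 1)) j = _ := st_sw x (by omega) h1
  have e := nb_sw x h1
  rcases Nat.eq_zero_or_pos k with rfl | hk0
  · rw [st_zero] at h2
    simp only [zero_add] at h1 h2 h3 h4 hf e hm
    simp at h2
    rw [h2] at h3
    simp at h3
    rw [h3] at h4
    simp at h4
    obtain ⟨y, hy, hlt⟩ := exists_nb_lt_of_left hs (hx.step hs.1 hm) (by simp [hf, h3])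
      (by simp [hf, h2])
    refine ⟨y, hy, Or.inl (hlt.trans_le ?_)⟩
    simp [wl, hf, h2, h3, h4] at e
    omega
  · refine ⟨_, hx.step hs.1 hm, Or.inl ?_⟩
    rcases hb : st x k with _ | _ <;> rw [hb] at h2 <;> simp at h2 <;> rw [h2] at h3 <;>
      simp at h3 <;> rw [h3] at h4 <;> simp at h4 <;>
      simp [wl, hf, h2, h3, h4, hb, show 1 ≤ k from hk0, Nat.add_assoc] at e <;> omega

lemma better_of_isolated (hs : Y.Start l s) (hx : Y.Reach l s x) {k : ℕ}
    (hk : k + 1 < N) (hlast : st x N = false)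
    (h0 : st x k = false) (h1 : st x (k + 1) = true) (h2 : st x (k + 2) = false)
    (h3 : st x (k + 3) = false) (hm : Y.IsMax x (sw x (k + 1))) : Y.Better l s x := by
  have hN := Y.five_le
  have hf : ∀ j, st (sw x (k + 1)) j = _ := st_sw x (by omega) hk
  have e := nb_sw x hk
  have ed := dist_sw x hk
  rcases Nat.eq_zero_or_pos k with rfl | hk0
  · simp only [zero_add] at h1 h2 h3 hf e hm
    have g1 : st (sw x 1) 1 = false := by simp [hf, h2]
    have gN : st (sw x 1) N = false := by
      rw [hf, if_neg (by omega), if_neg (by omega), hlast]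
    have hg := st_fl (sw x 1) hN
    refine ⟨_, (hx.step hs.1 hm).step hs.1 (Y.isMax_fl g1 gN), Or.inr ⟨?_, Or.inl ?_⟩⟩
    · have e' := nb_fl (sw x 1) hN
      simp [wl, hf, hg, h1, h2, h3] at e e'
      omega
    · refine tl_lt_of_zero (i := 2) (by omega) (by omega) h2 fun j hj hj' => ?_
      obtain rfl | rfl : j = 1 ∨ j = 2 := by omega
      · simp [hg, hf, h2]
      · simp [hg, hf, h1]
  · refine ⟨_, hx.step hs.1 hm, Or.inr ⟨?_, Or.inr ⟨?_, ?_⟩⟩⟩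
    · simp [wl, hf, h0, h1, h2, h3, show 1 ≤ k from hk0, Nat.add_assoc] at e
      omega
    · refine tl_le_of_zero (k := k) hk0 h0 fun j hj => ?_
      rw [hf, if_neg (by omega), if_neg (by omega)]
    · simp [h1, h2] at ed
      omega

lemma better_of_hole (hs : Y.Start l s) (hx : Y.Reach l s x) {k : ℕ}
    (h0 : st x k = true) (h1 : st x (k + 1) = true) (h2 : st x (k + 2) = false)
    (h3 : st x (k + 3) = true) (h4 : st x (k + 4) = true)
    (hm : ∀ j, j + 1 < N → st x (j + 1) ≠ st x (j + 2) → 0 ≤ Y.φ x (sw x (j + 1)) →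
      Y.IsMax x (sw x (j + 1))) : Y.Better l s x := by
  have hN := Y.five_le
  have hk1 := (le_of_st h0).1
  have hk4 := (le_of_st h4).2
  by_cases hlead : ∀ j ≤ k + 1, 1 ≤ j → st x j = true
  · have hk : k + 1 + 1 < N := by omega
    have hw : st x (k + 1 + 1) ≠ st x (k + 1 + 2) := by
      rw [show k + 1 + 1 = k + 2 by ring, show k + 1 + 2 = k + 3 by ring, h2, h3]; simp
    have hf : ∀ j, st (sw x (k + 1 + 1)) j = _ := st_sw x (by omega) hk
    have e := nb_sw x hk
    refine ⟨_, hx.step hs.1 (hm (k + 1) hk hw ?_), Or.inr ⟨?_, Or.inl ?_⟩⟩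
    · rw [Y.φ_sw hk hw]
      simp [Nat.add_assoc, h1, h2, h3, h4]
    · simp [wl, hf, h1, h2, h3, h4, Nat.add_assoc] at e
      change nb (sw x (k + 2)) ≤ nb x
      omega
    · refine tl_lt_of_zero (i := k + 2) (by omega) (by omega) h2 fun j hj hj' => ?_
      rcases eq_or_ne j (k + 2) with rfl | hne
      · simp [hf, h3]
      · rw [hf, if_neg (by omega), if_neg (by omega)]
        exact hlead j (by omega) hj'
  · push Not at hlead
    obtain ⟨j, hj, hj1, hj0⟩ := hlead
    simp only [ne_eq, Bool.not_eq_true] at hj0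
    have hjk : j < k := by
      rcases lt_trichotomy j k with h | rfl | h
      · exact h
      · rw [h0] at hj0; exact absurd hj0 (by simp)
      · rw [show j = k + 1 by omega, h1] at hj0; exact absurd hj0 (by simp)
    have hk : k + 1 < N := by omega
    have hw : st x (k + 1) ≠ st x (k + 2) := by rw [h1, h2]; simp
    have hf : ∀ j, st (sw x (k + 1)) j = _ := st_sw x (by omega) hk
    have e := nb_sw x hk
    have ed := dist_sw x hk
    refine ⟨_, hx.step hs.1 (hm k hk hw ?_), Or.inr ⟨?_, Or.inr ⟨?_, ?_⟩⟩⟩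
    · rw [Y.φ_sw hk hw]
      simp [h0, h1, h2, h3]
    · simp [wl, hf, h0, h1, h2, h3, Nat.add_assoc] at e
      omega
    · refine tl_le_of_zero hj1 hj0 fun i hi => ?_
      rw [hf, if_neg (by omega), if_neg (by omega)]
    · simp [h1, h2] at ed
      omega

end Sys

end Kawasaki

namespace Kawasaki

/-- All blocks have length at least three, except that two empty sites suffice at the right end. -/
def Pstar {N : ℕ} (x : Config N) : Prop :=
  st x 1 = true ∧ st x N = false ∧ st x (N - 1) = false ∧
    ∀ i, 1 ≤ i → i < N → st x i ≠ st x (i + 1) →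
      3 ≤ i ∧ st x (i - 2) = st x i ∧ st x (i - 1) = st x i ∧
        st x (i + 2) = st x (i + 1) ∧ st x (i + 3) = st x (i + 1)

lemma Pstar.compact {N : ℕ} {x : Config N} (h : Pstar x) : Compact x := by
  refine ⟨h.1, h.2.1, fun k hk hw => ?_⟩
  obtain ⟨_, _, h1, h2, _⟩ := h.2.2.2 (k + 1) (by omega) hk hw
  exact ⟨h1, h2.symm⟩

lemma st_congr {N : ℕ} (x : Config N) {i j : ℕ} (h : i = j) : st x i = st x j := by rw [h]

lemma lt_of_st {N : ℕ} {x : Config N} {i : ℕ} (hl : st x N = false) (h : st x i = true) :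
    i < N := by
  refine lt_of_le_of_ne (le_of_st h).2 ?_
  rintro rfl
  rw [hl] at h
  exact absurd h (by simp)

namespace Sys

variable {N : ℕ} [NeZero N] {Y : Sys N} {l : ℝ} {s x : Config N}

/-- A block of two particles moves one step to the right. -/
lemma reach_of_pair (hs : Y.Start l s) (hx : Y.Reach l s x) (hc : Compact x)
    (hl : st x (N - 1) = false) {k : ℕ} (h0 : st x k = false) (h1 : st x (k + 1) = true)
    (h2 : st x (k + 2) = true) (h3 : st x (k + 3) = false) :
    ∃ y, Y.Reach l s y ∧ nb y ≤ nb x + (if k = 0 then 1 else 0) ∧ dist y < dist x ∧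
      ∀ j, st y j = if j = k + 1 then false else if j = k + 3 then true else st x j := by
  have hN := Y.five_le
  have hkN : k + 3 < N := by
    have := lt_of_st hc.2.1 h2
    by_contra h
    rw [st_congr x (show N - 1 = k + 2 by omega), h2] at hl
    simp at hl
  have hk1 : k + 1 + 1 < N := by omega
  have hw : st x (k + 1 + 1) ≠ st x (k + 1 + 2) := by
    rw [show k + 1 + 1 = k + 2 by ring, show k + 1 + 2 = k + 3 by ring, h2, h3]; simp
  have h4 : st x (k + 4) = false := by
    have := (hc.2.2 _ hk1 hw).2
    rw [show k + 1 + 2 = k + 3 by ring, show k + 1 + 3 = k + 4 by ring, h3] at this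
    exact this.symm
  have hf : ∀ j, st (sw x (k + 1 + 1)) j = _ := st_sw x (by omega) hk1
  set y := sw x (k + 1 + 1) with hy
  have hxy := hx.step hs.1 (Y.isMax_compact hc hl hk1 hw)
  have g1 : st y 1 = true := by
    rw [hf, if_neg (by omega), if_neg (by omega)]; exact hc.1
  have gN : st y N = false := by
    rw [hf, if_neg (by omega), if_neg (by omega)]; exact hc.2.1
  have hg : Gain y k := by
    refine ⟨by omega, ?_, ?_, ?_⟩ <;> simp [hf, h0, h1, h2, h3, Nat.add_assoc]
  have hk : k + 1 < N := by omega
  have hf' : ∀ j, st (sw y (k + 1)) j = _ := st_sw y (by omega) hk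
  have e1 := nb_sw x hk1
  have e2 := nb_sw y hk
  have d1 := dist_sw x hk1
  have d2 := dist_sw y hk
  rw [← hy] at hxy e1 d1
  refine ⟨_, hxy.step hs.1 (Y.isMax_gain g1 gN hg), ?_, ?_, ?_⟩
  · simp [wl, hf, hf', h0, h1, h2, h3, h4, Nat.add_assoc] at e1 e2
    split_ifs with hk0
    · subst hk0
      simp at e2
      change nb (sw y 1) ≤ nb x + 1
      omega
    · rw [if_pos (by omega)] at e2
      simp at e2
      omega
  · simp [hf, h1, h2, h3, Nat.add_assoc] at d1 d2
    omega
  · intro j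
    rw [hf']
    by_cases a : j = k + 1
    · simp [a, hf, h3]
    by_cases b : j = k + 2
    · subst b; simp [hf, h1, h2]
    by_cases c : j = k + 3
    · subst c; simp [hf, h2]
    rw [if_neg a, if_neg b, if_neg a, if_neg c, hf, if_neg b, if_neg c]

lemma better_of_pair (hs : Y.Start l s) (hx : Y.Reach l s x) (hc : Compact x)
    (hl : st x (N - 1) = false) {k : ℕ} (h0 : st x k = false) (h1 : st x (k + 1) = true)
    (h2 : st x (k + 2) = true) (h3 : st x (k + 3) = false) : Y.Better l s x := by
  have hN := Y.five_le
  obtain ⟨y, hy, hn, hd, hf⟩ := reach_of_pair hs hx hc hl h0 h1 h2 h3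
  rcases Nat.eq_zero_or_pos k with rfl | hk0
  · simp only [zero_add] at hf h1 h2 h3
    have g1 : st y 1 = false := by simp [hf]
    have gN : st y N = false := by
      rw [hf, if_neg (by omega), if_neg (by omega)]; exact hc.2.1
    have hg := st_fl y hN
    refine ⟨_, hy.step hs.1 (Y.isMax_fl g1 gN), Or.inr ⟨?_, Or.inl ?_⟩⟩
    · have e' := nb_fl y hN
      simp [wl, hg, hf, h2] at e' hn
      omega
    · refine tl_lt_of_zero (i := 3) (by omega) (by omega) h3 fun j hj hj' => ?_
      obtain rfl | rfl | rfl : j = 1 ∨ j = 2 ∨ j = 3 := by omega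
      · simp [hg, hf]
      · simp [hg, hf, h2]
      · simp [hg, hf]
  · rw [if_neg (by omega)] at hn
    refine ⟨y, hy, Or.inr ⟨hn, Or.inr ⟨?_, hd⟩⟩⟩
    refine tl_le_of_zero hk0 h0 fun j hj => ?_
    rw [hf, if_neg (by omega), if_neg (by omega)]

lemma better_of_gap (hs : Y.Start l s) (hx : Y.Reach l s x) (hc : Compact x)
    (hl : st x (N - 1) = false) {k : ℕ} (h0 : st x k = true) (h1 : st x (k + 1) = true)
    (h2 : st x (k + 2) = false) (h3 : st x (k + 3) = false) (h4 : st x (k + 4) = true)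
    (h5 : st x (k + 5) = true) : Y.Better l s x := by
  have hN := Y.five_le
  have hk0 := (le_of_st h0).1
  have hkN : k + 5 < N := lt_of_st hc.2.1 h5
  by_cases hlead : ∀ j ≤ k + 1, 1 ≤ j → st x j = true
  · have hk1 : k + 2 + 1 < N := by omega
    have hw : st x (k + 2 + 1) ≠ st x (k + 2 + 2) := by
      rw [show k + 2 + 1 = k + 3 by ring, show k + 2 + 2 = k + 4 by ring, h3, h4]; simp
    have hf : ∀ j, st (sw x (k + 2 + 1)) j = _ := st_sw x (by omega) hk1
    set y := sw x (k + 2 + 1) with hy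
    have hxy := hx.step hs.1 (Y.isMax_compact hc hl hk1 hw)
    have g1 : st y 1 = true := by
      rw [hf, if_neg (by omega), if_neg (by omega)]; exact hc.1
    have gN : st y N = false := by
      rw [hf, if_neg (by omega), if_neg (by omega)]; exact hc.2.1
    have hg : Gain y (k + 1) := by
      refine ⟨by omega, ?_, ?_, ?_⟩ <;> simp [hf, h1, h2, h3, h4, Nat.add_assoc]
    have hk : k + 1 + 1 < N := by omega
    have hf' : ∀ j, st (sw y (k + 1 + 1)) j = _ := st_sw y (by omega) hk
    have e1 := nb_sw x hk1
    have e2 := nb_sw y hk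
    rw [← hy] at e1 hxy
    refine ⟨_, hxy.step hs.1 (Y.isMax_gain g1 gN hg), Or.inr ⟨?_, Or.inl ?_⟩⟩
    · simp [wl, hf, hf', h1, h2, h3, h4, h5, Nat.add_assoc] at e1 e2
      change nb (sw y (k + 2)) ≤ nb x
      omega
    · refine tl_lt_of_zero (i := k + 2) (by omega) (by omega) h2 fun j hj hj' => ?_
      rcases eq_or_ne j (k + 2) with rfl | hne
      · simp [hf', hf, h4]
      · rw [hf', if_neg (by omega), if_neg (by omega), hf, if_neg (by omega), if_neg (by omega)]
        exact hlead j (by omega) hj'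
  · push Not at hlead
    obtain ⟨j, hj, hj1, hj0⟩ := hlead
    simp only [ne_eq, Bool.not_eq_true] at hj0
    have hjk : j < k := by
      rcases lt_trichotomy j k with h | rfl | h
      · exact h
      · rw [h0] at hj0; exact absurd hj0 (by simp)
      · rw [show j = k + 1 by omega, h1] at hj0; exact absurd hj0 (by simp)
    have hk : k + 1 < N := by omega
    have hw : st x (k + 1) ≠ st x (k + 2) := by rw [h1, h2]; simp
    have hf : ∀ j, st (sw x (k + 1)) j = _ := st_sw x (by omega) hk
    set y := sw x (k + 1) with hy
    have hxy := hx.step hs.1 (Y.isMax_compact hc hl hk hw)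
    have g1 : st y 1 = true := by
      rw [hf, if_neg (by omega), if_neg (by omega)]; exact hc.1
    have gN : st y N = false := by
      rw [hf, if_neg (by omega), if_neg (by omega)]; exact hc.2.1
    have hg : Gain y (k + 1) := by
      refine ⟨by omega, ?_, ?_, ?_⟩ <;> simp [hf, h1, h2, h3, h4, Nat.add_assoc]
    have hk' : k + 1 + 1 < N := by omega
    have hf' : ∀ j, st (sw y (k + 1 + 1)) j = _ := st_sw y (by omega) hk'
    have e1 := nb_sw x hk
    have e2 := nb_sw y hk'
    have d1 := dist_sw x hk
    have d2 := dist_sw y hk'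
    rw [← hy] at e1 d1 hxy
    refine ⟨_, hxy.step hs.1 (Y.isMax_gain g1 gN hg), Or.inr ⟨?_, Or.inr ⟨?_, ?_⟩⟩⟩
    · simp [wl, hf, hf', h0, h1, h2, h3, h4, Nat.add_assoc] at e1 e2
      change nb (sw y (k + 2)) ≤ nb x
      omega
    · refine tl_le_of_zero hj1 hj0 fun i hi => ?_
      rw [hf', if_neg (by omega), if_neg (by omega), hf, if_neg (by omega), if_neg (by omega)]
    · simp [hf, h1, h2, h3, Nat.add_assoc] at d1 d2
      change dist (sw y (k + 2)) < dist x
      omega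

/-- The last particle of a compact configuration with a one-site gap at the right leaves. -/
lemma reach_of_short_gap (hs : Y.Hge l s) (hx : Y.Reach l s x) (hc : Compact x)
    (hl : st x (N - 1) = true) (hle : l ≤ Y.F x - Y.κ / 2) :
    ∃ y, Y.Reach l s y ∧ nb y ≤ nb x ∧ dist y < dist x ∧
      ∀ j, st y j = if j = N - 1 then false else st x j := by
  have hN := Y.five_le
  obtain ⟨k, hk⟩ : ∃ k, N = k + 2 := ⟨N - 2, by omega⟩
  have hl' : st x (k + 1) = true := by rw [← hl]; exact st_congr x (by omega)
  have hlast : st x (k + 2) = false := by rw [← hk]; exact hc.2.1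
  have hk1 : k + 1 < N := by omega
  have hw : st x (k + 1) ≠ st x (k + 2) := by rw [hl', hlast]; simp
  have h0 : st x k = true := by rw [(hc.2.2 k hk1 hw).1, hl']
  have hf : ∀ j, st (sw x (k + 1)) j = _ := st_sw x (by omega) hk1
  have hxy := Relation.ReflTransGen.tail hx (hop_step hc hle hk1 hw)
  have g1 : st (sw x (k + 1)) 1 = true := by
    rw [hf, if_neg (by omega), if_neg (by omega)]; exact hc.1
  have gN : st (sw x (k + 1)) N = true := by
    rw [st_congr _ hk, hf]; simp [hl']
  have gN' : st (sw x (k + 1)) (N - 1) = false := by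
    rw [show N - 1 = k + 1 by omega, hf]; simp [hlast]
  have hg := st_fr (sw x (k + 1)) hN
  have e1 := nb_sw x hk1
  have e2 := nb_fr (sw x (k + 1)) hN
  have d1 := dist_sw x hk1
  have d2 := dist_fr (sw x (k + 1)) hN gN
  have h3 : st x (k + 3) = false := st_gt x (by omega)
  have hr : Y.Reach l s (fr (sw x (k + 1))) :=
    Sys.Reach.step hxy hs (Y.isMax_fr g1 gN gN')
  refine ⟨_, hr, ?_, ?_, ?_⟩
  · simp [wl, hf, h0, hl', hlast, h3, Nat.add_assoc] at e1
    have a1 : wl (fr (sw x (k + 1))) (N - 1) = 0 := by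
      unfold wl
      rw [if_neg]
      rintro ⟨_, _, h⟩
      rw [Nat.sub_add_cancel (by omega), hg, if_pos rfl, gN] at h
      simp at h
    have a2 : wl (sw x (k + 1)) (N - 1) = 1 := by
      unfold wl
      rw [if_pos]
      refine ⟨by omega, gN', ?_⟩
      rw [Nat.sub_add_cancel (by omega), gN]
    omega
  · simp [hl', hlast] at d1
    omega
  · intro j
    rw [hg]
    by_cases a : j = N
    · rw [if_pos a, if_neg (by omega), gN, a, hc.2.1]; rfl
    rw [if_neg a, hf]
    by_cases b : j = k + 1
    · rw [if_pos b, if_pos (by omega), hlast]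
    · rw [if_neg b, if_neg (by omega), if_neg (by omega)]

lemma better_of_short_gap (hs : Y.Start l s) (hx : Y.Reach l s x) (hc : Compact x)
    (hl : st x (N - 1) = true) {j : ℕ} (hj : 1 ≤ j) (hj' : j < N - 1) (h0 : st x j = false) :
    Y.Better l s x := by
  obtain ⟨y, hy, hn, hd, hf⟩ := reach_of_short_gap hs.1 hx hc hl
    (hop_le hc hl (hs.2 x hc hl) (Or.inl hx))
  refine ⟨y, hy, Or.inr ⟨hn, Or.inr ⟨?_, hd⟩⟩⟩
  refine tl_le_of_zero hj h0 fun i hi => ?_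
  rw [hf, if_neg (by omega)]

lemma exists_pstar_of_all (hs : Y.Start l s) (hx : Y.Reach l s x)
    (h1 : ∀ j, 1 ≤ j → j < N → st x j = true) (hl : st x N = false) :
    ∃ p, Y.Reach l s p ∧ Pstar p := by
  have hN := Y.five_le
  have hc : Compact x := by
    refine ⟨h1 1 le_rfl (by omega), hl, fun k hk hw => ?_⟩
    have hk' : k + 2 = N := by
      by_contra hne
      rw [h1 (k + 1) (by omega) hk, h1 (k + 2) (by omega) (by omega)] at hw
      exact hw rfl
    refine ⟨?_, ?_⟩
    · rw [h1 (k + 1) (by omega) hk, h1 k (by omega) (by omega)]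
    · rw [hk', hl, st_gt x (by omega)]
  have hl' : st x (N - 1) = true := h1 _ (by omega) (by omega)
  obtain ⟨y, hy, -, -, hf⟩ := reach_of_short_gap hs.1 hx hc hl'
    (hop_le hc hl' (hs.2 x hc hl') (Or.inl hx))
  have hy' : ∀ j, st y j = decide (1 ≤ j ∧ j ≤ N - 2) := by
    intro j
    rw [hf]
    rcases Nat.eq_zero_or_pos j with rfl | hj
    · rw [if_neg (by omega), st_zero]; simp
    rcases lt_trichotomy j N with h | h | h
    · rcases eq_or_ne j (N - 1) with rfl | hne
      · rw [if_pos rfl]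
        simp; omega
      · rw [if_neg hne, h1 j hj h]
        simp; omega
    · rw [if_neg (by omega), h, hl]
      simp; omega
    · rw [if_neg (by omega), st_gt x h]
      simp; omega
  refine ⟨y, hy, ?_, ?_, ?_, ?_⟩
  · simp [hy']; omega
  · simp [hy']; omega
  · simp [hy']; omega
  · intro i hi hiN hw
    have : i = N - 2 := by
      by_contra hne
      apply hw
      simp only [hy', decide_eq_decide]
      omega
    subst this
    refine ⟨by omega, ?_⟩
    simp only [hy', decide_eq_decide]
    omega

lemma better_of_right (hs : Y.Start l s) (hx : Y.Reach l s x) (h1 : st x 1 = true)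
    (hl : st x N = true) {j : ℕ} (hj : 1 ≤ j) (hj' : j < N) (h0 : st x j = false) :
    Y.Better l s x := by
  have hN := Y.five_le
  rcases Y.isMax_fr_or_gain h1 hl with h | ⟨k, hk, hm⟩
  · have hf := st_fr x hN
    refine ⟨_, hx.step hs.1 h, Or.inr ⟨?_, Or.inr ⟨?_, ?_⟩⟩⟩
    · have := nb_fr x hN
      have h3 : wl (fr x) (N - 1) = 0 := by
        simp [wl, hf, hl, Nat.sub_add_cancel (show 1 ≤ N by omega)]
      omega
    · refine tl_le_of_zero hj h0 fun i hi => ?_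
      rw [hf, if_neg (by omega)]
    · have := dist_fr x hN hl
      omega
  · exact better_of_gain hs hx hk hm

lemma better_of_not_compact (hs : Y.Start l s) (hx : Y.Reach l s x) (h1 : st x 1 = true)
    (hl : st x N = false) (hc : ¬ Compact x) : Y.Better l s x := by
  by_cases hg : ∃ k, Gain x k
  · obtain ⟨k, hk⟩ := hg
    exact better_of_gain hs hx hk (Y.isMax_gain h1 hl hk)
  push Not at hg
  have hm : ∀ j, j + 1 < N → st x (j + 1) ≠ st x (j + 2) → 0 ≤ Y.φ x (sw x (j + 1)) →
      Y.IsMax x (sw x (j + 1)) := fun j hj hw => Y.isMax_zero h1 hl hg hj hw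
  have : ∃ k, k + 1 < N ∧ st x (k + 1) ≠ st x (k + 2) ∧
      ¬ (st x k = st x (k + 1) ∧ st x (k + 2) = st x (k + 3)) := by
    by_contra hcon
    push Not at hcon
    refine hc ⟨h1, hl, fun k hk hw => ?_⟩
    exact hcon k hk hw
  obtain ⟨k, hk, hw, hn⟩ := this
  have hgk := hg k
  unfold Gain at hgk
  rcases ha : st x k with _ | _ <;> rcases hb : st x (k + 1) with _ | _ <;>
    rcases hcc : st x (k + 2) with _ | _ <;> rcases hd : st x (k + 3) with _ | _ <;>
    simp [ha, hb, hcc, hd, hk] at hw hn hgk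
  · -- 0 0 1 0
    have hk2 : k + 2 < N := lt_of_st hl hcc
    rcases he : st x (k + 4) with _ | _
    · refine better_of_isolated (k := k + 1) hs hx hk2 hl hb hcc hd he (hm _ hk2 ?_ ?_)
      · simp [Nat.add_assoc, hcc, hd]
      · rw [Y.φ_sw hk2 (by simp [Nat.add_assoc, hcc, hd])]
        simp [Nat.add_assoc, hb, hcc, hd, he]
    · exact absurd ⟨hk2, by simp [Nat.add_assoc, hb, hcc], by simp [Nat.add_assoc, hcc, hd],
        by simp [Nat.add_assoc, hd, he]⟩ (hg (k + 1))
  · -- 0 1 0 0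
    refine better_of_isolated hs hx hk hl ha hb hcc hd (hm _ hk (by simp [hb, hcc]) ?_)
    rw [Y.φ_sw hk (by simp [hb, hcc])]
    simp [ha, hb, hcc, hd]
  · -- 1 0 1 1
    obtain ⟨m, rfl⟩ : ∃ m, k = m + 1 := ⟨k - 1, by have := (le_of_st ha).1; omega⟩
    rcases he : st x m with _ | _
    · exact absurd ⟨by omega, by simp [ha, he], by
        simp only [Nat.add_assoc] at hb; simp [ha, hb], by
        simp only [Nat.add_assoc] at hb hcc; simp [hcc, hb]⟩ (hg m)
    · exact better_of_hole hs hx he ha hb hcc hd hm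
  · -- 1 1 0 1
    have hk3 : k + 3 < N := lt_of_st hl hd
    rcases he : st x (k + 4) with _ | _
    · exact absurd ⟨by omega, by simp [Nat.add_assoc, hb, hcc], by simp [Nat.add_assoc, hcc, hd],
        by simp [Nat.add_assoc, hd, he]⟩ (hg (k + 1))
    · exact better_of_hole hs hx ha hb hcc hd he hm

lemma better_of_compact (hs : Y.Start l s) (hx : Y.Reach l s x) (hc : Compact x)
    (hl : st x (N - 1) = false) (hp : ¬ Pstar x) : Y.Better l s x := by
  have : ∃ k, k + 1 < N ∧ st x (k + 1) ≠ st x (k + 2) ∧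
      ¬ (3 ≤ k + 1 ∧ st x (k + 1 - 2) = st x (k + 1) ∧ st x (k + 4) = st x (k + 2)) := by
    by_contra hcon
    push Not at hcon
    refine hp ⟨hc.1, hc.2.1, hl, fun i hi hiN hw => ?_⟩
    obtain ⟨k, rfl⟩ : ∃ k, i = k + 1 := ⟨i - 1, by omega⟩
    obtain ⟨a1, a2⟩ := hc.2.2 k hiN hw
    obtain ⟨b1, b2, b3⟩ := hcon k hiN hw
    exact ⟨b1, b2, a1, a2.symm, b3⟩
  obtain ⟨k, hk, hw, hn⟩ := this
  obtain ⟨a1, a2⟩ := hc.2.2 k hk hw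
  have hk0 : k ≠ 0 := by
    rintro rfl
    rw [st_zero, hc.1] at a1
    simp at a1
  obtain ⟨m, rfl⟩ : ∃ m, k = m + 1 := ⟨k - 1, by omega⟩
  simp only [Nat.add_assoc, Nat.reduceAdd] at hw hn a1 a2
  rcases hb : st x (m + 2) with _ | _
  · have h3 : st x (m + 3) = true := by rw [hb] at hw; simpa using hw
    rw [hb] at a1 hn
    rw [h3] at a2 hn
    rcases hm : st x m with _ | _
    · have hm1 : 3 ≤ m + 2 := by
        rcases Nat.eq_zero_or_pos m with rfl | h
        · have := hc.1; rw [show (1 : ℕ) = 0 + 1 from rfl, a1] at this; simp at this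
        · omega
      have h5 : st x (m + 5) = false := by
        simpa [hm1, hm] using hn
      exact better_of_pair hs hx hc hl hb h3 a2.symm h5
    · obtain ⟨j, rfl⟩ : ∃ j, m = j + 1 := ⟨m - 1, by have := (le_of_st hm).1; omega⟩
      have := (hc.2.2 j (by omega) (by rw [hm, a1]; simp)).1
      rw [hm] at this
      exact better_of_gap hs hx hc hl this hm a1 hb h3 a2.symm
  · have h3 : st x (m + 3) = false := by rw [hb] at hw; simpa using hw
    rw [hb] at a1 hn
    rw [h3] at a2 hn
    rcases hm : st x m with _ | _
    · exact better_of_pair hs hx hc hl hm a1 hb h3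
    · have hm1 : 3 ≤ m + 2 := by have := (le_of_st hm).1; omega
      have h5 : st x (m + 5) = true := by
        simpa [hm1, hm] using hn
      have hN5 : m + 5 ≤ N := (le_of_st h5).2
      have h6 := (hc.2.2 (m + 3) (by omega) (by rw [a2.symm, h5]; simp)).2
      rw [h5] at h6
      exact better_of_gap hs hx hc hl a1 hb h3 a2.symm h5 h6.symm

/-- Following fastest transitions, one ends in a configuration with long blocks. -/
theorem exists_pstar (hs : Y.Start l s) : ∃ p, Y.Reach l s p ∧ Pstar p := by
  have hN := Y.five_le
  suffices h : ∀ x, Y.Reach l s x → ∃ p, Y.Reach l s p ∧ Pstar p from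
    h s Relation.ReflTransGen.refl
  intro x
  induction x using Prog.wf.induction with
  | _ x ih =>
  intro hx
  by_cases hp : Pstar x
  · exact ⟨x, hx, hp⟩
  have key : Y.Better l s x → ∃ p, Y.Reach l s p ∧ Pstar p := fun ⟨y, hy, h⟩ => ih y h hy
  rcases h1 : st x 1 with _ | _
  · exact key (better_of_left_empty hs hx h1)
  rcases hl : st x N with _ | _
  · by_cases hc : Compact x
    · rcases hl' : st x (N - 1) with _ | _
      · exact key (better_of_compact hs hx hc hl' hp)
      · by_cases hall : ∀ j, 1 ≤ j → j < N → st x j = true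
        · exact exists_pstar_of_all hs hx hall hl
        · push Not at hall
          obtain ⟨j, hj, hjN, h0⟩ := hall
          simp only [ne_eq, Bool.not_eq_true] at h0
          refine key (better_of_short_gap hs hx hc hl' hj ?_ h0)
          rcases eq_or_ne j (N - 1) with rfl | hne
          · rw [hl'] at h0; simp at h0
          · omega
    · exact key (better_of_not_compact hs hx h1 hl hc)
  · by_cases hall : ∀ j, 1 ≤ j → j < N → st x j = true
    · have hf := st_fr x hN
      rcases Y.isMax_fr_or_gain h1 hl with h | ⟨k, hk, -⟩
      · refine exists_pstar_of_all hs (hx.step hs.1 h) (fun j hj hj' => ?_) ?_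
        · rw [hf, if_neg (by omega), hall j hj hj']
        · rw [hf, if_pos rfl, hl]; rfl
      · exfalso
        refine hk.2.2.1 ?_
        have := hk.1
        rw [hall (k + 1) (by omega) hk.1]
        rcases eq_or_ne (k + 2) N with e | e
        · rw [e, hl]
        · rw [hall (k + 2) (by omega) (by omega)]
    · push Not at hall
      obtain ⟨j, hj, hjN, h0⟩ := hall
      simp only [ne_eq, Bool.not_eq_true] at h0
      exact key (better_of_right hs hx h1 hl hj hjN h0)

end Sys

end Kawasaki

namespace Kawasaki

/-- Exchanging the two sites of a wall of `z ∈ 𝒫*`. -/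
def IsSwitch {N : ℕ} (z e : Config N) : Prop :=
  ∃ k, k + 1 < N ∧ st z (k + 1) ≠ st z (k + 2) ∧ e = sw z (k + 1)

lemma Pstar.exists_wall {N : ℕ} {z : Config N} (hN : 1 ≤ N) (hz : Pstar z) :
    ∃ k, k + 1 < N ∧ st z (k + 1) ≠ st z (k + 2) := by
  by_contra hc
  push Not at hc
  have : ∀ k, k < N → st z (k + 1) = true := by
    intro k
    induction k with
    | zero => exact fun _ => hz.1
    | succ k ih => exact fun h => by rw [← hc k h]; exact ih (by omega)
  have h := this (N - 1) (by omega)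
  rw [Nat.sub_add_cancel (by omega), hz.2.1] at h
  exact absurd h (by simp)

lemma IsSwitch.allowed {N : ℕ} [NeZero N] {z e : Config N} (hN : 5 ≤ N) (he : IsSwitch z e) :
    Allowed z e := by
  obtain ⟨k, hk, hw, rfl⟩ := he
  exact allowed_sw hN (by omega) hk hw

lemma IsSwitch.not_compact {N : ℕ} {z e : Config N} (hz : Pstar z) (he : IsSwitch z e) : ¬ Compact e := by
  obtain ⟨k, hk, hw, rfl⟩ := he
  intro hc
  have hf : ∀ j, st (sw z (k + 1)) j = _ := st_sw z (by omega) hk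
  have h := (hc.2.2 k hk (by
    rw [hf, hf, if_pos rfl, if_neg (by omega), if_pos rfl]; exact hw.symm)).1
  rw [hf, hf, if_neg (by omega), if_neg (by omega), if_pos rfl,
    (hz.compact.2.2 k hk hw).1] at h
  exact hw h

namespace Sys

variable {N : ℕ} [NeZero N] {Y : Sys N} {l : ℝ} {s x z e b : Config N}

variable (Y) in
/-- The maximal value of `F`. -/
noncomputable def top : ℝ := ⨆ x, Y.F x

lemma le_top (x : Config N) : Y.F x ≤ Y.top := le_ciSup (Set.finite_range _).bddAbove x

lemma exists_top : ∃ x, Y.F x = Y.top := exists_eq_ciSup_of_finite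

lemma isMax_pstar (hz : Pstar z) {k : ℕ} (hk : k + 1 < N) (hw : st z (k + 1) ≠ st z (k + 2)) :
    Y.IsMax z (sw z (k + 1)) :=
  Y.isMax_compact hz.compact hz.2.2.1 hk hw

/-- A neighbour of `z` has small value of `F`. -/
lemma F_add_φ_le (hz : Pstar z) (hA : Allowed z e) :
    Y.F e + Y.φ e z ≤ Y.F z - Y.κ / 2 := by
  have h := hge_of_step (Y := Y) (l := Y.F e + Y.φ e z) ⟨allowed_symm Y.five_le hA, le_rfl⟩
  obtain ⟨k, hk, hw⟩ := hz.exists_wall (by have := Y.five_le; omega)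
  have h1 := h.le (isMax_pstar hz hk hw)
  rw [Y.φ_sw_loss hk hw (hz.compact.2.2 k hk hw).1 (hz.compact.2.2 k hk hw).2] at h1
  linarith

lemma φ_switch (hz : Pstar z) (he : IsSwitch z e) : Y.φ z e = -(Y.κ / 2) := by
  obtain ⟨k, hk, hw, rfl⟩ := he
  exact Y.φ_sw_loss hk hw (hz.compact.2.2 k hk hw).1 (hz.compact.2.2 k hk hw).2

lemma F_switch_le (hz : Pstar z) (he : IsSwitch z e) : Y.F e ≤ Y.F z - Y.κ := by
  have hA := he.allowed Y.five_le
  have h1 := F_add_φ_le (Y := Y) hz hA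
  have h2 := Y.φ_symm hA
  rw [φ_switch hz he] at h2
  linarith

/-- A switched configuration gains a bond only by switching back. -/
lemma switch_exit (hz : Pstar z) (he : IsSwitch z e) (hb : Allowed e b) (hbz : b ≠ z) :
    Y.φ e b ≤ 0 := by
  obtain ⟨k, hk, hw, rfl⟩ := he
  have hN := Y.five_le
  obtain ⟨h3, h1, h2, h4, h5⟩ := hz.2.2.2 (k + 1) (by omega) hk hw
  obtain ⟨m, rfl⟩ : ∃ m, k = m + 2 := ⟨k - 2, by omega⟩
  have hf : ∀ j, st (sw z (m + 2 + 1)) j = _ := st_sw z (by omega) hk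
  have hk2 : m + 4 < N := by
    by_contra h
    rw [st_congr z (show m + 2 + 1 = N - 1 by omega), st_congr z (show m + 2 + 2 = N by omega),
      hz.2.1, hz.2.2.1] at hw
    exact hw rfl
  simp only [Nat.add_assoc, Nat.reduceAdd] at h1 h2 h4 h5 hw
  change st z (m + 1) = _ at h1
  change st z (m + 2) = _ at h2
  rcases Y.allowed_cases hb with ⟨j, hj, hw', rfl⟩ | rfl | rfl
  · refine Y.φ_sw_nonpos hj hw' fun hg => ?_
    obtain ⟨-, g1, g2, g3⟩ := hg
    rcases lt_trichotomy j (m + 2) with h | rfl | h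
    · rcases (show j + 3 ≤ m + 2 ∨ j = m ∨ j = m + 1 by omega) with h' | rfl | rfl
      · rw [hf, hf, if_neg (by omega), if_neg (by omega), if_neg (by omega), if_neg (by omega)]
          at g1 g2
        rw [hf, if_neg (by omega), if_neg (by omega)] at g3
        exact g1 (hz.compact.2.2 j hj g2).1
      · refine g2 ?_
        rw [hf, hf, if_neg (by omega), if_neg (by omega), if_neg (by omega), if_neg (by omega),
          h1, h2]
      · refine g1 ?_
        rw [hf, hf, if_neg (by omega), if_neg (by omega), if_neg (by omega), if_neg (by omega),
          h1, h2]
    · exact hbz (sw_sw z (by omega) hk)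
    · rcases (show m + 5 ≤ j ∨ j = m + 3 ∨ j = m + 4 by omega) with h' | rfl | rfl
      · rw [hf, hf, if_neg (by omega), if_neg (by omega), if_neg (by omega), if_neg (by omega)]
          at g1 g2
        exact g1 (hz.compact.2.2 j hj g2).1
      · refine g3 ?_
        rw [hf, hf, if_neg (by omega), if_neg (by omega), if_neg (by omega), if_neg (by omega)]
        exact h4.trans h5.symm
      · refine g2 ?_
        rw [hf, hf, if_neg (by omega), if_neg (by omega), if_neg (by omega), if_neg (by omega)]
        exact h4.trans h5.symm
  · have : st (sw z (m + 2 + 1)) 1 = true := by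
      rw [hf, if_neg (by omega), if_neg (by omega)]; exact hz.1
    have := Y.φ_fl_true this
    have := Y.left
    have := Y.kpos
    linarith
  · have : st (sw z (m + 2 + 1)) N = false := by
      rw [hf, if_neg (by omega), if_neg (by omega)]; exact hz.2.1
    exact (Y.φ_fr_false this).le

/-- Entering `z ∈ 𝒫*` from outside its switching neighbourhood is slow. -/
lemma lt_of_reach_pstar (hz : Pstar z) (hs : s ≠ z) (hs' : ¬ IsSwitch z s)
    (hr : Y.Reach l s z) : l < Y.F z - Y.κ / 2 := by
  have e := Y.kpos
  have eL := Y.left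
  have eR := Y.right
  obtain ⟨b, a, hb, ha, hA, hle⟩ := exists_exit_of_reach {y | y = z ∨ IsSwitch z y}
    (by simp [hs, hs']) (by simp) hr
  simp only [Set.mem_ofPred_eq, not_or] at hb ha
  rcases hb with rfl | hb
  · rcases Y.allowed_cases hA with ⟨k, hk, hw, rfl⟩ | rfl | rfl
    · exact absurd ⟨k, hk, hw, rfl⟩ ha.2
    · have := Y.φ_fl_true hz.1
      linarith
    · have := Y.φ_fr_false_false hz.2.1 hz.2.2.1
      linarith
  · have h1 := switch_exit (Y := Y) hz hb hA ha.1
    have h2 := F_switch_le (Y := Y) hz hb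
    linarith

/-- Entering `z ∈ 𝒫*` from outside its neighbourhood is slow when the right gap is long. -/
lemma le_of_reach_pstar (hz : Pstar z) (hz' : st z (N - 2) = false) (hs : s ≠ z)
    (hs' : ¬ Allowed z s) (hr : Y.Reach l s z) : l ≤ Y.F z - Y.κ := by
  have hN := Y.five_le
  have e := Y.kpos
  have eL := Y.left
  have eR := Y.right
  obtain ⟨b, a, hb, ha, hA, hle⟩ := exists_exit_of_reach {y | y = z ∨ Allowed z y}
    (by simp [hs, hs']) (by simp) hr
  simp only [Set.mem_ofPred_eq, not_or] at hb ha
  rcases hb with rfl | hb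
  · exact absurd hA ha.2
  have h1 := F_add_φ_le (Y := Y) hz hb
  rcases Y.allowed_cases hb with ⟨k, hk, hw, rfl⟩ | rfl | rfl
  · have h1 := switch_exit (Y := Y) hz ⟨k, hk, hw, rfl⟩ hA ha.1
    have h2 := F_switch_le (Y := Y) hz ⟨k, hk, hw, rfl⟩
    linarith
  · have hf := st_fl z hN
    have h2 : st z 2 = true := by
      by_contra h
      have := hz.2.2.2 1 le_rfl (by omega) (by rw [hz.1]; exact fun h' => h h'.symm)
      omega
    have h3 := Y.φ_symm hb
    rw [Y.φ_fl z, hz.1, h2, o_true] at h3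
    have h4 : Y.φ (fl z) a ≤ Y.κ / 2 := by
      rcases Y.allowed_cases hA with ⟨k, hk, hw, rfl⟩ | rfl | rfl
      · exact Y.φ_sw_le hk hw
      · exact absurd (fl_fl hN z) ha.1
      · have : st (fl z) N = false := by rw [hf, if_neg (by omega)]; exact hz.2.1
        have := Y.φ_fr_false this
        linarith
    linarith
  · have hf := st_fr z hN
    have h3 := Y.φ_symm hb
    rw [Y.φ_fr_false_false hz.2.1 hz.2.2.1] at h3
    have h4 : Y.φ (fr z) a ≤ 0 := by
      rcases Y.allowed_cases hA with ⟨k, hk, hw, rfl⟩ | rfl | rfl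
      · refine Y.φ_sw_nonpos hk hw fun hg => ?_
        obtain ⟨-, g1, g2, g3⟩ := hg
        rcases (show k + 3 < N ∨ k + 3 = N ∨ k + 2 = N by omega) with h | h | h
        · rw [hf, hf, if_neg (by omega), if_neg (by omega)] at g1 g2
          exact g1 (hz.compact.2.2 k hk g2).1
        · refine g2 ?_
          rw [hf, hf, if_neg (by omega), if_neg (by omega), st_congr z (show k + 1 = N - 2 by omega),
            st_congr z (show k + 2 = N - 1 by omega), hz', hz.2.2.1]
        · refine g1 ?_
          rw [hf, hf, if_neg (by omega), if_neg (by omega), st_congr z (show k + 1 = N - 1 by omega),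
            st_congr z (show k = N - 2 by omega), hz', hz.2.2.1]
      · have : st (fr z) 1 = true := by rw [hf, if_neg (by omega)]; exact hz.1
        have := Y.φ_fl_true this
        linarith
      · exact absurd (fr_fr hN z) ha.1
    linarith

lemma F_nbr_lt (hz : Pstar z) (hA : Allowed z e) : Y.F e < Y.F z := by
  have k := Y.kpos
  have h1 := F_add_φ_le (Y := Y) hz hA
  have h2 := Y.φ_symm hA
  have h3 := compact_φ_lt_zero (Y := Y) hz.compact hA
  linarith

/-- Maximality of `F` propagates along fluxes at least `top - κ`. -/
lemma F_eq_top_of_reach (hz : Pstar z) (hz' : st z (N - 2) = false) (hs : Y.F s = Y.top)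
    (hr : Y.Reach (Y.top - Y.κ) s z) : Y.F z = Y.top := by
  by_cases h : s = z
  · rw [← h, hs]
  refine le_antisymm (le_top z) ?_
  by_cases hA : Allowed z s
  · have := F_nbr_lt (Y := Y) hz hA
    have := le_top (Y := Y) z
    linarith
  · have := le_of_reach_pstar hz hz' h hA hr
    linarith

lemma start_of_false (h : Y.Hge l s) (h1 : st s N = false) (h2 : st s (N - 1) = false) :
    Y.Start l s := by
  have hN := Y.five_le
  refine ⟨h, fun v hv hl => ⟨?_, ?_⟩⟩
  · rintro rfl
    rw [hl] at h2
    exact absurd h2 (by simp)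
  · rintro rfl
    rw [st_fr v hN, if_pos rfl, hv.2.1] at h1
    exact absurd h1 (by simp)

lemma hge_of_top (h : Y.F s = Y.top) : Y.Hge (Y.top - Y.κ / 2) s := by
  have hN := Y.five_le
  have e := Y.kpos
  by_cases hw : ∃ k, k + 1 < N ∧ st s (k + 1) ≠ st s (k + 2)
  · obtain ⟨k, hk, hw⟩ := hw
    refine ⟨_, Y.allowed_sw hk hw, ?_⟩
    have := Y.le_φ_sw hk hw
    linarith
  · push Not at hw
    rcases h1 : st s 1 with _ | _
    · refine ⟨_, allowed_fl hN s, ?_⟩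
      have := Y.φ_fl_false h1
      have := Y.left
      linarith
    · refine ⟨_, allowed_fr hN s, ?_⟩
      have : ∀ k, k < N → st s (k + 1) = true := by
        intro k
        induction k with
        | zero => exact fun _ => h1
        | succ k ih => exact fun h => by rw [← hw k h]; exact ih (by omega)
      have hl := this (N - 1) (by omega)
      rw [Nat.sub_add_cancel (by omega)] at hl
      have := Y.φ_fr_true hl
      linarith

/-- Configurations with large outgoing flux. -/
lemma cases_of_hge (h : Y.Hge (Y.top - Y.κ / 2) s) :
    Pstar s ∨ (∃ p, Pstar p ∧ IsSwitch p s) ∨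
      ∃ v, Compact v ∧ st v (N - 1) = true ∧ (s = v ∨ s = fr v) := by
  by_contra hc
  push Not at hc
  obtain ⟨h1, h2, h3⟩ := hc
  obtain ⟨p, hr, hp⟩ := exists_pstar (Y := Y) ⟨h, h3⟩
  have := lt_of_reach_pstar hp (by rintro rfl; exact h1 hp) (h2 p hp) hr
  have := le_top (Y := Y) p
  linarith

lemma pstar_of_top (h : Y.F s = Y.top) : Pstar s := by
  have e := Y.kpos
  rcases cases_of_hge (hge_of_top h) with h1 | ⟨p, hp, hs⟩ | ⟨v, hv, hl, rfl | rfl⟩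
  · exact h1
  · have := F_switch_le (Y := Y) hp hs
    have := le_top (Y := Y) p
    linarith
  · have hN := Y.five_le
    have hg := hge_of_top h
    obtain ⟨y, hy, -, -, hf⟩ := reach_of_short_gap hg Relation.ReflTransGen.refl hv hl (by rw [h])
    have hst : Y.Start (Y.top - Y.κ / 2) y := start_of_false (hge_of_reach hg hy)
      (by rw [hf, if_neg (by omega)]; exact hv.2.1) (by rw [hf, if_pos rfl])
    obtain ⟨p, hr, hp⟩ := exists_pstar hst
    have := lt_of_reach_pstar hp (by
      rintro rfl; have := hp.2.2.1; rw [hl] at this; exact absurd this (by simp))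
      (fun hsw => IsSwitch.not_compact hp hsw hv) (hy.trans hr)
    have := le_top (Y := Y) p
    linarith
  · have := F_fr_lt (Y := Y) hv
    have := le_top (Y := Y) v
    linarith

end Sys

end Kawasaki

namespace Kawasaki

lemma compact_add_pair {N : ℕ} {u x : Config N} (hu : Compact u) {k : ℕ} (hk : 3 ≤ k) (hkN : k + 1 < N)
    (h0 : ∀ j, k ≤ j + 2 → st u j = false)
    (hf : ∀ j, st x j = if j = k ∨ j = k + 1 then true else st u j) : Compact x := by
  refine ⟨by rw [hf, if_neg (by omega)]; exact hu.1,
    by rw [hf, if_neg (by omega)]; exact hu.2.1, fun i hi hw => ?_⟩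
  rw [hf, hf] at hw
  rw [hf, hf, hf, hf]
  rcases (show i + 3 < k ∨ i + 3 = k ∨ i + 2 = k ∨ i + 1 = k ∨ i = k ∨ k < i by omega) with
    h | h | h | h | h | h
  · rw [if_neg (by omega), if_neg (by omega)] at hw
    rw [if_neg (by omega), if_neg (by omega), if_neg (by omega), if_neg (by omega)]
    exact hu.2.2 i hi hw
  · rw [if_neg (by omega), if_neg (by omega), h0 _ (by omega), h0 _ (by omega)] at hw
    exact absurd rfl hw
  · rw [if_neg (by omega), if_neg (by omega), if_pos (by omega), if_pos (by omega),
      h0 _ (by omega), h0 _ (by omega)]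
    exact ⟨rfl, rfl⟩
  · rw [if_pos (by omega), if_pos (by omega)] at hw
    exact absurd rfl hw
  · rw [if_pos (by omega), if_pos (by omega), if_neg (by omega), if_neg (by omega),
      h0 _ (by omega), h0 _ (by omega)]
    exact ⟨rfl, rfl⟩
  · rw [if_neg (by omega), if_neg (by omega), h0 _ (by omega), h0 _ (by omega)] at hw
    exact absurd rfl hw

lemma Pstar.wall_of_last {N : ℕ} {z : Config N} {j : ℕ} (hz : Pstar z) (hj : st z j = true)
    (hj0 : ∀ i, j < i → st z i = false) : 3 ≤ j ∧ j + 2 ≤ N ∧ st z (j - 2) = true ∧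
      st z (j - 1) = true := by
  have h1 := (le_of_st hj).1
  have h2 := lt_of_st hz.2.1 hj
  obtain ⟨a1, a2, a3, -⟩ := hz.2.2.2 j h1 h2 (by rw [hj, hj0 _ (by omega)]; simp)
  refine ⟨a1, ?_, by rw [a2, hj], by rw [a3, hj]⟩
  by_contra h
  have := hz.2.2.1
  rw [st_congr z (show N - 1 = j by omega), hj] at this
  exact absurd this (by simp)

lemma compact_remove_last {N : ℕ} {z b : Config N} {j : ℕ} (hz : Pstar z) (hj : st z j = true)
    (hj0 : ∀ i, j < i → st z i = false)
    (hb : ∀ i, st b i = if i = j then false else st z i) : Compact b := by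
  obtain ⟨a1, a2, a3, a4⟩ := Pstar.wall_of_last hz hj hj0
  refine ⟨by rw [hb, if_neg (by omega)]; exact hz.1,
    by rw [hb, if_neg (by omega)]; exact hz.2.1, fun i hi hw => ?_⟩
  rw [hb, hb] at hw
  rw [hb, hb, hb, hb]
  rcases (show i + 3 < j ∨ i + 3 = j ∨ i + 2 = j ∨ j < i + 2 by omega) with h | h | h | h
  · rw [if_neg (by omega), if_neg (by omega)] at hw
    rw [if_neg (by omega), if_neg (by omega), if_neg (by omega), if_neg (by omega)]
    exact hz.compact.2.2 i hi hw
  · rw [if_neg (by omega), if_neg (by omega), st_congr z (show i + 1 = j - 2 by omega),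
      st_congr z (show i + 2 = j - 1 by omega), a3, a4] at hw
    exact absurd rfl hw
  · rw [if_neg (by omega), if_neg (by omega), if_pos (by omega), if_neg (by omega),
      st_congr z (show i = j - 2 by omega), st_congr z (show i + 1 = j - 1 by omega), a3, a4,
      hj0 (i + 3) (by omega)]
    exact ⟨rfl, rfl⟩
  · exfalso
    refine hw ?_
    rw [if_neg (show i + 2 ≠ j by omega), hj0 (i + 2) (by omega)]
    split_ifs
    · rfl
    · exact hj0 _ (by omega)

namespace Sys

variable {N : ℕ} [NeZero N] {Y : Sys N} {l : ℝ} {s x z e b u : Config N}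

/-- A single particle to the right of a compact configuration walks to the right end and leaves. -/
lemma reach_of_walker (hs : Y.Hge l s) (hb : Compact b) {k : ℕ} (hk : 3 ≤ k) (hkN : k ≤ N)
    (h0 : ∀ j, k ≤ j + 2 → st b j = false) (hx : Y.Reach l s x)
    (hf : ∀ j, st x j = if j = k then true else st b j) : Y.Reach l s b := by
  have hN := Y.five_le
  have g1 : st x 1 = true := by rw [hf, if_neg (by omega)]; exact hb.1
  induction hn : N - k generalizing k x with
  | zero =>
    obtain rfl : k = N := by omega
    have h := hx.step hs (Y.isMax_fr g1 (by rw [hf, if_pos rfl])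
      (by rw [hf, if_neg (by omega)]; exact h0 _ (by omega)))
    have : fr x = b := by
      refine ext_st fun j _ _ => ?_
      rw [st_fr x hN]
      split_ifs with hj
      · rw [hf, if_pos rfl, hj, hb.2.1]; rfl
      · rw [hf, if_neg hj]
    rwa [this] at h
  | succ n ih =>
    obtain ⟨i, rfl⟩ : ∃ i, k = i + 1 := ⟨k - 1, by omega⟩
    have hiN : i + 1 < N := by omega
    have z0 : st x i = false := by rw [hf, if_neg (by omega)]; exact h0 _ (by omega)
    have z1 : st x (i + 1) = true := by rw [hf, if_pos rfl]
    have z2 : st x (i + 2) = false := by rw [hf, if_neg (by omega)]; exact h0 _ (by omega)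
    have z3 : st x (i + 3) = false := by rw [hf, if_neg (by omega)]; exact h0 _ (by omega)
    have gN : st x N = false := by rw [hf, if_neg (by omega)]; exact hb.2.1
    have hw : st x (i + 1) ≠ st x (i + 2) := by rw [z1, z2]; simp
    have hg : ∀ j, ¬ Gain x j := by
      rintro j ⟨hj, w1, w2, w3⟩
      simp only [hf] at w1 w2 w3
      rcases (show j + 3 < i + 1 ∨ j + 3 = i + 1 ∨ j + 3 = i + 2 ∨ j + 3 = i + 3 ∨ i < j
        by omega) with h | h | h | h | h
      · rw [if_neg (by omega), if_neg (by omega)] at w1 w2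
        exact w1 (hb.2.2 j hj w2).1
      · rw [if_neg (by omega), if_neg (by omega), h0 _ (by omega), h0 _ (by omega)] at w2
        exact w2 rfl
      · rw [if_neg (by omega), if_neg (by omega), h0 _ (by omega), h0 _ (by omega)] at w1
        exact w1 rfl
      · rw [if_neg (by omega), if_neg (by omega), h0 _ (by omega), h0 _ (by omega)] at w3
        exact w3 rfl
      · rw [if_neg (by omega), if_neg (by omega), h0 _ (by omega), h0 _ (by omega)] at w2
        exact w2 rfl
    have h := hx.step hs (Y.isMax_zero g1 gN hg hiN hw (by
      rw [Y.φ_sw hiN hw, z0, z1, z2, z3]; simp))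
    refine ih (k := i + 2) (by omega) (by omega) (fun j hj => h0 j (by omega)) h (fun j => ?_)
      ?_ (by omega)
    · rw [st_sw x (by omega) hiN]
      by_cases a1 : j = i + 1
      · rw [if_pos a1, if_neg (by omega), z2, a1]; exact (h0 _ (by omega)).symm
      · rw [if_neg a1]
        by_cases a2 : j = i + 2
        · rw [if_pos a2, if_pos a2, z1]
        · rw [if_neg a2, if_neg a2, hf, if_neg a1]
    · rw [st_sw x (by omega) hiN, if_neg (by omega), if_neg (by omega)]; exact g1

/-- A pair of particles to the right of a compact configuration walks to the right end and
leaves. -/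
lemma reach_of_walking_pair (hs : Y.Start l s) (hu : Compact u) {k : ℕ} (hk : 3 ≤ k)
    (hkN : k + 1 < N) (h0 : ∀ j, k ≤ j + 2 → st u j = false) (hx : Y.Reach l s x)
    (hf : ∀ j, st x j = if j = k ∨ j = k + 1 then true else st u j) : Y.Reach l s u := by
  have hN := Y.five_le
  induction hn : N - k generalizing k x with
  | zero => omega
  | succ n ih =>
    have hc := compact_add_pair hu hk hkN h0 hf
    rcases (show k + 2 = N ∨ k + 2 < N by omega) with h | h
    · have hl : st x (N - 1) = true := by rw [hf, if_pos (by omega)]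
      obtain ⟨y, hy, -, -, hfy⟩ := reach_of_short_gap hs.1 hx hc hl
        (hop_le hc hl (hs.2 x hc hl) (Or.inl hx))
      refine reach_of_walker hs.1 hu hk (by omega) h0 hy fun j => ?_
      rw [hfy, hf]
      split_ifs with a1 a2 a3 a4 <;> first | rfl | omega | skip
      exact (h0 _ (by omega)).symm
    · obtain ⟨i, rfl⟩ : ∃ i, k = i + 1 := ⟨k - 1, by omega⟩
      have hl : st x (N - 1) = false := by
        rw [hf, if_neg (by omega)]; exact h0 _ (by omega)
      obtain ⟨y, hy, -, -, hfy⟩ := reach_of_pair hs hx hc hl (k := i)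
        (by rw [hf, if_neg (by omega)]; exact h0 _ (by omega)) (by rw [hf, if_pos (by omega)])
        (by rw [hf, if_pos (by omega)]) (by rw [hf, if_neg (by omega)]; exact h0 _ (by omega))
      refine ih (k := i + 2) (by omega) (by omega) (fun j hj => h0 j (by omega)) hy (fun j => ?_)
        (by omega)
      rw [hfy, hf]
      split_ifs with a1 a2 a3 a4 <;> first | rfl | omega | skip
      exact (h0 _ (by omega)).symm

lemma F_switch_of_top (hz : Pstar z) (ht : Y.F z = Y.top) (he : IsSwitch z e) :
    Y.F e = Y.top - Y.κ := by
  have hk := Y.kpos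
  have h1 := F_switch_le (Y := Y) hz he
  have hA := he.allowed Y.five_le
  have hφ := φ_switch (Y := Y) hz he
  have hs := Y.φ_symm hA
  obtain ⟨b, hb, hle⟩ := hge_of_step (Y := Y) (l := Y.top - Y.κ / 2) ⟨hA, by rw [ht, hφ]; linarith⟩
  have h2 : Y.φ e b ≤ Y.κ / 2 := by
    by_cases h : b = z
    · rw [h]; linarith
    · have := switch_exit (Y := Y) hz he hb h
      linarith
  linarith

/-- From a maximizer in `𝒫*` the last particle can leave to the right. -/
lemma reach_remove_last {j : ℕ} (hz : Pstar z) (ht : Y.F z = Y.top) (hj : st z j = true)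
    (hj0 : ∀ i, j < i → st z i = false)
    (hb : ∀ i, st b i = if i = j then false else st z i) :
    Y.Reach (Y.top - Y.κ) z b := by
  have hκ := Y.kpos
  obtain ⟨a1, a2, a3, a4⟩ := Pstar.wall_of_last hz hj hj0
  obtain ⟨i, rfl⟩ : ∃ i, j = i + 1 := ⟨j - 1, by omega⟩
  have hi : i + 1 < N := by omega
  have hw : st z (i + 1) ≠ st z (i + 2) := by rw [hj, hj0 _ (by omega)]; simp
  have hsw : IsSwitch z (sw z (i + 1)) := ⟨i, hi, hw, rfl⟩
  have hf : ∀ j, st (sw z (i + 1)) j = _ := st_sw z (by omega) hi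
  have hF := F_switch_of_top hz ht hsw
  have s1 : Y.Step (Y.top - Y.κ) z (sw z (i + 1)) :=
    ⟨Y.allowed_sw hi hw, by rw [ht, φ_switch hz hsw]; linarith⟩
  have hi' : i + 1 + 1 < N := by omega
  have z0 : st (sw z (i + 1)) (i + 1) = false := by
    rw [hf, if_pos rfl]; exact hj0 _ (by omega)
  have z1 : st (sw z (i + 1)) (i + 2) = true := by
    rw [hf, if_neg (by omega), if_pos rfl]; exact hj
  have z2 : st (sw z (i + 1)) (i + 3) = false := by
    rw [hf, if_neg (by omega), if_neg (by omega)]; exact hj0 _ (by omega)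
  have z3 : st (sw z (i + 1)) (i + 4) = false := by
    rw [hf, if_neg (by omega), if_neg (by omega)]; exact hj0 _ (by omega)
  have hw' : st (sw z (i + 1)) (i + 1 + 1) ≠ st (sw z (i + 1)) (i + 1 + 2) := by
    simp [Nat.add_assoc, z1, z2]
  have s2 : Y.Step (Y.top - Y.κ) (sw z (i + 1)) (sw (sw z (i + 1)) (i + 1 + 1)) := by
    refine ⟨Y.allowed_sw hi' hw', ?_⟩
    rw [hF, Y.φ_sw hi' hw']
    simp [Nat.add_assoc, z0, z1, z2, z3]
  have hg : Y.Hge (Y.top - Y.κ) z := ⟨_, s1⟩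
  refine reach_of_walker (k := i + 3) hg (compact_remove_last hz hj hj0 hb) (by omega) (by omega)
    (fun m hm => ?_) ((Relation.ReflTransGen.single s1).tail s2) (fun m => ?_)
  · rw [hb]
    split_ifs
    · rfl
    · exact hj0 _ (by omega)
  · rw [st_sw _ (by omega) hi', hb]
    by_cases b1 : m = i + 1 + 1
    · rw [if_pos b1, if_neg (by omega), if_neg (by omega), b1, hj0 (i + 1 + 1) (by omega)]
      exact z2
    · rw [if_neg b1]
      by_cases b2 : m = i + 3
      · rw [if_pos b2, if_pos (by omega)]
        exact z1
      · rw [if_neg (by omega), if_neg b2, hf]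
        by_cases b3 : m = i + 1
        · rw [if_pos b3, if_pos b3]
          exact hj0 _ (by omega)
        · rw [if_neg b3, if_neg (by omega), if_neg b3]

end Sys

end Kawasaki

namespace Kawasaki

/-- `x` consists of `a` particles, then `b` empty sites, then `c` particles, then empty sites. -/
def Shp {N : ℕ} (x : Config N) (a b c : ℕ) : Prop :=
  ∀ j, st x j = true ↔ (1 ≤ j ∧ j ≤ a ∨ a + b < j ∧ j ≤ a + b + c)

variable {N : ℕ} {x : Config N} {a b c a' b' c' : ℕ}

lemma Shp.pos (h : Shp x a b c) {j : ℕ} (hj : 1 ≤ j ∧ j ≤ a ∨ a + b < j ∧ j ≤ a + b + c) :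
    st x j = true := (h j).2 hj

lemma Shp.neg (h : Shp x a b c) {j : ℕ} (hj : ¬(1 ≤ j ∧ j ≤ a ∨ a + b < j ∧ j ≤ a + b + c)) :
    st x j = false := by
  rw [← Bool.not_eq_true, h]; exact hj

lemma Shp.sw (h : Shp x a b c) {k : ℕ} (hk : k + 1 < N)
    (h' : ∀ j, (1 ≤ j ∧ j ≤ a' ∨ a' + b' < j ∧ j ≤ a' + b' + c') ↔
      (j = k + 1 ∧ (1 ≤ k + 2 ∧ k + 2 ≤ a ∨ a + b < k + 2 ∧ k + 2 ≤ a + b + c) ∨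
        j = k + 2 ∧ (1 ≤ k + 1 ∧ k + 1 ≤ a ∨ a + b < k + 1 ∧ k + 1 ≤ a + b + c) ∨
        j ≠ k + 1 ∧ j ≠ k + 2 ∧ (1 ≤ j ∧ j ≤ a ∨ a + b < j ∧ j ≤ a + b + c))) :
    Shp (Kawasaki.sw x (k + 1)) a' b' c' := by
  intro j
  rw [h', st_sw x (by omega) hk]
  split_ifs with h1 h2
  · rw [h]; omega
  · rw [h]; omega
  · rw [h]; omega

lemma Shp.fl (h : Shp x a b c) (hN : 5 ≤ N)
    (h' : ∀ j, (1 ≤ j ∧ j ≤ a' ∨ a' + b' < j ∧ j ≤ a' + b' + c') ↔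
      (j = 1 ∧ ¬(1 ≤ 1 ∧ 1 ≤ a ∨ a + b < 1 ∧ 1 ≤ a + b + c) ∨
        j ≠ 1 ∧ (1 ≤ j ∧ j ≤ a ∨ a + b < j ∧ j ≤ a + b + c))) :
    Shp (Kawasaki.fl x) a' b' c' := by
  intro j
  rw [h', st_fl x hN]
  split_ifs with h1
  · rw [Bool.not_eq_true', ← Bool.not_eq_true, h]; omega
  · rw [h]; omega

lemma Shp.fr (h : Shp x a b c) (hN : 5 ≤ N)
    (h' : ∀ j, (1 ≤ j ∧ j ≤ a' ∨ a' + b' < j ∧ j ≤ a' + b' + c') ↔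
      (j = N ∧ ¬(1 ≤ N ∧ N ≤ a ∨ a + b < N ∧ N ≤ a + b + c) ∨
        j ≠ N ∧ (1 ≤ j ∧ j ≤ a ∨ a + b < j ∧ j ≤ a + b + c))) :
    Shp (Kawasaki.fr x) a' b' c' := by
  intro j
  rw [h', st_fr x hN]
  split_ifs with h1
  · rw [Bool.not_eq_true', ← Bool.not_eq_true, h]; omega
  · rw [h]; omega

/-- A set of configurations with at most two blocks of particles which is left only by
transitions of small flux. -/
def InC {N : ℕ} (x : Config N) : Prop :=
  ∃ a b c, a + b + c ≤ N ∧ (b ≤ 1 ∨ c ≤ 1 ∧ 2 ≤ a ∨ c = 2 ∧ a + b + c = N ∧ 2 ≤ a) ∧ Shp x a b c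

/-- The configurations which may have a transition of flux close to the maximum of `F`. -/
def Special (s : Config N) : Prop :=
  Pstar s ∨ (∃ p, Pstar p ∧ IsSwitch p s) ∨
    ∃ v, Compact v ∧ st v (N - 1) = true ∧ (s = v ∨ s = fr v)

lemma Special.two (hN : 5 ≤ N) {s : Config N} (h : Special s) :
    st s 1 = true ∧ st s 2 = true := by
  have hc : ∀ v : Config N, Compact v → st v 1 = true ∧ st v 2 = true := by
    refine fun v hv => ⟨hv.1, ?_⟩
    by_contra h
    have := (hv.2.2 0 (by omega) (by
      change st v 1 ≠ st v 2
      rw [hv.1]; exact fun e => h e.symm)).1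
    rw [st_zero] at this
    have h1 := hv.1
    simp_all
  rcases h with h | ⟨p, hp, k, hk, hw, rfl⟩ | ⟨v, hv, -, rfl | rfl⟩
  · exact hc _ h.compact
  · have h3 := (hp.2.2.2 (k + 1) (by omega) hk hw).1
    rw [st_sw p (by omega) hk, st_sw p (by omega) hk, if_neg (by omega), if_neg (by omega),
      if_neg (by omega), if_neg (by omega)]
    exact hc _ hp.compact
  · exact hc _ hv
  · rw [st_fr v hN, st_fr v hN, if_neg (by omega), if_neg (by omega)]
    exact hc _ hv

lemma Special.last (hN : 5 ≤ N) {s : Config N} (h : Special s) (hs : st s N = true) :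
    st s (N - 1) = true ∧ st s (N - 2) = true := by
  rcases h with h | ⟨p, hp, k, hk, hw, rfl⟩ | ⟨v, hv, hl, rfl | rfl⟩
  · rw [h.2.1] at hs; simp at hs
  · exfalso
    rw [st_sw p (by omega) hk, if_neg (by omega)] at hs
    split_ifs at hs with h1
    · have h2 := hp.2.1
      have h3 := hp.2.2.1
      rw [st_congr p h1] at h2
      rw [st_congr p (show N - 1 = k + 1 by omega)] at h3
      exact hw (h3.trans h2.symm)
    · rw [hp.2.1] at hs; simp at hs
  · rw [hv.2.1] at hs; simp at hs
  · rw [st_fr v hN, st_fr v hN, if_neg (by omega), if_neg (by omega)]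
    refine ⟨hl, ?_⟩
    have := (hv.2.2 (N - 2) (by omega) (by
      rw [st_congr v (show N - 2 + 1 = N - 1 by omega), st_congr v (show N - 2 + 2 = N by omega),
        hl, hv.2.1]
      simp)).1
    rw [this, st_congr v (show N - 2 + 1 = N - 1 by omega), hl]

lemma Compact.not_bump {N : ℕ} {v : Config N} (hv : Compact v) {i : ℕ} (hi : i + 2 < N)
    (h1 : st v (i + 1) ≠ st v (i + 2)) : st v (i + 2) = st v (i + 3) := by
  have := (hv.2.2 i (by omega) h1).2
  exact this

lemma Special.not_bump (hN : 5 ≤ N) {s : Config N} (h : Special s) {i : ℕ} (hi : i + 2 < N)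
    (h0 : st s i = st s (i + 1)) (h1 : st s (i + 1) ≠ st s (i + 2))
    (h2 : st s (i + 2) ≠ st s (i + 3)) : st s (i + 3) ≠ st s (i + 4) := by
  intro h3
  rcases h with h | ⟨p, hp, k, hk, hw, rfl⟩ | ⟨v, hv, hl, rfl | rfl⟩
  · exact h2 (h.compact.not_bump hi h1)
  · obtain ⟨a1, a2, a3, a4, a5⟩ := hp.2.2.2 (k + 1) (by omega) hk hw
    obtain ⟨m, rfl⟩ : ∃ m, k = m + 1 := ⟨k - 1, by omega⟩
    simp [Nat.add_assoc] at a2 a3 a4 a5 hw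
    have hf := st_sw p (show 1 ≤ m + 1 + 1 by omega) hk
    have e0 : st (sw p (m + 1 + 1)) m = st p (m + 2) := by
      rw [hf, if_neg (by omega), if_neg (by omega)]; exact a2
    have e1 : st (sw p (m + 1 + 1)) (m + 1) = st p (m + 2) := by
      rw [hf, if_neg (by omega), if_neg (by omega)]; exact a3
    have e2 : st (sw p (m + 1 + 1)) (m + 2) = st p (m + 3) := by
      rw [hf, if_pos (by omega)]
    have e3 : st (sw p (m + 1 + 1)) (m + 3) = st p (m + 2) := by
      rw [hf, if_neg (by omega), if_pos (by omega)]
    have e4 : st (sw p (m + 1 + 1)) (m + 4) = st p (m + 3) := by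
      rw [hf, if_neg (by omega), if_neg (by omega)]; exact a4
    have hfar : i + 3 < m + 2 ∨ m + 2 < i → False := by
      intro h
      rw [hf, hf, if_neg (by omega), if_neg (by omega), if_neg (by omega), if_neg (by omega)]
        at h1 h2
      exact h2 (hp.compact.not_bump hi h1)
    rcases (show (i + 3 < m + 2 ∨ m + 2 < i) ∨ i + 3 = m + 2 ∨ i + 2 = m + 2 ∨ i = m + 1 ∨
      i = m + 2 by omega) with h | h | h | h | h
    · exact hfar h
    · obtain rfl : m = i + 1 := by omega
      exact h1 (e0.trans e1.symm)
    · obtain rfl : i = m := by omega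
      exact hw (e3.symm.trans (h3.trans e4))
    · subst h
      exact hw (e1.symm.trans (h0.trans e2))
    · subst h
      exact hw (e3.symm.trans (h0.symm.trans e2))
  · exact h2 (hv.not_bump hi h1)
  · rw [st_fr v hN, st_fr v hN] at h1 h2 h3
    by_cases hi3 : i + 3 = N
    · rw [if_pos hi3, if_neg (by omega), st_gt v (show N < i + 4 by omega), hv.2.1] at h3
      simp at h3
    · rw [if_neg (by omega), if_neg (by omega)] at h1 h2
      exact h2 (hv.not_bump hi h1)

end Kawasaki

namespace Kawasaki

lemma Shp.wall {N : ℕ} {x : Config N} {a b c k : ℕ} (hx : Shp x a b c)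
    (hw : st x (k + 1) ≠ st x (k + 2)) :
    ¬((1 ≤ k + 1 ∧ k + 1 ≤ a ∨ a + b < k + 1 ∧ k + 1 ≤ a + b + c) ↔
      (1 ≤ k + 2 ∧ k + 2 ≤ a ∨ a + b < k + 2 ∧ k + 2 ≤ a + b + c)) := by
  rw [← hx, ← hx]
  intro h
  exact hw (Bool.eq_iff_iff.2 h)

namespace Sys

variable {N : ℕ} [NeZero N] {Y : Sys N} {x y w : Config N} {a b c k : ℕ}

lemma φ_sw_left (hk : k + 1 < N) (h : st x (k + 1) ≠ st x (k + 2)) (h1 : st x k ≠ st x (k + 1))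
    (h2 : st x (k + 2) = st x (k + 3)) : Y.φ x (sw x (k + 1)) = 0 := by
  rw [Y.φ_sw hk h, d_of_ne h1, h2]
  simp

lemma φ_sw_right (hk : k + 1 < N) (h : st x (k + 1) ≠ st x (k + 2)) (h1 : st x k = st x (k + 1))
    (h2 : st x (k + 2) ≠ st x (k + 3)) : Y.φ x (sw x (k + 1)) = 0 := by
  rw [Y.φ_sw hk h, d_of_ne h2, h1]
  simp

lemma exit_lt (hx : ¬ Special x) (hw : Allowed x w) (h : Y.φ x y + Y.κ / 2 ≤ Y.φ x w) :
    Y.F x + Y.φ x y < Y.top - Y.κ := by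
  by_contra hc
  exact hx (cases_of_hge (Y := Y) ⟨w, hw, by linarith⟩)

lemma exit_of_single (hN : a ≤ N) (hx : Shp x a 0 0) (hA : Allowed x y) (hy : ¬ InC y) :
    Y.F x + Y.φ x y < Y.top - Y.κ := by
  have h5 := Y.five_le
  have hκ := Y.kpos
  have hL := Y.left
  have hR := Y.right
  rcases Y.allowed_cases hA with ⟨k, hk, hw, rfl⟩ | rfl | rfl
  · have := hx.wall hw
    exact absurd ⟨a - 1, 1, 1, by omega, by omega, hx.sw hk (by intro j; omega)⟩ hy
  · rcases (show a = 0 ∨ 1 ≤ a by omega) with h | h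
    · exact absurd ⟨1, 0, 0, by omega, by omega, hx.fl h5 (by intro j; omega)⟩ hy
    · exact absurd ⟨0, 1, a - 1, by omega, by omega, hx.fl h5 (by intro j; omega)⟩ hy
  · rcases (show a = N ∨ a + 1 = N ∨ 2 ≤ a ∧ a < N ∨ a = 1 ∨ a = 0 by omega) with
      h | h | h | rfl | rfl
    · exact absurd ⟨N - 1, 0, 0, by omega, by omega, hx.fr h5 (by intro j; omega)⟩ hy
    · exact absurd ⟨N, 0, 0, by omega, by omega, hx.fr h5 (by intro j; omega)⟩ hy
    · exact absurd ⟨a, N - 1 - a, 1, by omega, by omega, hx.fr h5 (by intro j; omega)⟩ hy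
    · have h2 : st x 2 = false := hx.neg (by omega)
      have hw : st x (0 + 1) ≠ st x (0 + 2) := by
        rw [hx.pos (by omega), hx.neg (by omega)]; simp
      refine exit_lt (fun h => by simp [(h.two h5).2] at h2) (Y.allowed_sw (by omega) hw) ?_
      rw [φ_sw_left (by omega) hw (by rw [hx.pos (j := 0 + 1) (by omega), st_zero]; simp)
        (by rw [hx.neg (by omega), hx.neg (by omega)]),
        Y.φ_fr_false_false (hx.neg (by omega)) (hx.neg (by omega))]
      linarith
    · have h1 : st x 1 = false := hx.neg (by omega)
      refine exit_lt (fun h => by simp [(h.two h5).1] at h1) (allowed_fl h5 x) ?_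
      rw [Y.φ_fr_false_false (hx.neg (by omega)) (hx.neg (by omega))]
      have := Y.φ_fl_false h1
      linarith

/-- The transitions leaving `InC` from two blocks separated by one empty site. -/
lemma φ_exit_of_hole (hc : 1 ≤ c) (hN : a + 1 + c ≤ N) (hx : Shp x a 1 c) (hA : Allowed x y)
    (hy : ¬ InC y) :
    (Y.φ x y ≤ -(Y.κ / 2) ∧ 0 < a) ∨ Y.φ x y ≤ -(Y.κ / 2) ∧ a + 1 + c < N ∨
      Y.φ x y ≤ 0 ∧ c = 1 ∧ a < 2 := by
  have h5 := Y.five_le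
  have hκ := Y.kpos
  have hL := Y.left
  have hR := Y.right
  rcases Y.allowed_cases hA with ⟨k, hk, hw, rfl⟩ | rfl | rfl
  · have hw' := hx.wall hw
    rcases (show k + 1 = a ∨ k = a ∨ k = a + c by omega) with h | h | h
    · exact absurd ⟨a - 1, 1, c + 1, by omega, by omega, hx.sw hk (by intro j; omega)⟩ hy
    · exact absurd ⟨a + 1, 1, c - 1, by omega, by omega, hx.sw hk (by intro j; omega)⟩ hy
    · rcases (show c = 1 ∧ 2 ≤ a ∨ c = 1 ∧ a < 2 ∨ 2 ≤ c by omega) with ⟨rfl, h'⟩ | ⟨rfl, h'⟩ | h'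
      · exact absurd ⟨a, 2, 1, by omega, by omega, hx.sw hk (by intro j; omega)⟩ hy
      · refine Or.inr (Or.inr ⟨?_, rfl, h'⟩)
        rw [φ_sw_left hk hw]
        · rw [hx.neg (by omega), hx.pos (by omega)]; simp
        · rw [hx.neg (by omega), hx.neg (by omega)]
      · refine Or.inr (Or.inl ⟨?_, by omega⟩)
        rw [Y.φ_sw_loss hk hw]
        · rw [hx.pos (by omega), hx.pos (by omega)]
        · rw [hx.neg (by omega), hx.neg (by omega)]
  · rcases (show a = 0 ∨ 1 ≤ a by omega) with h | h
    · exact absurd ⟨c + 1, 0, 0, by omega, by omega, hx.fl h5 (by intro j; omega)⟩ hy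
    · have := Y.φ_fl_true (x := x) (hx.pos (by omega))
      exact Or.inl ⟨by linarith, h⟩
  · rcases (show a + 1 + c = N ∨ a + 1 + c + 1 = N ∨ a + 1 + c + 1 < N by omega) with h | h | h
    · exact absurd ⟨a, 1, c - 1, by omega, by omega, hx.fr h5 (by intro j; omega)⟩ hy
    · exact absurd ⟨a, 1, c + 1, by omega, by omega, hx.fr h5 (by intro j; omega)⟩ hy
    · have := Y.φ_fr_false_false (x := x) (hx.neg (by omega)) (hx.neg (by omega))
      exact Or.inr (Or.inl ⟨by linarith, by omega⟩)

lemma exit_of_hole (hc : 1 ≤ c) (hN : a + 1 + c ≤ N) (hx : Shp x a 1 c) (hA : Allowed x y)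
    (hy : ¬ InC y) : Y.F x + Y.φ x y < Y.top - Y.κ := by
  have h5 := Y.five_le
  have hκ := Y.kpos
  have hL := Y.left
  have hR := Y.right
  have hφ := φ_exit_of_hole (Y := Y) hc hN hx hA hy
  have hw : st x (a + 1) ≠ st x (a + 2) := by
    rw [hx.neg (by omega), hx.pos (by omega)]; simp
  have h0 : Y.φ x y ≤ 0 := by rcases hφ with h | h | h <;> linarith [h.1]
  rcases (show a = 0 ∨ a = 1 ∨ 2 ≤ a by omega) with rfl | rfl | ha
  · have h1 : st x 1 = false := hx.neg (by omega)
    refine exit_lt (fun h => by simp [(h.two h5).1] at h1) (allowed_fl h5 x) ?_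
    have := Y.φ_fl_false h1
    linarith
  · have h2 : st x 2 = false := hx.neg (by omega)
    refine exit_lt (fun h => by simp [(h.two h5).2] at h2) (Y.allowed_sw (by omega) hw) ?_
    have h1 : st x 1 ≠ st x (1 + 1) := by rw [hx.pos (by omega), hx.neg (by omega)]; simp
    rcases (show c = 1 ∨ 2 ≤ c by omega) with rfl | hc2
    · rw [Y.φ_sw_gain ⟨by omega, h1, hw, by rw [hx.pos (by omega), hx.neg (by omega)]; simp⟩]
      linarith
    · rw [φ_sw_left (by omega) hw h1 (by rw [hx.pos (by omega), hx.pos (by omega)])]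
      rcases hφ with h | h | h
      · linarith [h.1]
      · linarith [h.1]
      · omega
  · obtain ⟨i, rfl⟩ : ∃ i, a = i + 1 := ⟨a - 1, by omega⟩
    have h1 : st x (i + 1) ≠ st x (i + 1 + 1) := by
      rw [hx.pos (by omega), hx.neg (by omega)]; simp
    have h' : Y.φ x y ≤ -(Y.κ / 2) := by
      rcases hφ with h | h | h
      · exact h.1
      · exact h.1
      · omega
    rcases (show 2 ≤ c ∨ c = 1 by omega) with hc2 | rfl
    · refine exit_lt (fun h => ?_) (Y.allowed_sw (by omega) hw) ?_
      · refine h.not_bump h5 (i := i) (by omega) ?_ h1 ?_ ?_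
        · rw [hx.pos (by omega), hx.pos (by omega)]
        · rw [hx.neg (by omega), hx.pos (by omega)]; simp
        · rw [hx.pos (by omega), hx.pos (by omega)]
      · rw [φ_sw_left (by omega) hw h1 (by rw [hx.pos (by omega), hx.pos (by omega)])]
        linarith
    · rcases (show i + 1 + 1 + 1 = N ∨ i + 1 + 1 + 1 < N by omega) with hd | hd
      · refine exit_lt (fun h => ?_) (allowed_fr h5 x) ?_
        · have := (h.last h5 (hx.pos (by omega))).1
          rw [hx.neg (by omega)] at this
          simp at this
        · rw [Y.φ_fr_true_false (hx.pos (by omega)) (hx.neg (by omega))]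
          linarith
      · have hs : Shp (sw x (i + 1 + 1)) (i + 2) 0 0 := hx.sw (by omega) (by intro j; omega)
        have hp : Pstar (sw x (i + 1 + 1)) := by
          refine ⟨hs.pos (by omega), hs.neg (by omega), hs.neg (by omega), fun m hm hmN hmw => ?_⟩
          obtain ⟨n, rfl⟩ : ∃ n, m = n + 1 := ⟨m - 1, by omega⟩
          have := hs.wall hmw
          refine ⟨by omega, ?_, ?_, ?_, ?_⟩
          · rw [hs.pos (by omega), hs.pos (by omega)]
          · rw [hs.pos (by omega), hs.pos (by omega)]
          · rw [hs.neg (by omega), hs.neg (by omega)]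
          · rw [hs.neg (by omega), hs.neg (by omega)]
        have hsw : IsSwitch (sw x (i + 1 + 1)) x := by
          refine ⟨i + 1, by omega, ?_, (sw_sw x (by omega) (by omega)).symm⟩
          rw [hs.pos (by omega), hs.neg (by omega)]; simp
        have := F_switch_le (Y := Y) hp hsw
        have := Y.le_top (sw x (i + 1 + 1))
        linarith

lemma exit_of_single_right (ha : 2 ≤ a) (hb : 2 ≤ b) (hN : a + b + 1 ≤ N) (hx : Shp x a b 1)
    (hA : Allowed x y) (hy : ¬ InC y) : Y.F x + Y.φ x y < Y.top - Y.κ := by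
  have h5 := Y.five_le
  have hκ := Y.kpos
  have hL := Y.left
  have hR := Y.right
  obtain ⟨i, rfl⟩ : ∃ i, b = i + 1 := ⟨b - 1, by omega⟩
  have hw : st x (a + i + 1) ≠ st x (a + i + 2) := by
    rw [hx.neg (by omega), hx.pos (by omega)]; simp
  have h2 : st x (a + i + 2) ≠ st x (a + i + 3) := by
    rw [hx.pos (by omega), hx.neg (by omega)]; simp
  have h0 : st x (a + i) = st x (a + i + 1) := by
    rw [hx.neg (by omega), hx.neg (by omega)]
  have h' : Y.φ x y ≤ -(Y.κ / 2) := by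
    rcases Y.allowed_cases hA with ⟨k, hk, hw, rfl⟩ | rfl | rfl
    · have hw' := hx.wall hw
      rcases (show k + 1 = a ∨ k + 1 = a + i + 1 ∨ k + 1 = a + i + 2 by omega) with h | h | h
      · rw [Y.φ_sw_loss hk hw]
        · rw [hx.pos (by omega), hx.pos (by omega)]
        · rw [hx.neg (by omega), hx.neg (by omega)]
      · exact absurd ⟨a, i, 1, by omega, by omega, hx.sw hk (by intro j; omega)⟩ hy
      · exact absurd ⟨a, i + 2, 1, by omega, by omega, hx.sw hk (by intro j; omega)⟩ hy
    · have := Y.φ_fl_true (x := x) (hx.pos (by omega))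
      linarith
    · rcases (show a + i + 2 = N ∨ a + i + 3 = N ∨ a + i + 3 < N by omega) with h | h | h
      · exact absurd ⟨a, 0, 0, by omega, by omega, hx.fr h5 (by intro j; omega)⟩ hy
      · exact absurd ⟨a, i + 1, 2, by omega, by omega, hx.fr h5 (by intro j; omega)⟩ hy
      · have := Y.φ_fr_false_false (x := x) (hx.neg (by omega)) (hx.neg (by omega))
        linarith
  refine exit_lt (fun h => ?_) (Y.allowed_sw (by omega) hw) ?_
  · rcases (show a + i + 2 = N ∨ a + i + 2 < N by omega) with hd | hd
    · have := (h.last h5 (hx.pos (by omega))).1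
      rw [hx.neg (by omega)] at this
      simp at this
    · refine h.not_bump h5 hd h0 hw h2 ?_
      rw [hx.neg (by omega), hx.neg (by omega)]
  · rw [φ_sw_right (by omega) hw h0 h2]
    linarith

lemma exit_of_pair_right (ha : 2 ≤ a) (hb : 2 ≤ b) (hN : a + b + 2 = N) (hx : Shp x a b 2)
    (hA : Allowed x y) (hy : ¬ InC y) : Y.F x + Y.φ x y < Y.top - Y.κ := by
  have h5 := Y.five_le
  have hκ := Y.kpos
  have hL := Y.left
  have h' : Y.φ x y ≤ -(Y.κ / 2) := by
    rcases Y.allowed_cases hA with ⟨k, hk, hw, rfl⟩ | rfl | rfl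
    · have hw' := hx.wall hw
      rcases (show k + 1 = a ∨ k + 1 = a + b by omega) with h | h
      · rw [Y.φ_sw_loss hk hw]
        · rw [hx.pos (by omega), hx.pos (by omega)]
        · rw [hx.neg (by omega), hx.neg (by omega)]
      · rw [Y.φ_sw_loss hk hw]
        · rw [hx.neg (by omega), hx.neg (by omega)]
        · rw [hx.pos (by omega), hx.pos (by omega)]
    · have := Y.φ_fl_true (x := x) (hx.pos (by omega))
      linarith
    · exact absurd ⟨a, b, 1, by omega, by omega, hx.fr h5 (by intro j; omega)⟩ hy
  refine exit_lt (fun h => ?_) (allowed_fr h5 x) ?_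
  · have := (h.last h5 (hx.pos (by omega))).2
    rw [hx.neg (by omega)] at this
    simp at this
  · have := Y.φ_fr_true (x := x) (hx.pos (by omega))
    linarith

/-- Every transition leaving `InC` has flux less than the maximum of `F` minus `κ`. -/
lemma exit_of_inC (hx : InC x) (hA : Allowed x y) (hy : ¬ InC y) :
    Y.F x + Y.φ x y < Y.top - Y.κ := by
  obtain ⟨a, b, c, hN, h0, hx⟩ := hx
  rcases (show b = 0 ∨ c = 0 ∨ b = 1 ∧ 1 ≤ c ∨ 2 ≤ b ∧ c = 1 ∧ 2 ≤ a ∨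
    2 ≤ b ∧ c = 2 ∧ a + b + c = N ∧ 2 ≤ a by omega) with
    h | h | ⟨rfl, h⟩ | ⟨h1, rfl, h2⟩ | ⟨h1, rfl, h2, h3⟩
  · exact exit_of_single hN (fun j => (hx j).trans (by omega)) hA hy
  · exact exit_of_single (a := a) (by omega) (fun j => (hx j).trans (by omega)) hA hy
  · exact exit_of_hole h hN hx hA hy
  · exact exit_of_single_right h2 h1 hN hx hA hy
  · exact exit_of_pair_right h3 h1 h2 hx hA hy

end Sys

end Kawasaki

namespace Kawasaki

lemma st_mk_of_supp {N : ℕ} {f : ℕ → Bool} (hf : ∀ j, f j = true → 1 ≤ j ∧ j ≤ N) (j : ℕ) :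
    st (mk N f) j = f j := by
  by_cases h : 1 ≤ j ∧ j ≤ N
  · exact st_mk f h
  · rw [Bool.eq_iff_iff]
    exact ⟨fun h' => absurd (le_of_st h') h, fun h' => absurd (hf j h') h⟩

lemma exists_last_hole {N : ℕ} {y : Config N} {n i : ℕ} (hi : i < n) (h : st y i = false) :
    ∃ a, i ≤ a ∧ a < n ∧ st y a = false ∧ ∀ m, a < m → m < n → st y m = true := by
  refine ⟨Nat.findGreatest (fun m => st y m = false) (n - 1),
    Nat.le_findGreatest (by omega) h, ?_, ?_, fun m hm hmn => ?_⟩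
  · have := Nat.findGreatest_le (P := fun m => st y m = false) (n - 1)
    omega
  · exact Nat.findGreatest_spec (P := fun m => st y m = false) (m := i) (by omega) h
  · have := Nat.findGreatest_is_greatest hm (by omega)
    simpa using this

namespace Sys

variable {N : ℕ} [NeZero N] {Y : Sys N} {y : Config N}

/-- The maximizers of `F` consist of a single block of particles at the left end. -/
lemma shp_of_top (n : ℕ) (ht : Y.F y = Y.top) (hn : ∀ i, n < i → st y i = false) :
    ∃ p, 3 ≤ p ∧ p + 2 ≤ N ∧ p ≤ n ∧ Shp y p 0 0 := by
  induction n using Nat.strong_induction_on generalizing y with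
  | _ n ih =>
  have hκ := Y.kpos
  have hp := pstar_of_top ht
  by_cases hy : st y n = false
  · have h1 := hp.1
    have h0 : n ≠ 0 := by
      rintro rfl
      rw [hn 1 (by omega)] at h1; simp at h1
    obtain ⟨p, h3, h4, h5, h6⟩ := ih (n - 1) (by omega) ht (fun i hi => by
      rcases (show i = n ∨ n < i by omega) with rfl | h
      · exact hy
      · exact hn i h)
    exact ⟨p, h3, h4, by omega, h6⟩
  rw [Bool.not_eq_false] at hy
  obtain ⟨a1, a2, a3, a4⟩ := hp.wall_of_last hy hn
  by_cases hall : ∀ i, 1 ≤ i → i < n → st y i = true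
  · refine ⟨n, a1, a2, le_rfl, fun j => ⟨fun h => ?_, fun h => ?_⟩⟩
    · have h1 := (le_of_st h).1
      by_contra hj
      rw [hn j (by omega)] at h; simp at h
    · rcases (show j = n ∨ j < n by omega) with rfl | h'
      · exact hy
      · exact hall j (by omega) h'
  exfalso
  push Not at hall
  obtain ⟨i, hi1, hin, hi⟩ := hall
  obtain ⟨a, hia, han, ha, hlast⟩ := exists_last_hole hin (by simpa using hi)
  have hlast' : ∀ m, a < m → m ≤ n → st y m = true := by
    intro m h1 h2
    rcases (show m = n ∨ m < n by omega) with rfl | h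
    · exact hy
    · exact hlast m h1 h
  obtain ⟨b1, b2, b3, b4, b5⟩ := hp.2.2.2 a (by omega) (by omega) (by
    rw [ha, hlast' _ (by omega) (by omega)]; simp)
  rw [ha] at b2 b3
  rw [hlast' (a + 1) (by omega) (by omega)] at b4 b5
  have han3 : a + 3 ≤ n := by
    by_contra h
    rw [hn _ (by omega)] at b5; simp at b5
  have hb : ∀ i, st (Kawasaki.mk N fun i => if i = n then false else st y i) i =
      if i = n then false else st y i := by
    refine st_mk_of_supp fun j hj => ?_
    split_ifs at hj
    exact le_of_st hj
  set b : Config N := Kawasaki.mk N fun i => if i = n then false else st y i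
  have hr := reach_remove_last hp ht hy hn hb
  rcases (show a + 4 ≤ n ∨ n = a + 3 by omega) with h | rfl
  · have hpb : Pstar b := by
      refine ⟨by rw [hb, if_neg (by omega)]; exact hp.1,
        by rw [hb, if_neg (by omega)]; exact hp.2.1,
        by rw [hb, if_neg (by omega)]; exact hp.2.2.1, fun m hm hmN hw => ?_⟩
      rcases (show m ≤ a ∨ a < m ∧ m + 1 < n ∨ m + 1 = n ∨ n ≤ m by omega) with
        h' | h' | h' | h'
      · rw [hb, hb, if_neg (by omega), if_neg (by omega)] at hw
        rw [hb, hb, hb, hb, hb, hb, if_neg (by omega), if_neg (by omega), if_neg (by omega),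
          if_neg (by omega), if_neg (by omega), if_neg (by omega)]
        exact hp.2.2.2 m hm hmN hw
      · rw [hb, hb, if_neg (by omega), if_neg (by omega), hlast' _ (by omega) (by omega),
          hlast' _ (by omega) (by omega)] at hw
        exact absurd rfl hw
      · rw [hb, hb, hb, hb, hb, hb, if_neg (by omega), if_neg (by omega), if_neg (by omega),
          if_neg (by omega), if_pos h', if_neg (by omega), hlast' (m - 2) (by omega) (by omega),
          hlast' (m - 1) (by omega) (by omega), hlast' m (by omega) (by omega),
          hn (m + 2) (by omega), hn (m + 3) (by omega)]
        exact ⟨by omega, rfl, rfl, rfl, rfl⟩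
      · refine absurd ?_ hw
        rw [hb, hb, if_neg (show m + 1 ≠ n by omega), hn (m + 1) (by omega)]
        split_ifs
        · rfl
        · exact hn m (by omega)
    have hN2 : st b (N - 2) = false := by
      rw [hb]
      split_ifs
      · rfl
      · exact hn _ (by omega)
    obtain ⟨p, h3, h4, h5, h6⟩ := ih (n - 1) (by omega)
      (F_eq_top_of_reach hpb hN2 ht hr) (fun i hi => by
        rw [hb]
        split_ifs
        · rfl
        · exact hn _ (by omega))
    have e1 := (h6 (n - 1)).1 (by rw [hb, if_neg (by omega)]; exact hlast' _ (by omega) (by omega))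
    have e2 := (h6 a).2 (by omega)
    rw [hb, if_neg (by omega), ha] at e2
    simp at e2
  · have hu : ∀ i, st (Kawasaki.mk N fun i => if i < a then st y i else false) i =
        if i < a then st y i else false := by
      refine st_mk_of_supp fun j hj => ?_
      split_ifs at hj
      exact le_of_st hj
    set u : Config N := Kawasaki.mk N fun i => if i < a then st y i else false
    have hu0 : ∀ j, a + 1 ≤ j + 2 → st u j = false := by
      intro j hj
      rw [hu]
      split_ifs with h
      · rw [st_congr y (show j = a - 1 by omega), b3]
      · rfl
    have hu1 : ∀ j, j ≤ a → st u j = st y j := by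
      intro j hj
      rw [hu]
      split_ifs with h
      · rfl
      · rw [st_congr y (show j = a by omega), ha]
    have hpu : Pstar u := by
      refine ⟨by rw [hu1 _ (by omega)]; exact hp.1, hu0 _ (by omega), hu0 _ (by omega),
        fun m hm hmN hw => ?_⟩
      rcases (show m + 3 ≤ a ∨ m + 2 = a ∨ a < m + 2 by omega) with h' | h' | h'
      · rw [hu1 _ (by omega), hu1 _ (by omega)] at hw
        rw [hu1 _ (by omega), hu1 _ (by omega), hu1 _ (by omega), hu1 _ (by omega),
          hu1 _ (by omega), hu1 _ (by omega)]
        exact hp.2.2.2 m hm hmN hw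
      · rw [hu0 (m + 1) (by omega), hu1 m (by omega), st_congr y (show m = a - 2 by omega),
          b2] at hw
        exact absurd rfl hw
      · rw [hu0 _ (by omega), hu0 _ (by omega)] at hw
        exact absurd rfl hw
    have hH := hge_of_top ht
    have hs : Y.Start (Y.top - Y.κ) y := start_of_false
      (by obtain ⟨w, hw⟩ := hH; exact ⟨w, hw.1, by linarith [hw.2]⟩) hp.2.1 hp.2.2.1
    have hru := reach_of_walking_pair hs hpu.compact (k := a + 1) (by omega) (by omega) hu0 hr
      (fun j => by
        rw [hb]
        rcases (show j ≤ a ∨ j = a + 1 ∨ j = a + 2 ∨ j = a + 3 ∨ a + 3 < j by omega) with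
          h | h | h | h | h
        · rw [if_neg (by omega), if_neg (by omega), hu1 j h]
        · rw [if_neg (by omega), if_pos (by omega), hlast' _ (by omega) (by omega)]
        · rw [if_neg (by omega), if_pos (by omega), hlast' _ (by omega) (by omega)]
        · rw [if_pos h, if_neg (by omega), hu0 _ (by omega)]
        · rw [if_neg (by omega), if_neg (by omega), hu0 _ (by omega), hn _ h])
    obtain ⟨p, h3, h4, h5, h6⟩ := ih (a - 1) (by omega)
      (F_eq_top_of_reach hpu (hu0 _ (by omega)) ht hru) (fun i hi => hu0 i (by omega))
    have hpa : p + 3 ≤ a := by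
      have := h6.pos (j := p) (by omega)
      by_contra hc
      rcases (show p + 2 = a ∨ a < p + 2 by omega) with h | h
      · rw [hu1 _ (by omega), st_congr y (show p = a - 2 by omega), b2] at this
        simp at this
      · rw [hu0 _ (by omega)] at this
        simp at this
    have hyC : ¬ InC y := by
      rintro ⟨a', b', c', q1, q2, q3⟩
      have f1 : ∀ j, 1 ≤ j → j ≤ p → st y j = true := fun j _ _ => by
        rw [← hu1 j (by omega)]; exact h6.pos (by omega)
      have f2 : ∀ j, p < j → j ≤ a → st y j ≠ true := fun j _ _ => by
        rw [← hu1 j (by omega), h6.neg (by omega)]; simp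
      have e1 := (q3 1).1 (f1 1 (by omega) (by omega))
      have e2 := (q3 p).1 (f1 p (by omega) (by omega))
      have e3 := mt (q3 (p + 1)).2 (f2 _ (by omega) (by omega))
      have e4 := mt (q3 (p + 2)).2 (f2 _ (by omega) (by omega))
      have e5 := mt (q3 a).2 (f2 a (by omega) (by omega))
      have e6 := (q3 (a + 1)).1 (hlast' _ (by omega) (by omega))
      have e7 := (q3 (a + 2)).1 (hlast' _ (by omega) (by omega))
      have e8 := (q3 (a + 3)).1 (hlast' _ (by omega) (by omega))
      omega
    have huC : InC u := ⟨p, 0, 0, by omega, by omega, h6⟩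
    obtain ⟨v, w, hv, hw, hvw⟩ := exists_exit_of_reach {z | InC z} hyC huC hru
    have := exit_of_inC (Y := Y) hv hvw.1 hw
    linarith [hvw.2]

end Sys

end Kawasaki

namespace Kawasaki

lemma Shp.unique {N : ℕ} {x y : Config N} {a b c : ℕ} (hx : Shp x a b c) (hy : Shp y a b c) :
    x = y :=
  ext_st fun j _ _ => Bool.eq_iff_iff.2 ((hx j).trans (hy j).symm)

lemma shp_eta {N p : ℕ} (hp : p ≤ N) : Shp (eta N p) p 0 0 := by
  have h : eta N p = mk N fun j => decide (1 ≤ j ∧ j ≤ p) := by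
    funext k
    simp only [eta, mk, decide_eq_decide]
    omega
  intro j
  rw [h, st_mk_of_supp (fun j hj => by simp at hj; omega)]
  simp

lemma Shp.pstar {N : ℕ} {x : Config N} {p : ℕ} (hx : Shp x p 0 0) (h3 : 3 ≤ p)
    (hN : p + 2 ≤ N) : Pstar x := by
  refine ⟨hx.pos (by omega), hx.neg (by omega), hx.neg (by omega), fun m hm hmN hmw => ?_⟩
  obtain ⟨n, rfl⟩ : ∃ n, m = n + 1 := ⟨m - 1, by omega⟩
  have := hx.wall hmw
  refine ⟨by omega, ?_, ?_, ?_, ?_⟩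
  · rw [hx.pos (by omega), hx.pos (by omega)]
  · rw [hx.pos (by omega), hx.pos (by omega)]
  · rw [hx.neg (by omega), hx.neg (by omega)]
  · rw [hx.neg (by omega), hx.neg (by omega)]

namespace Sys

variable {N : ℕ} [NeZero N] {Y : Sys N} {l : ℝ} {s x y z : Config N} {a b c p : ℕ}

lemma F_pred_of_top (hx : Shp x (p + 1) 0 0) (ht : Y.F x = Y.top) (hp : 3 ≤ p)
    (hpN : p + 3 ≤ N) (hy : Shp y p 0 0) : Y.F y = Y.top := by
  refine F_eq_top_of_reach (hy.pstar hp (by omega)) (hy.neg (by omega)) ht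
    (reach_remove_last (hx.pstar (by omega) (by omega)) ht (hx.pos (j := p + 1) (by omega))
      (fun i hi => hx.neg (by omega)) fun i => ?_)
  split_ifs with h
  · exact hy.neg (by omega)
  · rw [Bool.eq_iff_iff, hy, hx]
    omega

/-- A hole moves to the left end, where it is filled. -/
lemma reach_of_hole (hs : Y.Hge l s) (hc : 2 ≤ c) (hN : a + 1 + c < N) (h3 : 3 ≤ a + c)
    (hx : Shp x a 1 c) (hr : Y.Reach l s x) (hy : Shp y (a + 1 + c) 0 0) : Y.Reach l s y := by
  have h5 := Y.five_le
  induction a generalizing c x with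
  | zero =>
    have h := hr.step hs (Y.isMax_fl (hx.neg (by omega)) (hx.neg (by omega)))
    rwa [(hx.fl h5 (a' := 0 + 1 + c) (b' := 0) (c' := 0) (by intro j; omega)).unique hy] at h
  | succ a ih =>
    have hw : st x (a + 1) ≠ st x (a + 2) := by
      rw [hx.pos (by omega), hx.neg (by omega)]; simp
    have h2 : st x (a + 2) ≠ st x (a + 3) := by
      rw [hx.neg (by omega), hx.pos (by omega)]; simp
    have hk : a + 1 < N := by omega
    have hm : Y.IsMax x (sw x (a + 1)) := by
      rcases Nat.eq_zero_or_pos a with rfl | ha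
      · refine Y.isMax_gain (hx.pos (by omega)) (hx.neg (by omega)) ⟨hk, ?_, hw, h2⟩
        rw [st_zero, hx.pos (by omega)]; simp
      · refine Y.isMax_zero (hx.pos (by omega)) (hx.neg (by omega)) ?_ hk hw
          (φ_sw_right hk hw (by rw [hx.pos (by omega), hx.pos (by omega)]) h2).ge
        rintro k ⟨h, w1, w2, w3⟩
        have e1 := hx.wall w2
        rcases (show k = a ∨ k = a + 1 ∨ k = a + c + 1 by omega) with h | h | h
        · rw [hx.pos (by omega), hx.pos (by omega)] at w1
          exact w1 rfl
        · rw [hx.pos (by omega), hx.pos (by omega)] at w3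
          exact w3 rfl
        · rw [hx.pos (by omega), hx.pos (by omega)] at w1
          exact w1 rfl
    exact ih (c := c + 1) (by omega) (by omega) (by omega)
      (hx.sw hk (by intro j; omega)) (hr.step hs hm) (fun j => (hy j).trans (by omega))

lemma reach_succ_of_top (hx : Shp x p 0 0) (ht : Y.F x = Y.top) (hp : 3 ≤ p)
    (hpN : p + 3 ≤ N) (hy : Shp y (p + 1) 0 0) : Y.Reach (Y.top - Y.κ) x y := by
  have hκ := Y.kpos
  obtain ⟨i, rfl⟩ : ∃ i, p = i + 2 := ⟨p - 2, by omega⟩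
  have hi : i + 1 + 1 < N := by omega
  have hw : st x (i + 1 + 1) ≠ st x (i + 1 + 2) := by
    rw [hx.pos (by omega), hx.neg (by omega)]; simp
  have hsw : IsSwitch x (sw x (i + 1 + 1)) := ⟨i + 1, hi, hw, rfl⟩
  have hpx := hx.pstar hp (by omega)
  have hF := F_switch_of_top hpx ht hsw
  have s1 : Y.Step (Y.top - Y.κ) x (sw x (i + 1 + 1)) :=
    ⟨Y.allowed_sw hi hw, by rw [ht, φ_switch hpx hsw]; linarith⟩
  have he : Shp (sw x (i + 1 + 1)) (i + 1) 1 1 := hx.sw hi (by intro j; omega)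
  have hi' : i + 1 < N := by omega
  have hw' : st (sw x (i + 1 + 1)) (i + 1) ≠ st (sw x (i + 1 + 1)) (i + 2) := by
    rw [he.pos (by omega), he.neg (by omega)]; simp
  have s2 : Y.Step (Y.top - Y.κ) (sw x (i + 1 + 1)) (sw (sw x (i + 1 + 1)) (i + 1)) := by
    refine ⟨Y.allowed_sw hi' hw', ?_⟩
    rw [hF, φ_sw_right hi' hw' (by rw [he.pos (by omega), he.pos (by omega)])
      (by rw [he.neg (by omega), he.pos (by omega)]; simp)]
    linarith
  exact reach_of_hole (a := i) (c := 2) ⟨_, s1⟩ le_rfl (by omega) (by omega)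
    (he.sw hi' (by intro j; omega)) ((Relation.ReflTransGen.single s1).tail s2)
    (fun j => (hy j).trans (by omega))

/-- The configurations which can be reached fast from the block with two empty sites. -/
def InEnd {N : ℕ} (x : Config N) : Prop :=
  ∃ a b c, (b = 0 ∧ c = 0 ∧ N ≤ a + 2 ∧ a ≤ N ∨ b = 1 ∧ c = 1 ∧ (a + 3 = N ∨ a + 2 = N) ∨
    a = 0 ∧ b = 1 ∧ N ≤ c + 3 ∧ c + 1 ≤ N) ∧ Shp x a b c

lemma lt_top_of_hge (hx : Shp x p 0 0) (hpN : N ≤ p + 1) (hp : p ≤ N) (h : Y.Hge l x) :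
    l < Y.top := by
  have h5 := Y.five_le
  have key : ∀ y : Config N, Shp y (N - 1) 0 0 → Y.Hge l y → l < Y.top := by
    rintro y hy ⟨z, hA, hl⟩
    have hc : Compact y := by
      refine ⟨hy.pos (by omega), hy.neg (by omega), fun k hk hw => ?_⟩
      have := hy.wall hw
      rw [hy.pos (by omega), hy.pos (by omega), hy.neg (by omega), hy.neg (by omega)]
      exact ⟨rfl, rfl⟩
    have := compact_φ_lt_zero (Y := Y) hc hA
    have := Y.le_top y
    linarith
  rcases (show p + 1 = N ∨ p = N by omega) with e | rfl
  · exact key x (fun j => (hx j).trans (by omega)) h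
  obtain ⟨y, hA, hl⟩ := h
  rcases Y.allowed_cases hA with ⟨k, hk, hw, rfl⟩ | rfl | rfl
  · have := hx.wall hw
    omega
  · have := Y.φ_fl_true (x := x) (hx.pos (by omega))
    have := Y.le_top x
    have := Y.kpos
    have := Y.left
    linarith
  · exact key _ (hx.fr h5 (by intro j; omega)) (hge_of_step ⟨hA, hl⟩)

lemma F_hole_lt (hx : Shp x 0 1 c) (hc : N ≤ c + 2) (hcN : c + 1 ≤ N) :
    Y.F x < Y.top - Y.κ := by
  have h5 := Y.five_le
  have hL := Y.left
  have h := lt_top_of_hge (hx.fl h5 (a' := c + 1) (b' := 0) (c' := 0) (by intro j; omega))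
    (by omega) hcN (hge_of_step (Y := Y) ⟨allowed_fl h5 x, le_rfl⟩)
  rw [Y.φ_fl, hx.neg (by omega), hx.pos (by omega), o_true, o_false] at h
  linarith

lemma exit_of_inEnd (hN : 6 ≤ N) (hx : Shp x (N - 2) 0 0) (ht : Y.F x < Y.top) (hy : InEnd y)
    (hA : Allowed y z) (hz : ¬ InEnd z) : Y.F y + Y.φ y z < Y.top - Y.κ := by
  have h5 := Y.five_le
  have hκ := Y.kpos
  have hL := Y.left
  have hR := Y.right
  have hpx := hx.pstar (by omega) (by omega)
  have hne : ∀ w, Shp w (N - 2) 0 0 → z ≠ w := by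
    rintro w hw rfl
    exact hz ⟨N - 2, 0, 0, by omega, hw⟩
  obtain ⟨a, b, c, ⟨rfl, rfl, h1, h2⟩ | ⟨rfl, rfl, h⟩ | ⟨rfl, rfl, h1, h2⟩, hy⟩ := hy
  · exfalso
    rcases Y.allowed_cases hA with ⟨k, hk, hw, rfl⟩ | rfl | rfl
    · have := hy.wall hw
      exact hz ⟨a - 1, 1, 1, by omega, hy.sw hk (by intro j; omega)⟩
    · exact hz ⟨0, 1, a - 1, by omega, hy.fl h5 (by intro j; omega)⟩
    · rcases (show a + 2 = N ∨ a + 1 = N ∨ a = N by omega) with h | h | h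
      · exact hz ⟨a, 1, 1, by omega, hy.fr h5 (by intro j; omega)⟩
      · exact hz ⟨a + 1, 0, 0, by omega, hy.fr h5 (by intro j; omega)⟩
      · exact hz ⟨a - 1, 0, 0, by omega, hy.fr h5 (by intro j; omega)⟩
  · rcases h with h | h
    · have hw : st x (a + 1) ≠ st x (a + 2) := by
        rw [hx.pos (by omega), hx.neg (by omega)]; simp
      have hsw : IsSwitch x y :=
        ⟨a, by omega, hw, hy.unique (hx.sw (by omega) (by intro j; omega))⟩
      have e1 := F_switch_le (Y := Y) hpx hsw
      have e2 := switch_exit (Y := Y) hpx hsw hA (hne x hx)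
      linarith
    · have hyx : y = fr x := hy.unique (hx.fr h5 (by intro j; omega))
      have e1 := F_add_φ_le (Y := Y) hpx (allowed_fr h5 x)
      rw [← hyx, Y.φ_symm (by rw [hyx]; exact allowed_fr h5 x), hyx,
        Y.φ_fr_false_false (hx.neg (by omega)) (hx.neg (by omega)), ← hyx] at e1
      have e2 : Y.φ y z ≤ 0 := by
        rcases Y.allowed_cases hA with ⟨k, hk, hw, rfl⟩ | rfl | rfl
        · have := hy.wall hw
          rcases (show k + 1 = a ∨ k = a by omega) with h | rfl
          · rw [φ_sw_right hk hw]
            · rw [hy.pos (by omega), hy.pos (by omega)]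
            · rw [hy.neg (by omega), hy.pos (by omega)]; simp
          · exact absurd ⟨k + 1, 0, 0, by omega, hy.sw hk (by intro j; omega)⟩ hz
        · have := Y.φ_fl_true (x := y) (hy.pos (by omega))
          linarith
        · exact absurd (hy.fr h5 (by intro j; omega)) (fun h => hne _ h rfl)
      linarith
  · rcases (show c + 3 = N ∨ N ≤ c + 2 by omega) with h | h
    · have hyx : y = fl x := hy.unique (hx.fl h5 (by intro j; omega))
      have e1 := F_add_φ_le (Y := Y) hpx (allowed_fl h5 x)
      rw [← hyx, Y.φ_symm (by rw [hyx]; exact allowed_fl h5 x), hyx,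
        Y.φ_fl, hx.pos (by omega), hx.pos (by omega), o_true, ← hyx] at e1
      have e2 : Y.φ y z ≤ Y.κ / 2 := by
        rcases Y.allowed_cases hA with ⟨k, hk, hw, rfl⟩ | rfl | rfl
        · exact Y.φ_sw_le hk hw
        · exact absurd (hy.fl h5 (by intro j; omega)) (fun h => hne _ h rfl)
        · have := Y.φ_fr_false (x := y) (hy.neg (by omega))
          linarith
      linarith
    · have e1 := F_hole_lt (Y := Y) hy h h2
      have e2 : Y.φ y z ≤ 0 := by
        rcases Y.allowed_cases hA with ⟨k, hk, hw, rfl⟩ | rfl | rfl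
        · have := hy.wall hw
          rcases (show k = 0 ∨ k = c by omega) with rfl | rfl
          · rw [Y.φ_sw_loss hk hw]
            · linarith
            · rw [hy.neg (by omega), hy.neg (by omega)]
            · rw [hy.pos (by omega), hy.pos (by omega)]
          · rw [Y.φ_sw_loss hk hw]
            · linarith
            · rw [hy.pos (by omega), hy.pos (by omega)]
            · rw [hy.neg (by omega), hy.neg (by omega)]
        · exact absurd ⟨c + 1, 0, 0, by omega, hy.fl h5 (by intro j; omega)⟩ hz
        · rcases (show c + 2 = N ∨ c + 1 = N by omega) with h | h
          · exact absurd ⟨0, 1, c + 1, by omega, hy.fr h5 (by intro j; omega)⟩ hz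
          · exact absurd ⟨0, 1, c - 1, by omega, hy.fr h5 (by intro j; omega)⟩ hz
      linarith

lemma F_succ_of_top (hx : Shp x p 0 0) (ht : Y.F x = Y.top) (hp : 3 ≤ p)
    (hpN : p + 3 ≤ N) (hy : Shp y (p + 1) 0 0) : Y.F y = Y.top := by
  have hr := reach_succ_of_top hx ht hp hpN hy
  rcases (show p + 4 ≤ N ∨ p + 3 = N by omega) with h | h
  · exact F_eq_top_of_reach (hy.pstar (by omega) (by omega)) (hy.neg (by omega)) ht hr
  by_contra hlt
  have hlt' := lt_of_le_of_ne (Y.le_top y) hlt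
  have hyE : InEnd y := ⟨p + 1, 0, 0, by omega, hy⟩
  have hxE : ¬ InEnd x := by
    rintro ⟨a, b, c, h1, h2⟩
    have e1 := (h2 p).1 (hx.pos (by omega))
    have e2 := mt (h2 (p + 1)).2 (by rw [hx.neg (by omega)]; simp)
    have e3 := mt (h2 (p + 2)).2 (by rw [hx.neg (by omega)]; simp)
    have e4 := mt (h2 (p + 3)).2 (by rw [hx.neg (by omega)]; simp)
    have e5 := (h2 1).1 (hx.pos (by omega))
    omega
  obtain ⟨v, w, hv, hw, hvw⟩ := exists_exit_of_reach {z | InEnd z} hxE hyE hr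
  have := exit_of_inEnd (Y := Y) (by omega) (fun j => (hy j).trans (by omega)) hlt' hv hvw.1 hw
  linarith [hvw.2]

lemma F_eta (hp : 3 ≤ p) (hpN : p + 2 ≤ N) : Y.F (eta N p) = Y.top := by
  obtain ⟨x, hx⟩ := Y.exists_top
  obtain ⟨q, h1, h2, -, h3⟩ := shp_of_top N hx (fun i hi => st_gt x hi)
  have up : ∀ n, q + n + 2 ≤ N → Y.F (eta N (q + n)) = Y.top := by
    intro n
    induction n with
    | zero => intro _; rwa [Nat.add_zero, ← h3.unique (shp_eta (by omega))]
    | succ n ih =>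
      intro h
      exact F_succ_of_top (shp_eta (by omega)) (ih (by omega)) (by omega) (by omega)
        (shp_eta (p := q + n + 1) (by omega))
  have down : ∀ n m, m + n = q → 3 ≤ m → Y.F (eta N m) = Y.top := by
    intro n
    induction n with
    | zero => intro m hm _; obtain rfl : m = q := by omega
              exact up 0 h2
    | succ n ih =>
      intro m hm hm3
      exact F_pred_of_top (shp_eta (by omega)) (ih (m + 1) (by omega) (by omega)) hm3 (by omega)
        (shp_eta (by omega))
  rcases le_total p q with h | h
  · exact down (q - p) p (by omega) hp
  · have := up (p - q) (by omega)
    rwa [show q + (p - q) = p by omega] at this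

lemma F_eq_top_iff (x : Config N) : Y.F x = Y.top ↔ memD x := by
  constructor
  · intro h
    obtain ⟨p, h1, h2, -, h3⟩ := shp_of_top N h (fun i hi => st_gt x hi)
    exact ⟨p, N - p, h1, by omega, by omega, h3.unique (shp_eta (by omega))⟩
  · rintro ⟨p, q, h1, h2, h3, rfl⟩
    exact F_eta h1 (by omega)

end Sys

end Kawasaki

namespace Kawasaki

variable {N : ℕ} [NeZero N]

lemma exists_allowed_dist_lt (hN : 5 ≤ N) (y : Config N) (hy : y ≠ fun _ => false) :
    ∃ z, Allowed y z ∧ dist z < dist y := by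
  obtain ⟨k, hk⟩ : ∃ k, y k = true := by
    by_contra h
    push Not at h
    exact hy (funext fun k => by simpa using h k)
  have hk' : st y (k + 1) = true := by rw [st_succ, hk]
  have hj : st y (Nat.findGreatest (fun m => st y m = true) N) = true :=
    Nat.findGreatest_spec (P := fun m => st y m = true) (m := k + 1) (by omega) hk'
  have hlast : ∀ m, Nat.findGreatest (fun m => st y m = true) N < m → st y m = false := by
    intro m hm
    by_cases hmN : m ≤ N
    · simpa using Nat.findGreatest_is_greatest hm hmN
    · exact st_gt y (by omega)
  obtain ⟨h1, h2⟩ := le_of_st hj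
  obtain ⟨i, hi⟩ : ∃ i, Nat.findGreatest (fun m => st y m = true) N = i + 1 :=
    ⟨Nat.findGreatest (fun m => st y m = true) N - 1, by omega⟩
  rw [hi] at hj hlast h2
  rcases (show i + 1 = N ∨ i + 1 < N by omega) with h | h
  · refine ⟨fr y, allowed_fr hN y, ?_⟩
    have := dist_fr y hN (by rw [← st_congr y h]; exact hj)
    omega
  · have h0 := hlast (i + 2) (by omega)
    refine ⟨sw y (i + 1), allowed_sw hN (by omega) h (by rw [hj, h0]; simp), ?_⟩
    have := dist_sw y h
    rw [hj, h0] at this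
    simp at this
    omega

lemma exists_inTree (hN : 5 ≤ N) (x : Config N) : ∃ t, InTree (Allowed (N := N)) t x := by
  obtain ⟨t, ht⟩ := exists_inTree_of_height (A := Allowed (N := N)) (fun _ => false) dist
    (exists_allowed_dist_lt hN)
  refine exists_inTree_of_reflTransGen (fun _ _ h => h.1) ht ?_
  induction hn : dist x using Nat.strong_induction_on generalizing x with
  | _ n ih =>
    by_cases hx : x = fun _ => false
    · rw [hx]
    · obtain ⟨z, hz, hlt⟩ := exists_allowed_dist_lt hN x hx
      exact (ih (dist z) (hn ▸ hlt) z rfl).tail (allowed_symm hN hz)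

end Kawasaki

open Kawasaki in
/-- for `μ_L > κ > 0 > μ_R`, `|μ_R| > κ`, the function `Ψ = Γ - Θ` is
constant on `𝒟 = {η_{p,q} : p ≥ 3, q ≥ 2, p + q = N}` and strictly larger there than
anywhere else; i.e. the maximizers of `Ψ` are exactly the states of `𝒟`. -/
theorem statement1 (N : ℕ) [NeZero N] (hN : 5 ≤ N) (κ μL μR : ℝ)
    (hκ : 0 < κ) (hμL : κ < μL) (hμR : μR < 0) (hμRκ : κ < |μR|) :
    (∀ x y : Config N, memD x → memD y → Psi κ μL μR x = Psi κ μL μR y) ∧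
    (∀ x y : Config N, memD x → ¬ memD y → Psi κ μL μR y < Psi κ μL μR x) := by
  have hR : |μR| = -μR := abs_of_neg hμR
  let Y : Sys N :=
    { κ := κ, μL := μL, μR := μR, F := Psi κ μL μR, five_le := hN, kpos := hκ, left := hμL
      right := by linarith
      cut := fun S _ _ ha hb hab =>
        cut_of_isGreatest (fun x => isGreatest_Psi κ μL μR (exists_inTree hN x)) S ha hb hab }
  have htop : ∀ x, Psi κ μL μR x = Y.top ↔ memD x := Y.F_eq_top_iff
  refine ⟨fun x y hx hy => ?_, fun x y hx hy => ?_⟩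
  · rw [(htop x).2 hx, (htop y).2 hy]
  · rw [(htop x).2 hx]
    exact lt_of_le_of_ne (Y.le_top y) (fun h => hy ((htop y).1 h))
end

section
/- Let K be a finite set with a cost function U as below, and let 𝒜 = ∪_i A_i be the union of all attractors in K. Then for every y ∈ K there exists x ∈ 𝒜 with 𝒰(y,x) = 0. -/
open scoped Classical ENNReal

namespace AttractorSetup

variable {K : Type*}

/-- The cost of a path: the sum of `U` over its consecutive steps. -/
noncomputable def pathCost (U : K → K → ℝ≥0∞) : List K → ℝ≥0∞
  | [] => 0
  | [_] => 0
  | a :: b :: l => U a b + pathCost U (b :: l)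

/-- `𝒰(x,y)`: the minimal cost over all paths from `x` to `y` (paths take only
finite-cost steps). -/
noncomputable def Ucal (U : K → K → ℝ≥0∞) (x y : K) : ℝ≥0∞ :=
  sInf { c | ∃ L : List K, L.Chain' (fun a b => U a b < ⊤) ∧ L.head? = some x ∧
    L.getLast? = some y ∧ c = pathCost U L }

/-- A nonempty set `A` is an attractor when `𝒰 = 0` inside `A` and `𝒰 > 0` from `A`
to its complement. -/
def IsAttractor (U : K → K → ℝ≥0∞) (A : Set K) : Prop :=
  A.Nonempty ∧ (∀ x ∈ A, ∀ y ∈ A, x ≠ y → Ucal U x y = 0) ∧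
    ∀ x ∈ A, ∀ y ∉ A, 0 < Ucal U x y

end AttractorSetup

namespace AttractorSetup

variable {K : Type*} (U : K → K → ℝ≥0∞)

theorem Ucal_self (x : K) : Ucal U x x = 0 :=
  le_antisymm (sInf_le ⟨[x], List.isChain_singleton x, rfl, rfl, rfl⟩) zero_le

theorem Ucal_le_step_add {a b : K} (hab : U a b < ⊤) (z : K) :
    Ucal U a z ≤ U a b + Ucal U b z := by
  conv_rhs => rw [Ucal, ENNReal.add_sInf]
  refine le_iInf₂ ?_
  rintro _ ⟨L, hL, hhead, hlast, rfl⟩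
  match L, hL, hhead, hlast with
  | c :: l, hL, hhead, hlast =>
    obtain rfl : c = b := by simpa using hhead
    exact sInf_le ⟨a :: c :: l, List.isChain_cons_cons.2 ⟨hab, hL⟩, rfl, by simpa using hlast, rfl⟩

theorem Ucal_le_pathCost_add {y : K} (z : K) (L : List K) {x : K}
    (hL : L.IsChain (fun a b => U a b < ⊤)) (hhead : L.head? = some x)
    (hlast : L.getLast? = some y) : Ucal U x z ≤ pathCost U L + Ucal U y z := by
  induction L generalizing x with
  | nil => simp at hhead
  | cons a l ih =>
    obtain rfl : a = x := by simpa using hhead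
    cases l with
    | nil =>
      obtain rfl : a = y := by simpa using hlast
      simp [pathCost]
    | cons b l =>
      rw [List.isChain_cons_cons] at hL
      calc Ucal U a z ≤ U a b + Ucal U b z := Ucal_le_step_add U hL.1 z
        _ ≤ U a b + (pathCost U (b :: l) + Ucal U y z) := by
          gcongr
          exact ih hL.2 rfl (by simpa using hlast)
        _ = pathCost U (a :: b :: l) + Ucal U y z := by rw [pathCost, add_assoc]

theorem Ucal_triangle (x y z : K) : Ucal U x z ≤ Ucal U x y + Ucal U y z := by
  conv_rhs => rw [Ucal, ENNReal.sInf_add]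
  refine le_iInf₂ ?_
  rintro _ ⟨L, hL, hhead, hlast, rfl⟩
  exact Ucal_le_pathCost_add U z L hL hhead hlast

theorem Ucal_eq_zero_trans {x y z : K} (hxy : Ucal U x y = 0) (hyz : Ucal U y z = 0) :
    Ucal U x z = 0 :=
  le_antisymm ((Ucal_triangle U x y z).trans (by simp [hxy, hyz])) zero_le

/-- The preorder in which `x ≤ y` when `y` is reachable from `x` at zero cost. -/
@[reducible] def zeroCostPreorder : Preorder K where
  le x y := Ucal U x y = 0
  le_refl := Ucal_self U
  le_trans _ _ _ := Ucal_eq_zero_trans U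

theorem exists_zero_cost_terminal [Finite K] (y : K) :
    ∃ x, Ucal U y x = 0 ∧ ∀ z, Ucal U x z = 0 → Ucal U z x = 0 := by
  let _ := zeroCostPreorder U
  obtain ⟨x, hyx, hx⟩ := (Set.finite_univ (α := K)).exists_le_maximal (Set.mem_univ y)
  exact ⟨x, hyx, fun z hz => hx.2 (Set.mem_univ z) hz⟩

theorem isAttractor_of_terminal {x : K} (hx : ∀ z, Ucal U x z = 0 → Ucal U z x = 0) :
    IsAttractor U {z | Ucal U x z = 0} :=
  ⟨⟨x, Ucal_self U x⟩, fun a ha _ hb _ => Ucal_eq_zero_trans U (hx a ha) hb,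
    fun _ ha _ hb => pos_iff_ne_zero.2 fun h => hb (Ucal_eq_zero_trans U ha h)⟩

end AttractorSetup

open AttractorSetup in
/-- let `K` be finite and `U : K × K → [0,∞]` with `U(x,x) = ∞` and such
that every state has a preferred successor (some `y ≠ x` with `U(x,y) = 0`). If `𝒜` is
the union of all attractors, then every `y ∈ K` reaches some `x ∈ 𝒜` at zero cost:
`𝒰(y,x) = 0`. -/
theorem statement3 {K : Type*} [Fintype K] [Nonempty K] (U : K → K → ℝ≥0∞)
    (hself : ∀ x : K, U x x = ⊤)
    (hsucc : ∀ x : K, ∃ y : K, y ≠ x ∧ U x y = 0) :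
    ∀ y : K, ∃ (A : Set K) (x : K), IsAttractor U A ∧ x ∈ A ∧ Ucal U y x = 0 := by
  intro y
  obtain ⟨x, hyx, hx⟩ := exists_zero_cost_terminal U y
  exact ⟨_, x, isAttractor_of_terminal U hx, Ucal_self U x, hyx⟩
end
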